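/- arXiv:1708.01849 — 6 statements merged into one kernel-verified Lean document; each statement's English description precedes it below -/
import Mathlib

section
/- For every nonnegative integer λ with λ ∉ {1, 3, 5, 9, 11, 15}, there exists a finite 3-free set A of nonnegative integers such that the Stanley sequence S(A) is independent with character λ. -/
/-- A set of nonnegative integers is 3-free if it contains no 3-term
arithmetic progression. -/
def ThreeFree (S : Set ℕ) : Prop :=
  ∀ x ∈ S, ∀ y ∈ S, ∀ z ∈ S, x < y → y < z → x + z ≠ 2 * y

/-- `a` is the Stanley sequence generated by the finite set `A`:
it is strictly increasing, begins with the elements of `A` in increasing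
order, and thereafter each term is chosen greedily as the least integer
exceeding the previous term which keeps the set of terms 3-free. -/
def IsStanleySeq (A : Finset ℕ) (a : ℕ → ℕ) : Prop :=
  StrictMono a ∧
  (∀ i < A.card, a i ∈ A) ∧
  ∀ k, A.card ≤ k + 1 →
    IsLeast {m : ℕ | a k < m ∧ ThreeFree (a '' Set.Iic k ∪ {m})} (a (k + 1))

/-- The sequence `a` is independent with character `lam`. -/
def IndependentWithChar (a : ℕ → ℕ) (lam : ℤ) : Prop :=
  ∃ κ : ℕ, ∀ k, κ ≤ k →
    (∀ i < 2 ^ k, a (2 ^ k + i) = a (2 ^ k) + a i) ∧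
    (a (2 ^ k) : ℤ) = 2 * (a (2 ^ k - 1) : ℤ) - lam + 1

/-- The number whose ternary digits are the binary digits of `n`. -/
def ternaryOfBinary (n : ℕ) : ℕ := Nat.ofDigits 3 (Nat.digits 2 n)

namespace ternaryOfBinary

local notation "τ" => ternaryOfBinary

@[simp] lemma zero : τ 0 = 0 := by simp [ternaryOfBinary]

lemma two_mul_add {r : ℕ} (hr : r < 2) (n : ℕ) : τ (2 * n + r) = 3 * τ n + r := by
  rcases Nat.eq_zero_or_pos (2 * n + r) with h | h
  · obtain ⟨rfl, rfl⟩ : n = 0 ∧ r = 0 := by omega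
    simp
  · unfold ternaryOfBinary
    rw [Nat.digits_def' (by norm_num) h, show (2 * n + r) % 2 = r by omega,
      show (2 * n + r) / 2 = n by omega, Nat.ofDigits_cons]
    ring

lemma two_mul (n : ℕ) : τ (2 * n) = 3 * τ n := two_mul_add (r := 0) (by norm_num) n

lemma two_mul_add_one (n : ℕ) : τ (2 * n + 1) = 3 * τ n + 1 := two_mul_add (by norm_num) n

lemma two_pow_add (j : ℕ) : ∀ {i : ℕ}, i < 2 ^ j → τ (2 ^ j + i) = 3 ^ j + τ i := by
  induction j with
  | zero =>
    intro i hi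
    obtain rfl : i = 0 := by simpa using hi
    simpa using two_mul_add_one 0
  | succ j ih =>
    intro i hi
    have h := ih (i := i / 2) (by rw [pow_succ] at hi; omega)
    have h1 := two_mul_add (Nat.mod_lt i two_pos) (2 ^ j + i / 2)
    have h2 := two_mul_add (Nat.mod_lt i two_pos) (i / 2)
    rw [show 2 * (2 ^ j + i / 2) + i % 2 = 2 ^ (j + 1) + i by rw [pow_succ]; omega] at h1
    rw [Nat.div_add_mod] at h2
    rw [h1, h2, h, pow_succ]
    ring

lemma two_pow (j : ℕ) : τ (2 ^ j) = 3 ^ j := by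
  simpa using two_pow_add j (i := 0) (by positivity)

lemma strictMono : StrictMono τ := by
  have key : ∀ q p, p < q → τ p < τ q := by
    intro q
    induction q using Nat.strong_induction_on with
    | _ q ih =>
      intro p hpq
      have hp := two_mul_add (Nat.mod_lt p two_pos) (p / 2)
      have hq := two_mul_add (Nat.mod_lt q two_pos) (q / 2)
      rw [Nat.div_add_mod] at hp hq
      rcases (show p / 2 ≤ q / 2 by omega).lt_or_eq with h | h
      · have := ih (q / 2) (by omega) _ h
        omega
      · rw [h] at hp
        omega
  exact fun p q => key q p

lemma two_mul_two_pow_sub_one (m : ℕ) : 2 * τ (2 ^ m - 1) + 1 = 3 ^ m := by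
  induction m with
  | zero => simp
  | succ m ih =>
    have : 2 ^ (m + 1) - 1 = 2 * (2 ^ m - 1) + 1 := by
      have := Nat.one_le_two_pow (n := m)
      rw [pow_succ]; omega
    rw [this, two_mul_add_one, pow_succ]
    omega

lemma two_mul_lt {m p : ℕ} (hp : p < 2 ^ m) : 2 * τ p < 3 ^ m := by
  have := strictMono.monotone (show p ≤ 2 ^ m - 1 by omega)
  have := two_mul_two_pow_sub_one m
  omega

lemma free {p q r : ℕ} (h : τ p + τ r = 2 * τ q) : p = q := by
  induction hn : p + q using Nat.strong_induction_on generalizing p q r with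
  | _ n ih =>
    have hp := two_mul_add (Nat.mod_lt p two_pos) (p / 2)
    have hq := two_mul_add (Nat.mod_lt q two_pos) (q / 2)
    have hr := two_mul_add (Nat.mod_lt r two_pos) (r / 2)
    rw [Nat.div_add_mod] at hp hq hr
    by_cases h0 : p + q = 0
    · omega
    · have hdiv : τ (p / 2) + τ (r / 2) = 2 * τ (q / 2) := by omega
      have := ih (p / 2 + q / 2) (by omega) hdiv rfl
      omega

lemma cover (n : ℕ) : ∃ p q, p ≤ q ∧ 2 * τ q = n + τ p := by
  induction n using Nat.strong_induction_on with
  | _ n ih =>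
    rcases Nat.eq_zero_or_pos n with rfl | hn
    · exact ⟨0, 0, le_rfl, by simp⟩
    obtain ⟨p, q, hpq, h⟩ := ih (n / 3) (by omega)
    obtain h3 | h3 | h3 : n % 3 = 0 ∨ n % 3 = 1 ∨ n % 3 = 2 := by omega
    · exact ⟨2 * p, 2 * q, by omega, by rw [two_mul, two_mul]; omega⟩
    · exact ⟨2 * p + 1, 2 * q + 1, by omega, by rw [two_mul_add_one, two_mul_add_one]; omega⟩
    · exact ⟨2 * p, 2 * q + 1, by omega, by rw [two_mul, two_mul_add_one]; omega⟩

lemma cover_lt {n m : ℕ} (hn : n < 3 ^ m) :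
    ∃ p q, p ≤ q ∧ q < 2 ^ m ∧ 2 * τ q = n + τ p := by
  obtain ⟨p, q, hpq, h⟩ := cover n
  refine ⟨p, q, hpq, ?_, h⟩
  rw [← strictMono.lt_iff_lt, two_pow]
  have := strictMono.monotone hpq
  omega

lemma free_mod {m p q r : ℕ} (hp : p < 2 ^ m) (hq : q < 2 ^ m) (hr : r < 2 ^ m)
    (h : τ p + τ r ≡ 2 * τ q [MOD 3 ^ m]) : p = q := by
  have := two_mul_lt hp
  have := two_mul_lt hq
  have := two_mul_lt hr
  exact free (Nat.ModEq.eq_of_lt_of_lt h (by omega) (by omega))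

end ternaryOfBinary

/-- A 3-free set of `2 ^ k` residues modulo `N` containing `0` such that every other residue is
the third term of a progression modulo `N` whose first two terms lie in `A` in increasing order. -/
structure IsModularSet (N k : ℕ) (A : Finset ℕ) : Prop where
  zero_mem : 0 ∈ A
  lt : ∀ x ∈ A, x < N
  card : A.card = 2 ^ k
  free : ∀ x ∈ A, ∀ y ∈ A, ∀ z ∈ A, x + z ≡ 2 * y [MOD N] → x = y
  cover : ∀ x < N, x ∉ A → ∃ y ∈ A, ∃ z ∈ A, y < z ∧ 2 * z ≡ x + y [MOD N]

instance (N k : ℕ) (A : Finset ℕ) : Decidable (IsModularSet N k A) :=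
  decidable_of_iff
    (0 ∈ A ∧ (∀ x ∈ A, x < N) ∧ A.card = 2 ^ k ∧
      (∀ x ∈ A, ∀ y ∈ A, ∀ z ∈ A, x + z ≡ 2 * y [MOD N] → x = y) ∧
      ∀ x < N, x ∉ A → ∃ y ∈ A, ∃ z ∈ A, y < z ∧ 2 * z ≡ x + y [MOD N])
    ⟨fun ⟨h₁, h₂, h₃, h₄, h₅⟩ => ⟨h₁, h₂, h₃, h₄, h₅⟩,
      fun ⟨h₁, h₂, h₃, h₄, h₅⟩ => ⟨h₁, h₂, h₃, h₄, h₅⟩⟩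

/-- `lam` is the character of an independent Stanley sequence. -/
def IsCharacter (lam : ℕ) : Prop :=
  ∃ A : Finset ℕ, A.Nonempty ∧ ThreeFree ↑A ∧
    ∃ a : ℕ → ℕ, IsStanleySeq A a ∧ IndependentWithChar a (lam : ℤ)

namespace IsModularSet

open ternaryOfBinary

local notation "τ" => ternaryOfBinary

variable {N k : ℕ} {A : Finset ℕ}

lemma free_right (h : IsModularSet N k A) {x y z : ℕ} (hx : x ∈ A) (hy : y ∈ A) (hz : z ∈ A)
    (hxyz : x + z ≡ 2 * y [MOD N]) : z = y :=
  h.free z hz y hy x hx (by rwa [add_comm])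

/-- The increasing enumeration of `{x + N * τ q | x ∈ A}`. -/
def seq (h : IsModularSet N k A) (n : ℕ) : ℕ :=
  A.orderEmbOfFin h.card ⟨n % 2 ^ k, Nat.mod_lt _ (by positivity)⟩ + N * τ (n / 2 ^ k)

lemma seq_strictMono (h : IsModularSet N k A) : StrictMono h.seq := by
  intro m n hmn
  unfold seq
  have hm := h.lt _ (A.orderEmbOfFin_mem h.card ⟨m % 2 ^ k, Nat.mod_lt _ (by positivity)⟩)
  rcases (Nat.div_le_div_right (c := 2 ^ k) hmn.le).lt_or_eq with hlt | heq
  · have h1 := Nat.mul_le_mul_left N (Nat.succ_le_of_lt (strictMono hlt))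
    rw [Nat.mul_succ] at h1
    omega
  · rw [heq]
    refine Nat.add_lt_add_right ?_ _
    rw [OrderEmbedding.lt_iff_lt, Fin.mk_lt_mk]
    have h1 := Nat.div_add_mod m (2 ^ k)
    have h2 := Nat.div_add_mod n (2 ^ k)
    rw [heq] at h1
    omega

lemma exists_seq_eq (h : IsModularSet N k A) {x : ℕ} (hx : x ∈ A) (q : ℕ) :
    ∃ n, n / 2 ^ k = q ∧ h.seq n = x + N * τ q := by
  obtain ⟨i, hi⟩ : x ∈ Set.range (A.orderEmbOfFin h.card) := by
    rw [Finset.range_orderEmbOfFin]; exact hx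
  have hk : 0 < 2 ^ k := by positivity
  have hdiv : (i + 2 ^ k * q) / 2 ^ k = q := by
    rw [Nat.add_mul_div_left _ _ hk, Nat.div_eq_of_lt i.2, zero_add]
  have hmod : (i + 2 ^ k * q) % 2 ^ k = i := by
    rw [Nat.add_mul_mod_self_left, Nat.mod_eq_of_lt i.2]
  refine ⟨i + 2 ^ k * q, hdiv, ?_⟩
  unfold seq
  simp only [hdiv, hmod, Fin.eta, hi]

lemma seq_eq (h : IsModularSet N k A) (n : ℕ) : ∃ x ∈ A, h.seq n = x + N * τ (n / 2 ^ k) :=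
  ⟨_, A.orderEmbOfFin_mem h.card _, rfl⟩

lemma threeFree_range_seq (h : IsModularSet N k A) : ThreeFree (Set.range h.seq) := by
  rintro _ ⟨l, rfl⟩ _ ⟨m, rfl⟩ _ ⟨n, rfl⟩ hlm hmn heq
  obtain ⟨x, hx, hl⟩ := h.seq_eq l
  obtain ⟨y, hy, hm⟩ := h.seq_eq m
  obtain ⟨z, hz, hn⟩ := h.seq_eq n
  have hmod : x + z ≡ 2 * y [MOD N] := by
    have : x + z + N * (τ (l / 2 ^ k) + τ (n / 2 ^ k)) = 2 * y + N * (2 * τ (m / 2 ^ k)) := by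
      rw [hl, hm, hn] at heq; linarith
    simpa [Nat.ModEq] using congrArg (· % N) this
  obtain rfl := h.free x hx y hy z hz hmod
  obtain rfl := h.free_right hx hy hz hmod
  have hN : 0 < N := (Nat.zero_le _).trans_lt (h.lt _ hx)
  have : N * (τ (l / 2 ^ k) + τ (n / 2 ^ k)) = N * (2 * τ (m / 2 ^ k)) := by
    rw [hl, hm, hn] at heq; linarith
  rw [hl, hm, ternaryOfBinary.free (Nat.eq_of_mul_eq_mul_left hN this)] at hlm
  exact hlm.false

lemma exists_progression (h : IsModularSet N k A) {m : ℕ} (hNm : N ≤ m)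
    (hm : m ∉ Set.range h.seq) :
    ∃ i j, i < j ∧ h.seq j < m ∧ h.seq i + m = 2 * h.seq j := by
  have hN : 0 < N := (Nat.zero_le _).trans_lt (h.lt _ h.zero_mem)
  suffices ∃ y ∈ A, ∃ z ∈ A, ∃ p q, y + N * τ p < z + N * τ q ∧
      y + N * τ p + m = 2 * (z + N * τ q) by
    obtain ⟨y, hy, z, hz, p, q, hlt, heq⟩ := this
    obtain ⟨i, -, hi⟩ := h.exists_seq_eq hy p
    obtain ⟨j, -, hj⟩ := h.exists_seq_eq hz q
    rw [← hi, ← hj] at hlt heq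
    exact ⟨i, j, h.seq_strictMono.lt_iff_lt.1 hlt, by omega, heq⟩
  have hdm := Nat.div_add_mod m N
  have hxN := Nat.mod_lt m hN
  have hv : 1 ≤ m / N := (Nat.one_le_div_iff hN).2 hNm
  set x := m % N
  set v := m / N
  by_cases hx : x ∈ A
  · obtain ⟨p, q, hpq, hcov⟩ := ternaryOfBinary.cover v
    have hne : p ≠ q := by
      rintro rfl
      obtain ⟨n, -, hn⟩ := h.exists_seq_eq hx p
      exact hm ⟨n, by rw [hn, show τ p = v by omega]; omega⟩
    refine ⟨x, hx, x, hx, p, q, ?_, ?_⟩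
    · have := Nat.mul_lt_mul_of_pos_left (strictMono (lt_of_le_of_ne hpq hne)) hN
      omega
    · have := congrArg (N * ·) hcov
      simp only [mul_add] at this
      linarith
  · obtain ⟨y, hy, z, hz, hyz, hmod⟩ := h.cover x hxN hx
    obtain ⟨c, hc⟩ := (Nat.modEq_iff_dvd.1 hmod.symm)
    have hzN := h.lt z hz
    push_cast at hc
    have hc0 : 0 ≤ c := by
      by_contra hneg
      have : (N : ℤ) * c ≤ N * (-1) := mul_le_mul_of_nonneg_left (by omega) (by omega)
      omega
    have hc1 : c ≤ 1 := by
      by_contra hneg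
      have : (N : ℤ) * 2 ≤ N * c := mul_le_mul_of_nonneg_left (by omega) (by omega)
      omega
    lift c to ℕ using hc0
    obtain ⟨p, q, hpq, hcov⟩ := ternaryOfBinary.cover (v - c)
    refine ⟨y, hy, z, hz, p, q, ?_, ?_⟩
    · have := Nat.mul_le_mul_left N (strictMono.monotone hpq)
      omega
    · have hcov' : 2 * τ q + c = v + τ p := by omega
      have hc' : 2 * z = x + y + N * c := by zify; linarith
      have := congrArg (N * ·) hcov'
      simp only [mul_add] at this
      linarith

lemma isStanleySeq_seq (h : IsModularSet N k A) :
    IsStanleySeq ((Finset.range (2 ^ (k + 1))).image h.seq) h.seq := by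
  have hcard : ((Finset.range (2 ^ (k + 1))).image h.seq).card = 2 ^ (k + 1) := by
    rw [Finset.card_image_of_injective _ h.seq_strictMono.injective, Finset.card_range]
  refine ⟨h.seq_strictMono, fun i hi => ?_, fun n hn => ⟨⟨h.seq_strictMono n.lt_succ_self, ?_⟩, ?_⟩⟩
  · rw [hcard] at hi
    exact Finset.mem_image_of_mem _ (Finset.mem_range.2 hi)
  · have hsub : h.seq '' Set.Iic n ∪ {h.seq (n + 1)} ⊆ Set.range h.seq := by
      rintro _ (⟨i, -, rfl⟩ | rfl) <;> exact ⟨_, rfl⟩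
    exact fun x hx y hy z hz => h.threeFree_range_seq x (hsub hx) y (hsub hy) z (hsub hz)
  · rintro m ⟨hnm, hfree⟩
    by_contra! hlt
    rw [hcard] at hn
    have hNm : N ≤ m := by
      obtain ⟨x, -, hx⟩ := h.seq_eq n
      have hq : 1 ≤ n / 2 ^ k := by
        have := Nat.one_le_two_pow (n := k)
        rw [Nat.one_le_div_iff (by positivity)]
        rw [pow_succ] at hn
        omega
      have h1 := strictMono.monotone hq
      have h2 : τ 1 = 1 := two_pow 0
      have h3 := Nat.le_mul_of_pos_right N (show 0 < τ (n / 2 ^ k) by omega)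
      omega
    have hm : m ∉ Set.range h.seq := by
      rintro ⟨i, rfl⟩
      rw [h.seq_strictMono.lt_iff_lt] at hnm hlt
      omega
    obtain ⟨i, j, hij, hjm, heq⟩ := h.exists_progression hNm hm
    have hjn : j ≤ n := by
      have := h.seq_strictMono.lt_iff_lt.1 (hjm.trans hlt)
      omega
    exact hfree _ (Or.inl ⟨i, by simp; omega, rfl⟩) _ (Or.inl ⟨j, hjn, rfl⟩) m (Or.inr rfl)
      (h.seq_strictMono hij) hjm heq

lemma independentWithChar_seq (h : IsModularSet N k A) {w lam : ℕ} (hw : w ∈ A)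
    (hmax : ∀ x ∈ A, x ≤ w) (hlam : lam + N = 2 * w + 1) :
    IndependentWithChar h.seq (lam : ℤ) := by
  have hk : 0 < 2 ^ k := by positivity
  refine ⟨k, fun j hj => ?_⟩
  obtain ⟨d, rfl⟩ := Nat.exists_eq_add_of_le hj
  have hadd : ∀ i < 2 ^ (k + d), h.seq (2 ^ (k + d) + i) = N * 3 ^ d + h.seq i := by
    intro i hi
    have hdiv : (2 ^ (k + d) + i) / 2 ^ k = 2 ^ d + i / 2 ^ k := by
      rw [pow_add, Nat.mul_add_div hk]
    have hmod : (2 ^ (k + d) + i) % 2 ^ k = i % 2 ^ k := by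
      rw [pow_add, Nat.mul_add_mod]
    have hi' : i / 2 ^ k < 2 ^ d := Nat.div_lt_of_lt_mul (by rwa [← pow_add])
    unfold seq
    simp only [hdiv, hmod, two_pow_add d hi']
    ring
  have h0 : h.seq 0 = 0 := by
    obtain ⟨n, -, hn⟩ := h.exists_seq_eq h.zero_mem 0
    have := h.seq_strictMono.monotone n.zero_le
    rw [zero] at hn
    omega
  have hpow : h.seq (2 ^ (k + d)) = N * 3 ^ d := by
    simpa [h0] using hadd 0 (by positivity)
  refine ⟨fun i hi => by rw [hadd i hi, hpow], ?_⟩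
  have hlast : h.seq (2 ^ (k + d) - 1) = w + N * τ (2 ^ d - 1) := by
    have hd : 1 ≤ 2 ^ d := Nat.one_le_two_pow
    obtain ⟨x, hx, hx'⟩ := h.seq_eq (2 ^ (k + d) - 1)
    obtain ⟨n, hn, hn'⟩ := h.exists_seq_eq hw (2 ^ d - 1)
    have hlt : n < 2 ^ (k + d) := by
      rw [pow_add]
      rw [mul_comm]
      exact (Nat.div_lt_iff_lt_mul hk).1 (by omega)
    have hle := h.seq_strictMono.monotone (show n ≤ 2 ^ (k + d) - 1 by omega)
    have hq : (2 ^ (k + d) - 1) / 2 ^ k ≤ 2 ^ d - 1 := by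
      have : (2 ^ (k + d) - 1) / 2 ^ k < 2 ^ d :=
        Nat.div_lt_of_lt_mul (by rw [← pow_add]; exact Nat.sub_lt (by positivity) one_pos)
      omega
    have h1 := Nat.mul_le_mul_left N (strictMono.monotone hq)
    have := hmax x hx
    omega
  have h3 := two_mul_two_pow_sub_one d
  rw [hpow, hlast]
  zify at h3 hlam
  push_cast
  linear_combination -N * h3 + hlam

theorem isCharacter (h : IsModularSet N k A) {w lam : ℕ} (hw : w ∈ A)
    (hmax : ∀ x ∈ A, x ≤ w) (hlam : lam + N = 2 * w + 1) : IsCharacter lam := by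
  refine ⟨(Finset.range (2 ^ (k + 1))).image h.seq, ?_, ?_, h.seq, h.isStanleySeq_seq,
    h.independentWithChar_seq hw hmax hlam⟩
  · exact (Finset.nonempty_range_iff.2 (by positivity)).image _
  · have hsub : ((Finset.range (2 ^ (k + 1))).image h.seq : Set ℕ) ⊆ Set.range h.seq := by
      rw [Finset.coe_image]
      exact Set.image_subset_range _ _
    exact fun x hx y hy z hz => h.threeFree_range_seq x (hsub hx) y (hsub hy) z (hsub hz)

end IsModularSet

/-- The set obtained from `A` by placing, for every `x ∈ A`, a copy of the numbers with ternary
digits `0, 1` and at most `m` digits above the residue `x` modulo `N`, displaced by `σ x`. -/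
def shiftedSet (N m : ℕ) (σ : ℕ → ℕ) (A : Finset ℕ) : Finset ℕ :=
  (A ×ˢ Finset.range (2 ^ m)).image fun t => t.1 + N * (ternaryOfBinary t.2 + σ t.1)

namespace shiftedSet

open ternaryOfBinary

local notation "τ" => ternaryOfBinary

variable {N k m : ℕ} {σ : ℕ → ℕ} {A : Finset ℕ}

lemma mem_iff {w : ℕ} :
    w ∈ shiftedSet N m σ A ↔ ∃ x ∈ A, ∃ p < 2 ^ m, x + N * (τ p + σ x) = w := by
  simp [shiftedSet, and_assoc]

lemma card (hlt : ∀ x ∈ A, x < N) (hcard : A.card = 2 ^ k) :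
    (shiftedSet N m σ A).card = 2 ^ (k + m) := by
  rw [shiftedSet, Finset.card_image_of_injOn, Finset.card_product, Finset.card_range, hcard,
    pow_add]
  rintro ⟨x, p⟩ hx ⟨y, q⟩ hy hxy
  simp only [Finset.coe_product, Set.mem_prod, Finset.mem_coe] at hx hy
  dsimp only at hxy
  have hxN := hlt x hx.1
  obtain rfl : x = y := by
    have := congrArg (· % N) hxy
    simpa [Nat.mod_eq_of_lt hxN, Nat.mod_eq_of_lt (hlt y hy.1)] using this
  have := Nat.eq_of_mul_eq_mul_left (by omega) (Nat.add_left_cancel hxy)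
  rw [strictMono.injective (Nat.add_right_cancel this)]

lemma free (hlt : ∀ x ∈ A, x < N)
    (hfree : ∀ x ∈ A, ∀ y ∈ A, ∀ z ∈ A, x + z ≡ 2 * y [MOD N] → x = y) :
    ∀ x ∈ shiftedSet N m σ A, ∀ y ∈ shiftedSet N m σ A, ∀ z ∈ shiftedSet N m σ A,
      x + z ≡ 2 * y [MOD N * 3 ^ m] → x = y := by
  intro x' hx' y' hy' z' hz' hmod
  obtain ⟨x, hx, p, hp, rfl⟩ := mem_iff.1 hx'
  obtain ⟨y, hy, q, hq, rfl⟩ := mem_iff.1 hy'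
  obtain ⟨z, hz, r, hr, rfl⟩ := mem_iff.1 hz'
  have hxyz : x + z ≡ 2 * y [MOD N] := by
    have h1 := Nat.ModEq.of_mul_right _ hmod
    rw [show x + N * (τ p + σ x) + (z + N * (τ r + σ z)) =
      x + z + N * (τ p + σ x + (τ r + σ z)) by ring,
      show 2 * (y + N * (τ q + σ y)) = 2 * y + N * (2 * (τ q + σ y)) by ring] at h1
    simpa [Nat.ModEq] using h1
  obtain rfl := hfree x hx y hy z hz hxyz
  obtain rfl := hfree z hz x hx x hx (by rwa [add_comm])
  have h1 : τ p + τ r ≡ 2 * τ q [MOD 3 ^ m] := by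
    rw [show z + N * (τ p + σ z) + (z + N * (τ r + σ z)) =
      N * (τ p + τ r) + (2 * z + N * (2 * σ z)) by ring,
      show 2 * (z + N * (τ q + σ z)) = N * (2 * τ q) + (2 * z + N * (2 * σ z)) by ring] at hmod
    have hN := hlt z hz
    exact Nat.ModEq.mul_left_cancel' (by omega) (Nat.ModEq.add_right_cancel' _ hmod)
  rw [free_mod hp hq hr h1]

lemma lt (hlt : ∀ x ∈ A, x < N) (hσ : ∀ x ∈ A, 2 * σ x < 3 ^ m) :
    ∀ w ∈ shiftedSet N m σ A, w < N * 3 ^ m := by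
  intro w hw
  obtain ⟨x, hx, p, hp, rfl⟩ := mem_iff.1 hw
  have h1 := two_mul_lt hp
  have h2 := hσ x hx
  have h3 := Nat.mul_le_mul_left N (show τ p + σ x + 1 ≤ 3 ^ m by omega)
  have h4 := hlt x hx
  rw [mul_add_one] at h3
  omega

lemma exists_third (σ : ℕ → ℕ) (m v : ℕ) {x y z : ℕ} (hxyz : 2 * z ≡ x + y [MOD N]) :
    ∃ p q, p ≤ q ∧ q < 2 ^ m ∧
      2 * (z + N * (τ q + σ z)) ≡ x + N * v + (y + N * (τ p + σ y)) [MOD N * 3 ^ m] := by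
  obtain ⟨c, hc⟩ := Nat.modEq_iff_dvd.1 hxyz.symm
  have hpos : (0 : ℤ) < 3 ^ m := by positivity
  have hn0 := Int.emod_nonneg (v - c - 2 * σ z + σ y) hpos.ne'
  have hn1 := Int.emod_lt_of_pos (v - c - 2 * σ z + σ y) hpos
  have hdm := Int.emod_add_mul_ediv (v - c - 2 * σ z + σ y) (3 ^ m)
  set e := (v - c - 2 * σ z + σ y : ℤ) / 3 ^ m
  lift (v - c - 2 * σ z + σ y : ℤ) % 3 ^ m to ℕ using hn0 with n
  obtain ⟨p, q, hpq, hq, hcov⟩ := cover_lt (n := n) (m := m) (by exact_mod_cast hn1)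
  refine ⟨p, q, hpq, hq, Nat.modEq_iff_dvd.2 ⟨e, ?_⟩⟩
  zify at hcov
  push_cast at hc ⊢
  linear_combination -hc - N * hcov - N * hdm

theorem isModularSet (h0 : 0 ∈ A) (hlt : ∀ x ∈ A, x < N) (hcard : A.card = 2 ^ k)
    (hfree : ∀ x ∈ A, ∀ y ∈ A, ∀ z ∈ A, x + z ≡ 2 * y [MOD N] → x = y)
    (hσ0 : σ 0 = 0) (hσ : ∀ x ∈ A, 2 * σ x < 3 ^ m)
    (hcover : ∀ x < N, x ∉ A → ∃ y ∈ A, ∃ z ∈ A,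
      (σ y < σ z ∨ σ y ≤ σ z ∧ y < z) ∧ 2 * z ≡ x + y [MOD N]) :
    IsModularSet (N * 3 ^ m) (k + m) (shiftedSet N m σ A) where
  zero_mem := mem_iff.2 ⟨0, h0, 0, by positivity, by simp [hσ0]⟩
  lt := lt hlt hσ
  card := card hlt hcard
  free := free hlt hfree
  cover := by
    intro w hw hwS
    have hN := hlt 0 h0
    have hxN := Nat.mod_lt w hN
    have hdm := Nat.mod_add_div w N
    set x := w % N
    set v := w / N
    by_cases hx : x ∈ A
    · obtain ⟨p, q, hpq, hq, hmod⟩ := exists_third σ m v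
        (show 2 * x ≡ x + x [MOD N] by rw [_root_.two_mul])
      rw [hdm] at hmod
      have hmem {p : ℕ} (hp : p < 2 ^ m) : x + N * (τ p + σ x) ∈ shiftedSet N m σ A :=
        mem_iff.2 ⟨x, hx, p, hp, rfl⟩
      have hne : p ≠ q := by
        rintro rfl
        rw [_root_.two_mul] at hmod
        have := Nat.ModEq.eq_of_lt_of_lt (Nat.ModEq.add_right_cancel' _ hmod)
          (lt hlt hσ _ (hmem hq)) hw
        exact hwS (this ▸ hmem hq)
      refine ⟨_, hmem (hpq.trans_lt hq), _, hmem hq, ?_, hmod⟩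
      have := Nat.mul_lt_mul_of_pos_left (Nat.add_lt_add_right
        (strictMono (lt_of_le_of_ne hpq hne)) (σ x)) hN
      omega
    · obtain ⟨y, hy, z, hz, hyz, hxyz⟩ := hcover x hxN hx
      obtain ⟨p, q, hpq, hq, hmod⟩ := exists_third σ m v hxyz
      rw [hdm] at hmod
      refine ⟨_, mem_iff.2 ⟨y, hy, p, hpq.trans_lt hq, rfl⟩, _, mem_iff.2 ⟨z, hz, q, hq, rfl⟩, ?_,
        hmod⟩
      have hle := strictMono.monotone hpq
      have hyN := hlt y hy
      rcases hyz with hlt' | ⟨hle', hlt'⟩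
      · have := Nat.mul_le_mul_left N (show τ p + σ y + 1 ≤ τ q + σ z by omega)
        rw [mul_add_one] at this
        omega
      · have := Nat.mul_le_mul_left N (show τ p + σ y ≤ τ q + σ z by omega)
        omega

end shiftedSet

/-- A 3-free set `A` of `2 ^ k` residues modulo `N` with a subset `D` containing `a` but not `0`,
such that every other residue is the third term of a progression modulo `N` whose first two terms
lie in `A`, the first one not being `a` and preceding the second one when the elements of `D` are
placed after those of `A \ D`. -/
structure IsPointed (N k a : ℕ) (A D : Finset ℕ) : Prop where
  zero_mem : 0 ∈ A
  lt : ∀ x ∈ A, x < N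
  card : A.card = 2 ^ k
  free : ∀ x ∈ A, ∀ y ∈ A, ∀ z ∈ A, x + z ≡ 2 * y [MOD N] → x = y
  subset : D ⊆ A
  mem : a ∈ D
  zero_notMem : 0 ∉ D
  cover : ∀ x < N, x ∉ A → ∃ y ∈ A, ∃ z ∈ A, y ≠ a ∧
    (y ∉ D ∧ z ∈ D ∨ (y ∈ D ↔ z ∈ D) ∧ y < z) ∧ 2 * z ≡ x + y [MOD N]

set_option synthInstance.maxSize 512 in
set_option synthInstance.maxHeartbeats 100000 in
instance (N k a : ℕ) (A D : Finset ℕ) : Decidable (IsPointed N k a A D) :=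
  decidable_of_iff
    (0 ∈ A ∧ (∀ x ∈ A, x < N) ∧ A.card = 2 ^ k ∧
      (∀ x ∈ A, ∀ y ∈ A, ∀ z ∈ A, x + z ≡ 2 * y [MOD N] → x = y) ∧ D ⊆ A ∧ a ∈ D ∧ 0 ∉ D ∧
      ∀ x < N, x ∉ A → ∃ y ∈ A, ∃ z ∈ A, y ≠ a ∧
        (y ∉ D ∧ z ∈ D ∨ (y ∈ D ↔ z ∈ D) ∧ y < z) ∧ 2 * z ≡ x + y [MOD N])
    ⟨fun ⟨h₁, h₂, h₃, h₄, h₅, h₆, h₇, h₈⟩ => ⟨h₁, h₂, h₃, h₄, h₅, h₆, h₇, h₈⟩,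
      fun ⟨h₁, h₂, h₃, h₄, h₅, h₆, h₇, h₈⟩ => ⟨h₁, h₂, h₃, h₄, h₅, h₆, h₇, h₈⟩⟩

namespace IsPointed

open ternaryOfBinary shiftedSet

local notation "τ" => ternaryOfBinary

variable {N k a : ℕ} {A D : Finset ℕ}

theorem isCharacter (h : IsPointed N k a A D) {s lam : ℕ} (hs : 1 ≤ s)
    (hD : 2 ≤ s ∨ D ⊆ {a}) (hlam : lam + N = 2 * a + 1 + 2 * (N * s)) : IsCharacter lam := by
  have haA := h.subset h.mem
  have ha0 : a ≠ 0 := fun h0 => h.zero_notMem (h0 ▸ h.mem)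
  obtain ⟨m, hm⟩ : ∃ m, 2 * s < 3 ^ m := ⟨2 * s, Nat.lt_pow_self (by norm_num)⟩
  set σ : ℕ → ℕ := fun x => if x = a then s else if x ∈ D then s - 1 else 0 with hσ
  have hσa : σ a = s := if_pos rfl
  have hσne {x : ℕ} (hx : x ≠ a) : σ x ≤ s - 1 := by
    simp only [hσ, if_neg hx]
    split_ifs <;> omega
  have hσD {x : ℕ} (hx : x ∈ D) : 1 ≤ σ x := by
    by_cases hxa : x = a
    · rw [hxa, hσa]; exact hs
    · have : 2 ≤ s := hD.resolve_right fun hsub => hxa (by simpa using hsub hx)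
      simp only [hσ, if_neg hxa, if_pos hx]
      omega
  have hσnot {x : ℕ} (hx : x ∉ D) : σ x = 0 := by
    have hxa : x ≠ a := fun hxa => hx (hxa ▸ h.mem)
    simp only [hσ, if_neg hxa, if_neg hx]
  have hσle (x : ℕ) : σ x ≤ s := by
    by_cases hxa : x = a
    · rw [hxa, hσa]
    · have := hσne hxa
      omega
  have hmod : IsModularSet (N * 3 ^ m) (k + m) (shiftedSet N m σ A) := by
    refine isModularSet h.zero_mem h.lt h.card h.free (hσnot h.zero_notMem)
      (fun x _ => (Nat.mul_le_mul_left 2 (hσle x)).trans_lt hm) fun x hx hxA => ?_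
    obtain ⟨y, hy, z, hz, hya, hyz, hxyz⟩ := h.cover x hx hxA
    refine ⟨y, hy, z, hz, ?_, hxyz⟩
    rcases hyz with ⟨hyD, hzD⟩ | ⟨hiff, hlt⟩
    · exact Or.inl (by rw [hσnot hyD]; exact hσD hzD)
    · refine Or.inr ⟨?_, hlt⟩
      by_cases hzD : z ∈ D
      · have hσy := hσne hya
        by_cases hza : z = a
        · rw [hza, hσa]; omega
        · simp only [hσ, if_neg hza, if_pos hzD]
          exact hσy
      · rw [hσnot (mt hiff.1 hzD)]; exact Nat.zero_le _
  have h3 := two_mul_two_pow_sub_one m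
  have hpow : 1 ≤ 2 ^ m := Nat.one_le_two_pow
  refine hmod.isCharacter (w := a + N * (τ (2 ^ m - 1) + s))
    (shiftedSet.mem_iff.2 ⟨a, haA, 2 ^ m - 1, by omega, by rw [hσa]⟩) ?_ ?_
  · intro w hw
    obtain ⟨x, hx, p, hp, rfl⟩ := shiftedSet.mem_iff.1 hw
    have hle := strictMono.monotone (show p ≤ 2 ^ m - 1 by omega)
    by_cases hxa : x = a
    · rw [hxa, hσa]
      gcongr
    · have h1 := hσne hxa
      have h2 := Nat.mul_le_mul_left N (show τ p + σ x + 1 ≤ τ (2 ^ m - 1) + s by omega)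
      rw [mul_add_one] at h2
      have := h.lt x hx
      omega
  · rw [← h3]
    linarith

end IsPointed

/-- The numbers `3 * x` and `3 * x + δ` for `x ∈ A`. -/
def tripled (δ : ℕ) (A : Finset ℕ) : Finset ℕ :=
  A.image (3 * ·) ∪ A.image (3 * · + δ)

namespace tripled

variable {δ k : ℕ} {A : Finset ℕ}

lemma mem_iff {n : ℕ} : n ∈ tripled δ A ↔ ∃ x ∈ A, n = 3 * x ∨ n = 3 * x + δ := by
  simp only [tripled, Finset.mem_union, Finset.mem_image, ← exists_or, ← and_or_left, eq_comm]

lemma mem_of_mem {x : ℕ} (hx : x ∈ A) : 3 * x ∈ tripled δ A := mem_iff.2 ⟨x, hx, Or.inl rfl⟩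

lemma mem_of_mem_add {x : ℕ} (hx : x ∈ A) : 3 * x + δ ∈ tripled δ A :=
  mem_iff.2 ⟨x, hx, Or.inr rfl⟩

lemma mul_mem_iff (hδ : δ = 1 ∨ δ = 2) {x : ℕ} : 3 * x ∈ tripled δ A ↔ x ∈ A := by
  refine ⟨fun h => ?_, mem_of_mem⟩
  obtain ⟨y, hy, h | h⟩ := mem_iff.1 h <;> obtain rfl : x = y := by omega
  all_goals exact hy

lemma mul_add_mem_iff (hδ : δ = 1 ∨ δ = 2) {x : ℕ} : 3 * x + δ ∈ tripled δ A ↔ x ∈ A := by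
  refine ⟨fun h => ?_, mem_of_mem_add⟩
  obtain ⟨y, hy, h | h⟩ := mem_iff.1 h <;> obtain rfl : x = y := by omega
  all_goals exact hy

lemma mul_add_notMem (hδ : δ = 1 ∨ δ = 2) {x : ℕ} : 3 * x + (3 - δ) ∉ tripled δ A := by
  rw [mem_iff]
  rintro ⟨y, -, h | h⟩ <;> omega

lemma card (hδ : δ = 1 ∨ δ = 2) (hcard : A.card = 2 ^ k) : (tripled δ A).card = 2 ^ (k + 1) := by
  rw [tripled, Finset.card_union_of_disjoint, Finset.card_image_of_injective,
    Finset.card_image_of_injective, hcard, pow_succ, mul_two]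
  · intro x y hxy
    dsimp only at hxy
    omega
  · intro x y hxy
    dsimp only at hxy
    omega
  · simp only [Finset.disjoint_left, Finset.mem_image]
    rintro _ ⟨x, -, rfl⟩ ⟨y, -, h⟩
    omega

lemma free {N : ℕ} (hδ : δ = 1 ∨ δ = 2)
    (hfree : ∀ x ∈ A, ∀ y ∈ A, ∀ z ∈ A, x + z ≡ 2 * y [MOD N] → x = y) :
    ∀ x ∈ tripled δ A, ∀ y ∈ tripled δ A, ∀ z ∈ tripled δ A,
      x + z ≡ 2 * y [MOD 3 * N] → x = y := by
  intro x' hx' y' hy' z' hz' hmod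
  obtain ⟨x, hx, hx'⟩ := mem_iff.1 hx'
  obtain ⟨y, hy, hy'⟩ := mem_iff.1 hy'
  obtain ⟨z, hz, hz'⟩ := mem_iff.1 hz'
  obtain ⟨c, hc⟩ := Nat.modEq_iff_dvd.1 hmod
  push_cast at hc
  rw [mul_assoc] at hc
  obtain rfl := hfree x hx y hy z hz
    (Nat.modEq_iff_dvd.2 ⟨c, by generalize (N : ℤ) * c = t at hc ⊢; push_cast; omega⟩)
  generalize (N : ℤ) * c = t at hc
  omega

end tripled

namespace IsPointed

open tripled

variable {N k a δ : ℕ} {A D : Finset ℕ}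

theorem tripled (h : IsPointed N k a A D) (hδ : δ = 1 ∨ δ = 2) (haN : a + δ < N)
    (haA : a + δ ∉ A) : IsPointed (3 * N) (k + 1) (3 * a) (tripled δ A) (tripled δ D) where
  zero_mem := mem_of_mem (x := 0) h.zero_mem
  lt := by
    intro n hn
    obtain ⟨x, hx, hn⟩ := mem_iff.1 hn
    have := h.lt x hx
    omega
  card := tripled.card hδ h.card
  free := tripled.free hδ h.free
  subset := fun n hn => by
    obtain ⟨x, hx, hn⟩ := mem_iff.1 hn
    exact mem_iff.2 ⟨x, h.subset hx, hn⟩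
  mem := mem_of_mem h.mem
  zero_notMem := (mul_mem_iff hδ (x := 0)).not.2 h.zero_notMem
  cover := by
    have lift {n x y z : ℕ} (hmod : 2 * z ≡ x + y [MOD N]) :
        2 * (3 * z) + n ≡ 3 * x + n + 3 * y [MOD 3 * N] := by
      have := (Nat.ModEq.mul_left' 3 hmod).add_right n
      rw [show 3 * (x + y) + n = 3 * x + n + 3 * y by ring] at this
      rwa [show 2 * (3 * z) = 3 * (2 * z) by ring]
    intro n hn hnA
    obtain ⟨q, hq⟩ : ∃ q, n = 3 * q ∨ n = 3 * q + δ ∨ n = 3 * q + (3 - δ) :=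
      ⟨n / 3, by omega⟩
    rcases hq with rfl | rfl | rfl
    · rw [mul_mem_iff hδ] at hnA
      obtain ⟨y, hy, z, hz, hya, hyz, hmod⟩ := h.cover q (by omega) hnA
      refine ⟨3 * y, mem_of_mem hy, 3 * z, mem_of_mem hz, by omega, ?_, lift (n := 0) hmod⟩
      rw [mul_mem_iff hδ, mul_mem_iff hδ]
      exact hyz.imp_right fun h => ⟨h.1, by omega⟩
    · rw [mul_add_mem_iff hδ] at hnA
      obtain ⟨y, hy, z, hz, hya, hyz, hmod⟩ := h.cover q (by omega) hnA
      refine ⟨3 * y + δ, mem_of_mem_add hy, 3 * z + δ, mem_of_mem_add hz, by omega, ?_, ?_⟩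
      · rw [mul_add_mem_iff hδ, mul_add_mem_iff hδ]
        exact hyz.imp_right fun h => ⟨h.1, by omega⟩
      · have := lift (n := 2 * δ) hmod
        rw [mul_add]
        convert this using 1
        ring
    · obtain ⟨p, hpN, hp⟩ : ∃ p < N, p + δ ≡ q + 1 [MOD N] := by
        rcases Nat.lt_or_ge (q + 1) δ with hqδ | hqδ
        · refine ⟨q + 1 + N - δ, by omega, ?_⟩
          rw [show q + 1 + N - δ + δ = q + 1 + N by omega]
          exact Nat.add_modEq_right
        · exact ⟨q + 1 - δ, by omega, by rw [show q + 1 - δ + δ = q + 1 by omega]⟩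
      obtain ⟨c, hc⟩ := Nat.modEq_iff_dvd.1 hp
      have modEq {u v : ℕ} (t : ℤ) (ht : (v : ℤ) = u + 3 * (N * t)) : u ≡ v [MOD 3 * N] :=
        Nat.modEq_iff_dvd.2 ⟨t, by push_cast; linarith⟩
      by_cases hpA : p ∈ A
      · rcases eq_or_ne p a with rfl | hpa
        · obtain ⟨y, hy, z, hz, hya, hyz, hmod⟩ := h.cover _ haN haA
          refine ⟨3 * y + δ, mem_of_mem_add hy, 3 * z, mem_of_mem hz, by omega, ?_, ?_⟩
          · rw [mul_add_mem_iff hδ, mul_mem_iff hδ]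
            exact hyz.imp_right fun h => ⟨h.1, by omega⟩
          · obtain ⟨d, hd⟩ := Nat.modEq_iff_dvd.1 hmod
            refine modEq (c + d) ?_
            rw [mul_add (N : ℤ)]
            omega
        · refine ⟨3 * p, mem_of_mem hpA, 3 * p + δ, mem_of_mem_add hpA, by omega, ?_, ?_⟩
          · rw [mul_add_mem_iff hδ, mul_mem_iff hδ]
            exact Or.inr ⟨Iff.rfl, by omega⟩
          · exact modEq c (by omega)
      · obtain ⟨y, hy, z, hz, hya, hyz, hmod⟩ := h.cover p hpN hpA
        refine ⟨3 * y, mem_of_mem hy, 3 * z + δ, mem_of_mem_add hz, by omega, ?_, ?_⟩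
        · rw [mul_add_mem_iff hδ, mul_mem_iff hδ]
          exact hyz.imp_right fun h => ⟨h.1, by omega⟩
        · obtain ⟨d, hd⟩ := Nat.modEq_iff_dvd.1 hmod
          refine modEq (c + d) ?_
          rw [mul_add (N : ℤ)]
          omega

end IsPointed

namespace IsPointed

variable {N k a : ℕ} {A D : Finset ℕ}

lemma exists_pow_three_mul (h : IsPointed N k a A D) (haN : a + 1 < N) (haA : a + 1 ∉ A) (j : ℕ) :
    ∃ k' A' D', IsPointed (3 ^ j * N) k' (3 ^ j * a) A' D' ∧
      ∃ δ, (δ = 1 ∨ δ = 2) ∧ 3 ^ j * a + δ < 3 ^ j * N ∧ 3 ^ j * a + δ ∉ A' := by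
  induction j with
  | zero => exact ⟨k, A, D, by simpa using h, 1, Or.inl rfl, by simpa using haN, by simpa using haA⟩
  | succ j ih =>
    obtain ⟨k', A', D', h', δ, hδ, hlt, hnot⟩ := ih
    rw [pow_succ', mul_assoc, mul_assoc]
    exact ⟨_, _, _, h'.tripled hδ hlt hnot, 3 - δ, by omega, by omega,
      tripled.mul_add_notMem hδ⟩

theorem isCharacter_of_pow_three (h : IsPointed N k a A D) (haN : a + 1 < N) (haA : a + 1 ∉ A)
    (j : ℕ) {s lam : ℕ} (hs : 2 ≤ s)
    (hlam : lam + 3 ^ j * N = 3 ^ j * (2 * a + 2 * (N * s)) + 1) : IsCharacter lam := by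
  obtain ⟨_, _, _, h', -⟩ := h.exists_pow_three_mul haN haA j
  exact h'.isCharacter (s := s) (by omega) (Or.inl hs) (by rw [hlam]; ring)

end IsPointed

/-- `lam` arises from a modular set of `2 ^ k` residues modulo `N` with greatest element `w`. -/
lemma isCharacter_of_set (N k w : ℕ) (A : Finset ℕ) {lam : ℕ}
    (h : IsModularSet N k A ∧ w ∈ A ∧ (∀ x ∈ A, x ≤ w) ∧ lam + N = 2 * w + 1) : IsCharacter lam :=
  h.1.isCharacter h.2.1 h.2.2.1 h.2.2.2

lemma isCharacter_of_lt_thirty {lam : ℕ} (h : lam < 30)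
    (hlam : lam ∉ ({1, 3, 5, 9, 11, 15} : Set ℕ)) : IsCharacter lam := by
  simp only [Set.mem_insert_iff, Set.mem_singleton_iff] at hlam
  interval_cases lam <;> try omega
  · exact isCharacter_of_set 1 0 0 {0} (by decide +kernel)
  · exact isCharacter_of_set 3 1 2 {0, 2} (by decide +kernel)
  · exact isCharacter_of_set 9 2 6 {0, 2, 5, 6} (by decide +kernel)
  · exact isCharacter_of_set 9 2 7 {0, 1, 6, 7} (by decide +kernel)
  · exact isCharacter_of_set 10 2 8 {0, 1, 7, 8} (by decide +kernel)
  · exact isCharacter_of_set 9 2 8 {0, 3, 5, 8} (by decide +kernel)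
  · exact isCharacter_of_set 27 3 18 {0, 1, 4, 6, 10, 13, 15, 18} (by decide +kernel)
  · exact isCharacter_of_set 27 3 19 {0, 1, 3, 7, 9, 12, 16, 19} (by decide +kernel)
  · exact isCharacter_of_set 30 3 21 {0, 1, 3, 4, 10, 13, 14, 21} (by decide +kernel)
  · exact isCharacter_of_set 27 3 20 {0, 6, 8, 9, 11, 15, 17, 20} (by decide +kernel)
  · exact isCharacter_of_set 27 3 21 {0, 1, 3, 4, 10, 13, 18, 21} (by decide +kernel)
  · exact isCharacter_of_set 28 3 22 {0, 4, 5, 9, 15, 17, 20, 22} (by decide +kernel)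
  · exact isCharacter_of_set 27 3 22 {0, 1, 3, 4, 9, 12, 19, 22} (by decide +kernel)
  · exact isCharacter_of_set 28 3 23 {0, 1, 3, 4, 19, 20, 22, 23} (by decide +kernel)
  · exact isCharacter_of_set 27 3 23 {0, 2, 3, 9, 11, 12, 14, 23} (by decide +kernel)
  · exact isCharacter_of_set 30 3 25 {0, 1, 3, 4, 21, 22, 24, 25} (by decide +kernel)
  · exact isCharacter_of_set 27 3 24 {0, 1, 4, 6, 10, 13, 18, 24} (by decide +kernel)
  · exact isCharacter_of_set 30 3 26 {0, 7, 9, 10, 16, 17, 19, 26} (by decide +kernel)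
  · exact isCharacter_of_set 27 3 25 {0, 1, 3, 7, 9, 12, 19, 25} (by decide +kernel)
  · exact isCharacter_of_set 32 3 28 {0, 2, 3, 5, 23, 25, 26, 28} (by decide +kernel)
  · exact isCharacter_of_set 27 3 26 {0, 2, 6, 9, 11, 15, 17, 26} (by decide +kernel)
  · exact isCharacter_of_set 30 3 28 {0, 10, 11, 17, 18, 21, 27, 28} (by decide +kernel)
  · exact isCharacter_of_set 31 3 29 {0, 3, 4, 7, 22, 25, 26, 29} (by decide +kernel)
  · exact isCharacter_of_set 30 3 29 {0, 7, 9, 16, 17, 20, 26, 29} (by decide +kernel)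

lemma isCharacter_of_mem_exceptional {lam : ℕ}
    (h : lam ∈ ({31, 37, 41, 45, 49, 53, 55, 61, 69, 82, 85} : Set ℕ)) : IsCharacter lam := by
  simp only [Set.mem_insert_iff, Set.mem_singleton_iff] at h
  obtain rfl | rfl | rfl | rfl | rfl | rfl | rfl | rfl | rfl | rfl | rfl := h
  · exact isCharacter_of_set 34 3 32 {0, 3, 4, 7, 25, 28, 29, 32} (by decide +kernel)
  · exact isCharacter_of_set 84 4 60 {0, 1, 3, 4, 9, 10, 12, 13, 28, 29, 31, 37, 38, 40, 41, 60}
      (by decide +kernel)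
  · exact isCharacter_of_set 90 4 65 {0, 3, 11, 14, 21, 24, 30, 32, 33, 35, 41, 44, 51, 54, 62, 65}
      (by decide +kernel)
  · exact isCharacter_of_set 86 4 65 {0, 1, 16, 17, 19, 20, 29, 30, 35, 36, 45, 46, 48, 49, 64, 65}
      (by decide +kernel)
  · exact isCharacter_of_set 84 4 66 {0, 1, 3, 4, 9, 12, 13, 29, 32, 37, 38, 40, 41, 56, 59, 66}
      (by decide +kernel)
  · exact isCharacter_of_set 84 4 68 {0, 1, 3, 4, 9, 10, 13, 28, 31, 32, 40, 41, 57, 65, 66, 68}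
      (by decide +kernel)
  · exact isCharacter_of_set 82 4 68 {0, 1, 3, 4, 9, 10, 12, 13, 55, 56, 58, 59, 64, 65, 67, 68}
      (by decide +kernel)
  · exact isCharacter_of_set 84 4 72 {0, 5, 13, 18, 24, 28, 29, 33, 39, 41, 44, 46, 52, 57, 67, 72}
      (by decide +kernel)
  · exact isCharacter_of_set 84 4 76 {0, 1, 3, 4, 19, 22, 23, 28, 31, 32, 47, 48, 50, 51, 57, 76}
      (by decide +kernel)
  · exact isCharacter_of_set 85 4 83 {0, 1, 19, 20, 35, 36, 54, 55, 57, 58, 63, 64, 76, 77, 82, 83}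
      (by decide +kernel)
  · exact isCharacter_of_set 86 4 85 {0, 7, 26, 31, 33, 34, 38, 41, 47, 54, 57, 64, 65, 72, 78, 85}
      (by decide +kernel)

lemma exists_isPointed_27 {a : ℕ} (h0 : a ≠ 0) (ha : a < 27) : ∃ A, IsPointed 27 3 a A {a} := by
  interval_cases a <;> try omega
  · exact ⟨{0, 1, 3, 4, 9, 12, 13, 19}, by decide +kernel⟩
  · exact ⟨{0, 2, 3, 5, 9, 12, 14, 20}, by decide +kernel⟩
  · exact ⟨{0, 1, 3, 4, 9, 10, 12, 13}, by decide +kernel⟩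
  · exact ⟨{0, 1, 3, 4, 9, 10, 12, 13}, by decide +kernel⟩
  · exact ⟨{0, 2, 3, 5, 9, 11, 12, 14}, by decide +kernel⟩
  · exact ⟨{0, 6, 14, 15, 17, 18, 23, 26}, by decide +kernel⟩
  · exact ⟨{0, 1, 6, 7, 9, 10, 15, 16}, by decide +kernel⟩
  · exact ⟨{0, 3, 5, 8, 9, 12, 14, 17}, by decide +kernel⟩
  · exact ⟨{0, 1, 3, 4, 9, 10, 13, 21}, by decide +kernel⟩
  · exact ⟨{0, 1, 3, 4, 9, 10, 12, 13}, by decide +kernel⟩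
  · exact ⟨{0, 2, 3, 5, 9, 11, 12, 14}, by decide +kernel⟩
  · exact ⟨{0, 1, 3, 4, 9, 10, 12, 13}, by decide +kernel⟩
  · exact ⟨{0, 1, 3, 4, 9, 10, 12, 13}, by decide +kernel⟩
  · exact ⟨{0, 2, 3, 5, 9, 11, 12, 14}, by decide +kernel⟩
  · exact ⟨{0, 2, 5, 6, 9, 11, 14, 15}, by decide +kernel⟩
  · exact ⟨{0, 3, 4, 7, 9, 12, 13, 16}, by decide +kernel⟩
  · exact ⟨{0, 3, 5, 8, 9, 12, 14, 17}, by decide +kernel⟩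
  · exact ⟨{0, 1, 4, 6, 10, 13, 15, 18}, by decide +kernel⟩
  · exact ⟨{0, 3, 4, 9, 10, 12, 13, 19}, by decide +kernel⟩
  · exact ⟨{0, 3, 5, 9, 11, 12, 14, 20}, by decide +kernel⟩
  · exact ⟨{0, 1, 4, 9, 10, 12, 13, 21}, by decide +kernel⟩
  · exact ⟨{0, 1, 3, 4, 9, 12, 19, 22}, by decide +kernel⟩
  · exact ⟨{0, 2, 3, 9, 11, 12, 14, 23}, by decide +kernel⟩
  · exact ⟨{0, 1, 4, 6, 10, 13, 18, 24}, by decide +kernel⟩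
  · exact ⟨{0, 1, 3, 7, 9, 12, 19, 25}, by decide +kernel⟩
  · exact ⟨{0, 2, 6, 9, 11, 15, 17, 26}, by decide +kernel⟩

lemma exists_isPointed_30 {a : ℕ} (ha : a < 30)
    (hne : a ∉ ({0, 15, 3, 5, 7, 9, 11, 12, 19, 27} : Set ℕ)) : ∃ A, IsPointed 30 3 a A {a} := by
  simp only [Set.mem_insert_iff, Set.mem_singleton_iff] at hne
  interval_cases a <;> try omega
  · exact ⟨{0, 1, 3, 7, 10, 21, 24, 28}, by decide +kernel⟩
  · exact ⟨{0, 2, 9, 10, 13, 19, 22, 23}, by decide +kernel⟩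
  · exact ⟨{0, 3, 4, 11, 14, 20, 21, 23}, by decide +kernel⟩
  · exact ⟨{0, 6, 7, 9, 10, 17, 19, 26}, by decide +kernel⟩
  · exact ⟨{0, 1, 7, 8, 10, 11, 17, 18}, by decide +kernel⟩
  · exact ⟨{0, 7, 8, 10, 11, 17, 18, 21}, by decide +kernel⟩
  · exact ⟨{0, 3, 9, 12, 13, 20, 22, 29}, by decide +kernel⟩
  · exact ⟨{0, 1, 3, 4, 10, 13, 14, 21}, by decide +kernel⟩
  · exact ⟨{0, 7, 9, 10, 16, 17, 19, 26}, by decide +kernel⟩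
  · exact ⟨{0, 1, 7, 8, 10, 11, 17, 18}, by decide +kernel⟩
  · exact ⟨{0, 1, 7, 8, 10, 11, 17, 18}, by decide +kernel⟩
  · exact ⟨{0, 1, 3, 4, 11, 14, 20, 23}, by decide +kernel⟩
  · exact ⟨{0, 1, 3, 4, 10, 13, 14, 21}, by decide +kernel⟩
  · exact ⟨{0, 9, 10, 12, 13, 19, 22, 23}, by decide +kernel⟩
  · exact ⟨{0, 1, 3, 4, 11, 14, 20, 23}, by decide +kernel⟩
  · exact ⟨{0, 3, 10, 11, 13, 14, 21, 24}, by decide +kernel⟩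
  · exact ⟨{0, 1, 3, 4, 21, 22, 24, 25}, by decide +kernel⟩
  · exact ⟨{0, 7, 9, 10, 16, 17, 19, 26}, by decide +kernel⟩
  · exact ⟨{0, 10, 11, 17, 18, 21, 27, 28}, by decide +kernel⟩
  · exact ⟨{0, 7, 9, 16, 17, 20, 26, 29}, by decide +kernel⟩

lemma exists_isPointed_30_of_mem {a : ℕ} (ha : a ∈ ({3, 5, 7, 9, 11, 12, 19, 27} : Set ℕ)) :
    ∃ A D, IsPointed 30 3 a A D := by
  simp only [Set.mem_insert_iff, Set.mem_singleton_iff] at ha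
  obtain rfl | rfl | rfl | rfl | rfl | rfl | rfl | rfl := ha
  · exact ⟨{0, 1, 3, 11, 13, 14, 20, 24}, {1, 3, 14, 20}, by decide +kernel⟩
  · exact ⟨{0, 2, 3, 5, 11, 14, 21, 24}, {2, 5}, by decide +kernel⟩
  · exact ⟨{0, 3, 4, 7, 9, 12, 13, 16}, {3, 4, 7, 12}, by decide +kernel⟩
  · exact ⟨{0, 6, 7, 9, 10, 17, 19, 26}, {6, 9, 26}, by decide +kernel⟩
  · exact ⟨{0, 1, 3, 4, 10, 11, 13, 14}, {1, 4, 10, 11, 14}, by decide +kernel⟩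
  · exact ⟨{0, 1, 3, 4, 9, 10, 12, 13}, {1, 3, 4, 12}, by decide +kernel⟩
  · exact ⟨{0, 3, 7, 9, 10, 12, 16, 19}, {3, 10, 12, 19}, by decide +kernel⟩
  · exact ⟨{0, 1, 8, 10, 11, 17, 18, 27}, {8, 10, 18, 27}, by decide +kernel⟩

lemma isCharacter_of_family (N a : ℕ) (A D : Finset ℕ) (s j : ℕ)
    (h : IsPointed N 3 a A D ∧ a + 1 < N ∧ a + 1 ∉ A) (hs : 2 ≤ s) {c lam : ℕ}
    (hc : c + N = 2 * a + 2 * (N * s)) (hlam : lam = 3 ^ j * c + 1) : IsCharacter lam := by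
  refine h.1.isCharacter_of_pow_three h.2.1 h.2.2 j hs ?_
  rw [hlam]
  linear_combination 3 ^ j * hc

lemma isCharacter_27_mul_add_one (i : ℕ) {u : ℕ} (hodd : u % 2 = 1) (hu : ¬ 3 ∣ u) :
    IsCharacter (27 * (3 ^ i * u) + 1) := by
  obtain h | h | h : u = 1 ∨ (∃ s, 1 ≤ s ∧ u + 1 = 6 * s) ∨ ∃ s, 1 ≤ s ∧ u = 6 * s + 1 := by
    have h6 : u % 6 = 1 ∨ u % 6 = 5 := by omega
    by_cases hu1 : u = 1
    · exact Or.inl hu1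
    rcases h6 with h | h
    · exact Or.inr (Or.inr ⟨u / 6, by omega, by omega⟩)
    · exact Or.inr (Or.inl ⟨u / 6 + 1, by omega, by omega⟩)
  · subst h
    rcases i with - | - | i
    · exact isCharacter_of_lt_thirty (by norm_num) (by norm_num)
    · exact isCharacter_of_mem_exceptional (by norm_num)
    · exact isCharacter_of_family 29 20 {0, 1, 3, 4, 13, 14, 19, 20} {1, 3, 4, 20}
        4 i (by decide +kernel) (by norm_num)
        (c := 243) rfl (by ring)
  · obtain ⟨s, hs, hus⟩ := h
    rcases hs.eq_or_lt with rfl | hs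
    · obtain rfl : u = 5 := by omega
      exact isCharacter_of_family 29 24 {0, 2, 6, 8, 18, 20, 24, 26} {8, 24, 26}
        2 i (by decide +kernel) (by norm_num)
        (c := 135) rfl (by ring)
    · exact isCharacter_of_family 27 9 {0, 1, 3, 4, 9, 12, 13, 19} {1, 3, 4, 9, 12, 13}
        s (i + 1) (by decide +kernel) hs
        (c := 9 * u) (by omega) (by ring)
  · obtain ⟨s, hs, rfl⟩ := h
    rcases hs.eq_or_lt with rfl | hs
    · exact isCharacter_of_family 29 22 {0, 4, 6, 10, 17, 18, 21, 22} {4, 10, 22}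
        3 i (by decide +kernel) (by norm_num)
        (c := 189) rfl (by ring)
    · exact isCharacter_of_family 27 18 {0, 14, 15, 17, 18, 23, 24, 26} {18}
        s (i + 1) (by decide +kernel) hs
        (c := 9 * (6 * s + 1)) (by omega) (by ring)

lemma isCharacter_30_mul_add_one (i : ℕ) {u : ℕ} (hu : ¬ 3 ∣ u) :
    IsCharacter (30 * (3 ^ i * u) + 1) := by
  obtain h | h | ⟨s, hs, h⟩ : u = 1 ∨ u = 2 ∨
      ∃ s, 1 ≤ s ∧ (u + 2 = 6 * s ∨ u + 1 = 6 * s ∨ u = 6 * s + 1 ∨ u = 6 * s + 2) := by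
    by_cases hu2 : u ≤ 2
    · omega
    · exact Or.inr (Or.inr ⟨(u + 2) / 6, by omega, by omega⟩)
  · subst h
    rcases i with - | i
    · exact isCharacter_of_mem_exceptional (by norm_num)
    · exact isCharacter_of_family 28 3 {0, 3, 5, 11, 15, 16, 20, 26} {3, 5, 20}
        2 i (by decide +kernel) (by norm_num)
        (c := 90) rfl (by ring)
  · subst h
    rcases i with - | i
    · exact isCharacter_of_mem_exceptional (by norm_num)
    · exact isCharacter_of_family 28 20 {0, 1, 3, 4, 19, 20, 22, 23} {1, 3, 19, 20, 22, 23}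
        3 i (by decide +kernel) (by norm_num)
        (c := 180) rfl (by ring)
  obtain h | h | h | h := h
  · rcases hs.eq_or_lt with rfl | hs
    · obtain rfl : u = 4 := by omega
      exact isCharacter_of_family 28 18 {0, 2, 5, 7, 13, 17, 18, 22} {2, 7, 13, 18}
        2 i (by decide +kernel) (by norm_num)
        (c := 120) rfl (by ring)
    · exact isCharacter_of_family 30 5 {0, 2, 3, 5, 11, 14, 21, 24} {2, 5, 24}
        s (i + 1) (by decide +kernel) hs
        (c := 10 * u) (by omega) (by ring)
  · rcases hs.eq_or_lt with rfl | hs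
    · obtain rfl : u = 5 := by omega
      exact isCharacter_of_family 28 5 {0, 1, 5, 11, 13, 16, 18, 24} {1, 5, 16}
        3 i (by decide +kernel) (by norm_num)
        (c := 150) rfl (by ring)
    · exact isCharacter_of_family 30 10 {0, 2, 9, 10, 13, 19, 22, 23} {2, 10, 19}
        s (i + 1) (by decide +kernel) hs
        (c := 10 * u) (by omega) (by ring)
  · rcases hs.eq_or_lt with rfl | hs
    · obtain rfl : u = 7 := by omega
      exact isCharacter_of_family 28 7 {0, 2, 5, 7, 13, 17, 18, 22} {2, 7, 13, 18}
        4 i (by decide +kernel) (by norm_num)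
        (c := 210) rfl (by ring)
    · exact isCharacter_of_family 30 20 {0, 1, 3, 4, 11, 13, 20, 24} {3, 4, 11, 13, 20}
        s (i + 1) (by decide +kernel) hs
        (c := 10 * u) (by omega) (by ring)
  · rcases hs.eq_or_lt with rfl | hs
    · obtain rfl : u = 8 := by omega
      exact isCharacter_of_family 28 22 {0, 2, 5, 7, 13, 17, 18, 22} {2, 5, 7, 22}
        4 i (by decide +kernel) (by norm_num)
        (c := 240) rfl (by ring)
    · exact isCharacter_of_family 30 25 {0, 3, 9, 12, 13, 16, 22, 25} {3, 12, 16, 25}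
        s (i + 1) (by decide +kernel) hs
        (c := 10 * u) (by omega) (by ring)

lemma isCharacter_of_even {lam : ℕ} (h : 30 ≤ lam) (heven : lam % 2 = 0) : IsCharacter lam := by
  obtain ⟨a, s, ha, hs⟩ : ∃ a s, a < 27 ∧ lam + 26 = 2 * (27 * s + a) :=
    ⟨(lam + 26) / 2 % 27, (lam + 26) / 2 / 27, Nat.mod_lt _ (by norm_num), by omega⟩
  rcases eq_or_ne a 0 with rfl | ha0
  · obtain ⟨i, u, hu, hiu⟩ := Nat.exists_eq_pow_mul_and_not_dvd (n := 2 * s - 1) (by omega) 3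
      (by norm_num)
    have hodd : u % 2 = 1 := by
      have hmod : 3 ^ i * u % 2 = 1 := by omega
      rw [Nat.mul_mod] at hmod
      rcases Nat.mod_two_eq_zero_or_one u with h0 | h1
      · simp [h0] at hmod
      · exact h1
    have := isCharacter_27_mul_add_one i hodd hu
    rwa [← hiu, show 27 * (2 * s - 1) + 1 = lam by omega] at this
  · obtain ⟨A, hA⟩ := exists_isPointed_27 ha0 ha
    exact hA.isCharacter (s := s) (by omega) (Or.inr subset_rfl) (by omega)

lemma isCharacter_of_odd {lam : ℕ} (h : 30 ≤ lam) (hodd : lam % 2 = 1) : IsCharacter lam := by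
  obtain ⟨a, s, ha, hs⟩ : ∃ a s, a < 30 ∧ lam + 29 = 2 * (30 * s + a) :=
    ⟨(lam + 29) / 2 % 30, (lam + 29) / 2 / 30, Nat.mod_lt _ (by norm_num), by omega⟩
  by_cases ha0 : a = 0 ∨ a = 15
  · obtain ⟨i, u, hu, hiu⟩ := Nat.exists_eq_pow_mul_and_not_dvd (n := lam / 30) (by omega) 3
      (by norm_num)
    have := isCharacter_30_mul_add_one i hu
    rwa [← hiu, show 30 * (lam / 30) + 1 = lam by omega] at this
  by_cases haF : a ∈ ({3, 5, 7, 9, 11, 12, 19, 27} : Set ℕ)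
  · by_cases hs1 : 2 ≤ s
    · obtain ⟨A, D, hA⟩ := exists_isPointed_30_of_mem haF
      exact hA.isCharacter (s := s) (by omega) (Or.inl hs1) (by omega)
    · refine isCharacter_of_mem_exceptional ?_
      simp only [Set.mem_insert_iff, Set.mem_singleton_iff] at haF ⊢
      omega
  · obtain ⟨A, hA⟩ := exists_isPointed_30 ha (by
      simp only [Set.mem_insert_iff, Set.mem_singleton_iff] at haF ⊢
      tauto)
    exact hA.isCharacter (s := s) (by omega) (Or.inr subset_rfl) (by omega)

theorem all_characters (lam : ℕ) (hlam : lam ∉ ({1, 3, 5, 9, 11, 15} : Set ℕ)) :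
    ∃ A : Finset ℕ, A.Nonempty ∧ ThreeFree ↑A ∧
      ∃ a : ℕ → ℕ, IsStanleySeq A a ∧ IndependentWithChar a (lam : ℤ) := by
  change IsCharacter lam
  rcases Nat.lt_or_ge lam 30 with h | h
  · exact isCharacter_of_lt_thirty h hlam
  rcases Nat.mod_two_eq_zero_or_one lam with heven | hodd
  · exact isCharacter_of_even h heven
  · exact isCharacter_of_odd h hodd
end

section
/- For every positive even integer λ, there exists a finite 3-free set A of nonnegative integers such that the Stanley sequence S(A) is independent with character λ. -/
/-- The set of `3 * a` for `a ∈ A` together with the `3 * b + e` for `b ∈ B`. -/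
def interleave (e : ℕ) (A B : Finset ℕ) : Finset ℕ :=
  A.image (3 * ·) ∪ B.image (3 * · + e)

/-- The natural numbers below `3 ^ n` whose ternary digits are all `0` or `1`. -/
def zeroOneDigits : ℕ → Finset ℕ
  | 0 => {0}
  | n + 1 => interleave 1 (zeroOneDigits n) (zeroOneDigits n)

/-- `w` completes, modulo `3 ^ n`, a weakly increasing progression from `A` through `B`. -/
def Reach (n : ℕ) (A B : Finset ℕ) (w : ℤ) : Prop :=
  ∃ a ∈ A, ∃ b ∈ B, a ≤ b ∧ (3 : ℤ) ^ n ∣ 2 * b - a - w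

/-- `w` completes, modulo `3 ^ n`, a strictly increasing progression from `A` through `B`. -/
def StrictReach (n : ℕ) (A B : Finset ℕ) (w : ℤ) : Prop :=
  ∃ a ∈ A, ∃ b ∈ B, a < b ∧ (3 : ℤ) ^ n ∣ 2 * b - a - w

/-- Sets of `2 ^ n` naturals which contain no progression modulo `3 ^ n`, but such that every
residue completes one. -/
structure IsModular (n : ℕ) (A : Finset ℕ) : Prop where
  card : A.card = 2 ^ n
  zero_mem : 0 ∈ A
  free : ∀ a ∈ A, ∀ b ∈ A, ∀ c ∈ A, (3 : ℤ) ^ n ∣ a + c - 2 * b → a = b ∧ b = c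
  cover : ∀ w : ℤ, Reach n A A w

theorem mem_interleave {e : ℕ} {A B : Finset ℕ} {x : ℕ} :
    x ∈ interleave e A B ↔ (∃ a ∈ A, 3 * a = x) ∨ ∃ b ∈ B, 3 * b + e = x := by
  simp [interleave]

theorem mul_three_mem_interleave {e : ℕ} {A B : Finset ℕ} {a : ℕ} (ha : a ∈ A) :
    3 * a ∈ interleave e A B :=
  mem_interleave.2 (Or.inl ⟨a, ha, rfl⟩)

theorem mul_three_add_mem_interleave {e : ℕ} {A B : Finset ℕ} {b : ℕ} (hb : b ∈ B) :
    3 * b + e ∈ interleave e A B :=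
  mem_interleave.2 (Or.inr ⟨b, hb, rfl⟩)

theorem three_pow_dvd_of_succ {n : ℕ} {x y : ℤ} (h : (3 : ℤ) ^ (n + 1) ∣ y) (hxy : y = 3 * x) :
    (3 : ℤ) ^ n ∣ x := by
  obtain ⟨k, hk⟩ := h
  exact ⟨k, by rw [pow_succ] at hk; linarith⟩

theorem three_pow_succ_dvd {n : ℕ} {x y : ℤ} (h : (3 : ℤ) ^ n ∣ x) (hxy : y = 3 * x) :
    (3 : ℤ) ^ (n + 1) ∣ y := by
  obtain ⟨k, hk⟩ := h
  exact ⟨k, by rw [pow_succ]; linarith⟩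

theorem IsModular.interleave {n e : ℕ} {A B : Finset ℕ} (he : e = 1 ∨ e = 2)
    (hA : IsModular n A) (hB : IsModular n B)
    (hAB : ∀ w : ℤ, StrictReach n B A (w + e) ∨ Reach n A B w) :
    IsModular (n + 1) (interleave e A B) where
  card := by
    rw [_root_.interleave, Finset.card_union_of_disjoint,
      Finset.card_image_of_injective _ (fun x y h => by simpa using h),
      Finset.card_image_of_injective _ (fun x y h => by simpa using h), hA.card, hB.card, pow_succ]
    · ring
    · rw [Finset.disjoint_left]
      simp only [Finset.mem_image]
      rintro _ ⟨a, -, rfl⟩ ⟨b, -, h⟩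
      omega
  zero_mem := mul_three_mem_interleave hA.zero_mem
  free := by
    intro x hx y hy z hz h
    have h3 : (3 : ℤ) ∣ x + z - 2 * y := (dvd_pow_self 3 n.succ_ne_zero).trans h
    obtain ⟨a, ha, rfl⟩ | ⟨a, ha, rfl⟩ := mem_interleave.1 hx <;>
    obtain ⟨b, hb, rfl⟩ | ⟨b, hb, rfl⟩ := mem_interleave.1 hy <;>
    obtain ⟨c, hc, rfl⟩ | ⟨c, hc, rfl⟩ := mem_interleave.1 hz <;>
    first
    | (have := hA.free a ha b hb c hc (three_pow_dvd_of_succ h (by push_cast; ring)); omega)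
    | (have := hB.free a ha b hb c hc (three_pow_dvd_of_succ h (by push_cast; ring)); omega)
    | (exfalso; push_cast at h3; omega)
  cover := by
    intro x
    obtain ⟨w, hw⟩ : ∃ w : ℤ, x = 3 * w ∨ x = 3 * w + e ∨ x = 3 * w + 2 * e := by
      rcases he with rfl | rfl
      · exact ⟨x / 3, by omega⟩
      · have : x % 3 = 0 ∨ x % 3 = 1 ∨ x % 3 = 2 := by omega
        rcases this with h | h | h
        · exact ⟨x / 3, by omega⟩
        · exact ⟨x / 3 - 1, by omega⟩
        · exact ⟨x / 3, by omega⟩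
    rcases hw with rfl | rfl | rfl
    · obtain ⟨a, ha, b, hb, hab, h⟩ := hA.cover w
      exact ⟨_, mul_three_mem_interleave ha, _, mul_three_mem_interleave hb, by omega,
        three_pow_succ_dvd h (by push_cast; ring)⟩
    · obtain ⟨a, ha, b, hb, hab, h⟩ := hB.cover w
      exact ⟨_, mul_three_add_mem_interleave ha, _, mul_three_add_mem_interleave hb, by omega,
        three_pow_succ_dvd h (by push_cast; ring)⟩
    · obtain ⟨b, hb, a, ha, hab, h⟩ | ⟨a, ha, b, hb, hab, h⟩ := hAB w
      · exact ⟨_, mul_three_add_mem_interleave hb, _, mul_three_mem_interleave ha, by omega,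
          three_pow_succ_dvd h (by push_cast; ring)⟩
      · exact ⟨_, mul_three_mem_interleave ha, _, mul_three_add_mem_interleave hb, by omega,
          three_pow_succ_dvd h (by push_cast; ring)⟩

theorem isModular_zeroOneDigits (n : ℕ) : IsModular n (zeroOneDigits n) := by
  induction n with
  | zero => exact ⟨rfl, by simp [zeroOneDigits], by simp [zeroOneDigits],
      fun w => ⟨0, by simp [zeroOneDigits], 0, by simp [zeroOneDigits], le_rfl, by simp⟩⟩
  | succ n ih => exact ih.interleave (Or.inl rfl) ih fun w => Or.inr (ih.cover w)

theorem two_mul_lt_of_mem_zeroOneDigits {n t : ℕ} (ht : t ∈ zeroOneDigits n) :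
    2 * t < 3 ^ n := by
  induction n generalizing t with
  | zero => simp_all [zeroOneDigits]
  | succ n ih =>
    rw [pow_succ]
    obtain ⟨a, ha, rfl⟩ | ⟨a, ha, rfl⟩ := mem_interleave.1 ht <;>
    · have := ih ha
      omega

/-- Modular sets interacting well enough with `zeroOneDigits n` that interleaving them with it,
with offset `2`, can be iterated. -/
structure IsStrong (n : ℕ) (A : Finset ℕ) : Prop extends IsModular n A where
  mixed : ∀ w : ℤ, StrictReach n (zeroOneDigits n) A (w + 2) ∨ Reach n A (zeroOneDigits n) w
  mixed_digits : ∀ t ∈ zeroOneDigits n,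
    StrictReach n (zeroOneDigits n) A (t + 1) ∨ Reach n A (zeroOneDigits n) t
  strict_digits : ∀ t ∈ zeroOneDigits n, 3 ∣ t → StrictReach n (zeroOneDigits n) A (t + 1)

theorem mod_three_of_mem_zeroOneDigits {n t : ℕ} (ht : t ∈ zeroOneDigits n) :
    t % 3 = 0 ∨ t % 3 = 1 := by
  cases n with
  | zero => simp_all [zeroOneDigits]
  | succ n =>
    obtain ⟨a, -, rfl⟩ | ⟨a, -, rfl⟩ := mem_interleave.1 ht <;> omega

theorem not_dvd_succ_sub_of_mem_zeroOneDigits {n s t : ℕ} (hs : s ∈ zeroOneDigits n)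
    (ht : t ∈ zeroOneDigits n) (h3 : ¬ 3 ∣ t) : ¬ (3 : ℤ) ^ n ∣ s - (t + 1) := by
  intro h
  have hs' := mod_three_of_mem_zeroOneDigits hs
  have ht' := mod_three_of_mem_zeroOneDigits ht
  cases n with
  | zero => simp_all [zeroOneDigits]
  | succ n =>
    have : (3 : ℤ) ∣ s - (t + 1) := (dvd_pow_self 3 n.succ_ne_zero).trans h
    omega

theorem strictReach_interleave_three_mul_add_one {n : ℕ} (A : Finset ℕ) (w : ℤ) :
    StrictReach (n + 1) (zeroOneDigits (n + 1)) (interleave 2 A (zeroOneDigits n)) (3 * w + 1) := by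
  obtain ⟨t, ht, a, ha, hta, h⟩ := (isModular_zeroOneDigits n).cover (w - 1)
  exact ⟨_, mul_three_mem_interleave ht, _, mul_three_add_mem_interleave ha, by omega,
    three_pow_succ_dvd h (by push_cast; ring)⟩

theorem IsStrong.interleave {n : ℕ} {A : Finset ℕ} (hA : IsStrong n A) :
    IsStrong (n + 1) (interleave 2 A (zeroOneDigits n)) where
  toIsModular := hA.toIsModular.interleave (Or.inr rfl) (isModular_zeroOneDigits n) hA.mixed
  mixed := by
    intro w
    obtain ⟨v, hv⟩ : ∃ v : ℤ, w = 3 * v ∨ w = 3 * v + 1 ∨ w = 3 * v + 2 := ⟨w / 3, by omega⟩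
    rcases hv with rfl | rfl | rfl
    · obtain ⟨x, hx, y, hy, hxy, h⟩ := (isModular_zeroOneDigits n).cover v
      obtain hlt | rfl := hxy.lt_or_eq
      · exact Or.inr ⟨_, mul_three_add_mem_interleave hx, _, mul_three_add_mem_interleave hy,
          by omega, three_pow_succ_dvd h (by push_cast; ring)⟩
      · obtain ⟨t, ht, a, ha, hta, h'⟩ | ⟨a, ha, t, ht, hat, h'⟩ := hA.mixed_digits x hx
        · exact Or.inl ⟨_, mul_three_add_mem_interleave ht, _, mul_three_mem_interleave ha,
            by omega, three_pow_succ_dvd (dvd_add h h') (by push_cast; ring)⟩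
        · exact Or.inr ⟨_, mul_three_mem_interleave ha, _, mul_three_mem_interleave ht,
            by omega, three_pow_succ_dvd (dvd_add h h') (by push_cast; ring)⟩
    · obtain ⟨t, ht, a, ha, hta, h⟩ := (isModular_zeroOneDigits n).cover v
      exact Or.inl ⟨_, mul_three_add_mem_interleave ht, _, mul_three_add_mem_interleave ha,
        by omega, three_pow_succ_dvd h (by push_cast; ring)⟩
    · rw [show 3 * v + 2 + 2 = 3 * (v + 1) + 1 by ring]
      exact Or.inl (strictReach_interleave_three_mul_add_one A _)
  mixed_digits := by
    intro s hs
    obtain ⟨t, ht, rfl⟩ | ⟨t, ht, rfl⟩ := mem_interleave.1 hs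
    · push_cast
      exact Or.inl (strictReach_interleave_three_mul_add_one A _)
    · obtain ⟨x, hx, y, hy, hxy, h⟩ := (isModular_zeroOneDigits n).cover (t + 1)
      obtain hlt | rfl := hxy.lt_or_eq
      · exact Or.inr ⟨_, mul_three_add_mem_interleave hx, _, mul_three_mem_interleave hy,
          by omega, three_pow_succ_dvd h (by push_cast; ring)⟩
      · have h3 : 3 ∣ t := by
          by_contra h3
          refine not_dvd_succ_sub_of_mem_zeroOneDigits hx ht h3 ?_
          convert h using 1
          ring
        obtain ⟨u, hu, a, ha, hua, h'⟩ := hA.strict_digits t ht h3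
        exact Or.inl ⟨_, mul_three_add_mem_interleave hu, _, mul_three_mem_interleave ha,
          by omega, three_pow_succ_dvd h' (by push_cast; ring)⟩
  strict_digits := by
    intro s hs h3
    obtain ⟨t, rfl⟩ := h3
    push_cast
    exact strictReach_interleave_three_mul_add_one A _

/-- Add `k` to the element `M` of `A`. -/
def raiseElem (A : Finset ℕ) (M k : ℕ) : Finset ℕ :=
  A.image fun a => if a = M then M + k else a

theorem add_mem_raiseElem {A : Finset ℕ} {M k : ℕ} (hM : M ∈ A) : M + k ∈ raiseElem A M k :=
  Finset.mem_image.2 ⟨M, hM, if_pos rfl⟩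

theorem mem_raiseElem_of_ne {A : Finset ℕ} {M k a : ℕ} (ha : a ∈ A) (h : a ≠ M) :
    a ∈ raiseElem A M k :=
  Finset.mem_image.2 ⟨a, ha, if_neg h⟩

theorem isGreatest_raiseElem {A : Finset ℕ} {M k : ℕ} (hM : IsGreatest (A : Set ℕ) M) :
    IsGreatest (raiseElem A M k : Set ℕ) (M + k) := by
  refine ⟨add_mem_raiseElem hM.1, fun x hx => ?_⟩
  obtain ⟨a, ha, rfl⟩ := Finset.mem_image.1 hx
  have := hM.2 ha
  split_ifs <;> omega

theorem exists_mem_raiseElem {A : Finset ℕ} {M k n a : ℕ} (hk : 3 ^ n ∣ k) (ha : a ∈ A) :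
    ∃ x ∈ raiseElem A M k, a ≤ x ∧ (3 : ℤ) ^ n ∣ x - a := by
  by_cases h : a = M
  · subst h
    refine ⟨_, add_mem_raiseElem ha, by omega, ?_⟩
    rw [Nat.cast_add, add_sub_cancel_left]
    exact_mod_cast hk
  · exact ⟨a, mem_raiseElem_of_ne ha h, le_rfl, by simp⟩

theorem exists_of_mem_raiseElem {A : Finset ℕ} {M k n x : ℕ} (hk : 3 ^ n ∣ k)
    (hx : x ∈ raiseElem A M k) :
    ∃ a ∈ A, x = (if a = M then M + k else a) ∧ (3 : ℤ) ^ n ∣ x - a := by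
  obtain ⟨a, ha, rfl⟩ := Finset.mem_image.1 hx
  refine ⟨a, ha, rfl, ?_⟩
  split_ifs with h
  · subst h
    rw [Nat.cast_add, add_sub_cancel_left]
    exact_mod_cast hk
  · simp

theorem IsModular.raiseElem {n M k : ℕ} {A : Finset ℕ} (hA : IsModular n A)
    (hM : IsGreatest (A : Set ℕ) M) (hM0 : M ≠ 0) (hk : 3 ^ n ∣ k) :
    IsModular n (raiseElem A M k) where
  card := by
    rw [_root_.raiseElem, Finset.card_image_of_injOn, hA.card]
    intro a ha b hb h
    have h1 := hM.2 ha
    have h2 := hM.2 hb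
    dsimp only at h
    split_ifs at h <;> omega
  zero_mem := mem_raiseElem_of_ne hA.zero_mem hM0.symm
  free := by
    intro x hx y hy z hz h
    obtain ⟨a, ha, hxa, ha'⟩ := exists_of_mem_raiseElem hk hx
    obtain ⟨b, hb, hyb, hb'⟩ := exists_of_mem_raiseElem hk hy
    obtain ⟨c, hc, hzc, hc'⟩ := exists_of_mem_raiseElem hk hz
    have := hA.free a ha b hb c hc (by
      exact (dvd_add (dvd_sub h (dvd_add ha' hc')) (hb'.mul_left 2)).trans (Eq.dvd (by ring)))
    obtain ⟨rfl, rfl⟩ := this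
    exact ⟨hxa.trans hyb.symm, hyb.trans hzc.symm⟩
  cover := by
    intro w
    obtain ⟨a, ha, b, hb, hab, h⟩ := hA.cover w
    obtain ⟨y, hy, hby, hy'⟩ := exists_mem_raiseElem (M := M) hk hb
    by_cases haM : a = M
    · have hbM : b = a := le_antisymm ((hM.2 hb).trans haM.ge) hab
      subst hbM
      refine ⟨y, hy, y, hy, le_rfl, ?_⟩
      exact (dvd_add h hy').trans (Eq.dvd (by ring))
    · refine ⟨a, mem_raiseElem_of_ne ha haM, y, hy, hab.trans hby, ?_⟩
      exact (dvd_add h (hy'.mul_left 2)).trans (Eq.dvd (by ring))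

theorem StrictReach.raiseElem {n M k : ℕ} {T A : Finset ℕ} {w : ℤ} (h : StrictReach n T A w)
    (hk : 3 ^ n ∣ k) : StrictReach n T (raiseElem A M k) w := by
  obtain ⟨t, ht, a, ha, hta, h⟩ := h
  obtain ⟨y, hy, hay, hy'⟩ := exists_mem_raiseElem (M := M) hk ha
  refine ⟨t, ht, y, hy, hta.trans_le hay, ?_⟩
  exact (dvd_add h (hy'.mul_left 2)).trans (Eq.dvd (by ring))

theorem Reach.raiseElem {n M k : ℕ} {T A : Finset ℕ} {w : ℤ} (h : Reach n A T w)
    (hT : ∀ t ∈ T, t < M) : Reach n (raiseElem A M k) T w := by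
  obtain ⟨a, ha, t, ht, hat, h⟩ := h
  exact ⟨a, mem_raiseElem_of_ne ha (hat.trans_lt (hT t ht)).ne, t, ht, hat, h⟩

theorem IsStrong.raiseElem {n M k : ℕ} {A : Finset ℕ} (hA : IsStrong n A)
    (hM : IsGreatest (A : Set ℕ) M) (hT : 3 ^ n ≤ 2 * M) (hk : 3 ^ n ∣ k) :
    IsStrong n (raiseElem A M k) := by
  have hT' : ∀ t ∈ zeroOneDigits n, t < M := fun t ht => by
    have := two_mul_lt_of_mem_zeroOneDigits ht
    omega
  have := pow_pos (show 0 < 3 by norm_num) n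
  exact
    { toIsModular := hA.toIsModular.raiseElem hM (by omega) hk
      mixed := fun w => (hA.mixed w).imp (·.raiseElem hk) (·.raiseElem hT')
      mixed_digits := fun t ht => (hA.mixed_digits t ht).imp (·.raiseElem hk) (·.raiseElem hT')
      strict_digits := fun t ht h3 => (hA.strict_digits t ht h3).raiseElem hk }

theorem forall_int_of_forall_lt {n : ℕ} {p : ℤ → Prop} (hp : ∀ w v, (3 : ℤ) ^ n ∣ w - v → p v → p w)
    (h : ∀ w < 3 ^ n, p (w : ℕ)) (w : ℤ) : p w := by
  have hpos : (0 : ℤ) < 3 ^ n := by positivity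
  obtain ⟨v, hv⟩ := Int.eq_ofNat_of_zero_le (Int.emod_nonneg w hpos.ne')
  refine hp w v ?_ (h v ?_)
  · rw [← hv]
    exact Int.dvd_self_sub_emod
  · have := Int.emod_lt_of_pos w hpos
    rw [hv] at this
    exact_mod_cast this

instance (n : ℕ) (A B : Finset ℕ) (w : ℤ) : Decidable (Reach n A B w) := by
  unfold Reach; infer_instance

instance (n : ℕ) (A B : Finset ℕ) (w : ℤ) : Decidable (StrictReach n A B w) := by
  unfold StrictReach; infer_instance

theorem Reach.of_dvd_sub {n : ℕ} {A B : Finset ℕ} {w v : ℤ} (h : (3 : ℤ) ^ n ∣ w - v)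
    (hv : Reach n A B v) : Reach n A B w := by
  obtain ⟨a, ha, b, hb, hab, hv⟩ := hv
  refine ⟨a, ha, b, hb, hab, ?_⟩
  exact (dvd_sub hv h).trans (Eq.dvd (by ring))

theorem StrictReach.of_dvd_sub {n : ℕ} {A B : Finset ℕ} {w v : ℤ} (h : (3 : ℤ) ^ n ∣ w - v)
    (hv : StrictReach n A B v) : StrictReach n A B w := by
  obtain ⟨a, ha, b, hb, hab, hv⟩ := hv
  refine ⟨a, ha, b, hb, hab, ?_⟩
  exact (dvd_sub hv h).trans (Eq.dvd (by ring))

theorem IsModular.of_forall_lt {n : ℕ} {A : Finset ℕ} (card : A.card = 2 ^ n) (zero_mem : 0 ∈ A)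
    (free : ∀ a ∈ A, ∀ b ∈ A, ∀ c ∈ A, (3 : ℤ) ^ n ∣ a + c - 2 * b → a = b ∧ b = c)
    (cover : ∀ w < 3 ^ n, Reach n A A (w : ℕ)) : IsModular n A :=
  ⟨card, zero_mem, free, forall_int_of_forall_lt (fun _ _ => Reach.of_dvd_sub) cover⟩

theorem IsStrong.of_forall_lt {n : ℕ} {A : Finset ℕ} (hA : IsModular n A)
    (mixed : ∀ w < 3 ^ n, StrictReach n (zeroOneDigits n) A ((w : ℕ) + 2) ∨
      Reach n A (zeroOneDigits n) (w : ℕ))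
    (mixed_digits : ∀ t ∈ zeroOneDigits n,
      StrictReach n (zeroOneDigits n) A (t + 1) ∨ Reach n A (zeroOneDigits n) t)
    (strict_digits : ∀ t ∈ zeroOneDigits n, 3 ∣ t → StrictReach n (zeroOneDigits n) A (t + 1)) :
    IsStrong n A where
  toIsModular := hA
  mixed := forall_int_of_forall_lt
    (p := fun w => StrictReach n (zeroOneDigits n) A (w + 2) ∨ Reach n A (zeroOneDigits n) w)
    (fun _ _ h => Or.imp (StrictReach.of_dvd_sub (by simpa using h)) (Reach.of_dvd_sub h)) mixed
  mixed_digits := mixed_digits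
  strict_digits := strict_digits

theorem isStrong_five : IsStrong 3 {0, 1, 6, 7, 10, 15, 16, 18} :=
  .of_forall_lt
    (.of_forall_lt (by decide +kernel) (by decide +kernel) (by decide +kernel) (by decide +kernel))
    (by decide +kernel) (by decide +kernel) (by decide +kernel)

theorem isStrong_twentyThree : IsStrong 3 {0, 5, 8, 12, 14, 17, 21, 36} :=
  .of_forall_lt
    (.of_forall_lt (by decide +kernel) (by decide +kernel) (by decide +kernel) (by decide +kernel))
    (by decide +kernel) (by decide +kernel) (by decide +kernel)

/-- Some modular set has a greatest element matching the character `2 * s`. -/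
def ExistsModular (s : ℕ) : Prop :=
  ∃ n A M, IsModular n A ∧ IsGreatest (A : Set ℕ) M ∧ 2 * M + 1 = 3 ^ n + 2 * s

/-- Some strong set has a greatest element matching the character `2 * s`. -/
def ExistsStrong (s : ℕ) : Prop :=
  ∃ n A M, IsStrong n A ∧ IsGreatest (A : Set ℕ) M ∧ 2 * M + 1 = 3 ^ n + 2 * s

theorem IsModular.existsModular {n M s : ℕ} {A : Finset ℕ} (hA : IsModular n A)
    (hM : IsGreatest (A : Set ℕ) M) (hM0 : M ≠ 0) (k : ℕ)
    (h : 2 * (M + 3 ^ n * k) + 1 = 3 ^ n + 2 * s) : ExistsModular s :=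
  ⟨n, _, _, hA.raiseElem hM hM0 (dvd_mul_right _ k), isGreatest_raiseElem hM, h⟩

theorem IsStrong.existsStrong {n M s : ℕ} {A : Finset ℕ} (hA : IsStrong n A)
    (hM : IsGreatest (A : Set ℕ) M) (hT : 3 ^ n ≤ 2 * M) (k : ℕ)
    (h : 2 * (M + 3 ^ n * k) + 1 = 3 ^ n + 2 * s) : ExistsStrong s :=
  ⟨n, _, _, hA.raiseElem hM hT (dvd_mul_right _ k), isGreatest_raiseElem hM, h⟩

theorem ExistsStrong.step {s : ℕ} (hs : ExistsStrong (s + 1)) : ExistsStrong (3 * s + 2) := by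
  obtain ⟨n, A, M, hA, hM, h⟩ := hs
  refine ⟨n + 1, _, 3 * M, hA.interleave, ⟨mul_three_mem_interleave hM.1, fun x hx => ?_⟩, ?_⟩
  · obtain ⟨a, ha, rfl⟩ | ⟨t, ht, rfl⟩ := mem_interleave.1 hx
    · have := hM.2 ha
      omega
    · have := two_mul_lt_of_mem_zeroOneDigits ht
      omega
  · rw [pow_succ]
    omega

theorem existsStrong (r : ℕ) : ExistsStrong (9 * r + 5) := by
  induction r using Nat.strong_induction_on with
  | _ r ih =>
    obtain ⟨q, rfl | rfl | rfl⟩ : ∃ q, r = 3 * q ∨ r = 3 * q + 1 ∨ r = 3 * q + 2 :=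
      ⟨r / 3, by omega⟩
    · exact isStrong_five.existsStrong (M := 18)
        ⟨by simp, by simp [upperBounds]⟩ (by norm_num) q (by ring)
    · have := (ih q (by omega)).step
      convert this using 1
      ring
    · exact isStrong_twentyThree.existsStrong (M := 36)
        ⟨by simp, by simp [upperBounds]⟩ (by norm_num) q (by ring)

theorem existsModular (s : ℕ) : ExistsModular s := by
  obtain ⟨q, hq⟩ : ∃ q, s = 3 * q ∨ s = 3 * q + 1 ∨ s = 9 * q + 2 ∨ s = 9 * q + 5 ∨
      s = 9 * q + 8 := by
    have : s % 9 < 9 := Nat.mod_lt _ (by norm_num)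
    by_cases h : s % 3 = 2
    · exact ⟨s / 9, by omega⟩
    · exact ⟨s / 3, by omega⟩
  rcases hq with rfl | rfl | rfl | rfl | rfl
  · exact IsModular.existsModular (n := 1) (A := {0, 1}) (M := 1)
      (.of_forall_lt (by decide) (by decide) (by decide +kernel) (by decide +kernel))
      ⟨by simp, by simp [upperBounds]⟩ (by norm_num) q (by ring)
  · exact IsModular.existsModular (n := 1) (A := {0, 2}) (M := 2)
      (.of_forall_lt (by decide) (by decide) (by decide +kernel) (by decide +kernel))
      ⟨by simp, by simp [upperBounds]⟩ (by norm_num) q (by ring)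
  · exact IsModular.existsModular (n := 2) (A := {0, 2, 5, 6}) (M := 6)
      (.of_forall_lt (by decide) (by decide) (by decide +kernel) (by decide +kernel))
      ⟨by simp, by simp [upperBounds]⟩ (by norm_num) q (by ring)
  · obtain ⟨n, A, M, hA, hM, h⟩ := existsStrong q
    exact ⟨n, A, M, hA.toIsModular, hM, h⟩
  · exact IsModular.existsModular (n := 2) (A := {0, 1, 4, 12}) (M := 12)
      (.of_forall_lt (by decide) (by decide) (by decide +kernel) (by decide +kernel))
      ⟨by simp, by simp [upperBounds]⟩ (by norm_num) q (by ring)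

/-- The sets obtained from `A` by repeatedly adjoining the translate by the current modulus,
starting from the modulus `3 ^ n`. -/
def tower (n : ℕ) (A : Finset ℕ) : ℕ → Finset ℕ
  | 0 => A
  | j + 1 => tower n A j ∪ (tower n A j).image (· + 3 ^ (n + j))

section Tower

variable {n : ℕ} {A : Finset ℕ}

theorem mem_tower_succ {j x : ℕ} :
    x ∈ tower n A (j + 1) ↔ ∃ y ∈ tower n A j, ∃ d ≤ 1, x = y + 3 ^ (n + j) * d := by
  simp only [tower, Finset.mem_union, Finset.mem_image]
  constructor
  · rintro (h | ⟨y, hy, rfl⟩)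
    · exact ⟨x, h, 0, by simp, by simp⟩
    · exact ⟨y, hy, 1, le_rfl, by simp⟩
  · rintro ⟨y, hy, d, hd, rfl⟩
    interval_cases d
    · exact Or.inl (by simpa using hy)
    · exact Or.inr ⟨y, hy, by simp⟩

theorem IsModular.tower (hA : IsModular n A) (j : ℕ) : IsModular (n + j) (tower n A j) := by
  induction j with
  | zero => exact hA
  | succ j ih =>
    have hpos : (0 : ℤ) < 3 ^ (n + j) := by positivity
    refine ⟨?_, mem_tower_succ.2 ⟨0, ih.zero_mem, 0, by simp, by simp⟩, ?_, ?_⟩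
    · rw [_root_.tower, Finset.card_union_of_disjoint,
        Finset.card_image_of_injective _ (add_left_injective _), ih.card, ← add_assoc, pow_succ]
      · ring
      · rw [Finset.disjoint_left]
        intro x hx hx'
        obtain ⟨y, hy, rfl⟩ := Finset.mem_image.1 hx'
        have := (ih.free _ hx _ hy _ hy ⟨1, by push_cast; ring⟩).1
        have : 0 < 3 ^ (n + j) := by positivity
        omega
    · intro x hx y hy z hz h
      obtain ⟨a, ha, s, hs, rfl⟩ := mem_tower_succ.1 hx
      obtain ⟨b, hb, t, ht, rfl⟩ := mem_tower_succ.1 hy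
      obtain ⟨c, hc, u, hu, rfl⟩ := mem_tower_succ.1 hz
      obtain ⟨k, hk⟩ := h
      rw [← add_assoc, pow_succ] at hk
      push_cast at hk
      obtain ⟨rfl, rfl⟩ := ih.free _ ha _ hb _ hc
        ⟨3 * k + 2 * t - s - u, by linear_combination hk⟩
      have : (s : ℤ) + u - 2 * t = 3 * k :=
        mul_left_cancel₀ hpos.ne' (by linear_combination hk)
      have hk0 : k = 0 := by omega
      have hst : s = t := by omega
      have htu : t = u := by omega
      subst hst htu
      exact ⟨rfl, rfl⟩
    · intro w
      obtain ⟨a, ha, b, hb, hab, k, hk⟩ := ih.cover w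
      obtain ⟨q, s, t, hst, ht, hq⟩ : ∃ q : ℤ, ∃ s t : ℕ, s ≤ t ∧ t ≤ 1 ∧ k + 2 * t - s = 3 * q := by
        have : k % 3 = 0 ∨ k % 3 = 1 ∨ k % 3 = 2 := by omega
        rcases this with h | h | h
        · exact ⟨k / 3, 0, 0, by omega⟩
        · exact ⟨k / 3 + 1, 0, 1, by omega⟩
        · exact ⟨k / 3 + 1, 1, 1, by omega⟩
      refine ⟨_, mem_tower_succ.2 ⟨a, ha, s, by omega, rfl⟩,
        _, mem_tower_succ.2 ⟨b, hb, t, ht, rfl⟩, by gcongr, q, ?_⟩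
      rw [← add_assoc, pow_succ]
      push_cast
      linear_combination hk + 3 ^ (n + j) * hq

theorem isGreatest_tower {M s : ℕ} (hM : IsGreatest (A : Set ℕ) M)
    (hs : 2 * M + 1 = 3 ^ n + 2 * s) (j : ℕ) :
    ∃ M', IsGreatest (tower n A j : Set ℕ) M' ∧ 2 * M' + 1 = 3 ^ (n + j) + 2 * s := by
  induction j with
  | zero => exact ⟨M, hM, hs⟩
  | succ j ih =>
    obtain ⟨M', hM', h⟩ := ih
    refine ⟨M' + 3 ^ (n + j) * 1, ⟨mem_tower_succ.2 ⟨M', hM'.1, 1, le_rfl, rfl⟩, ?_⟩, ?_⟩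
    · intro x hx
      obtain ⟨y, hy, d, hd, rfl⟩ := mem_tower_succ.1 hx
      have := hM'.2 hy
      gcongr
    · rw [← add_assoc, pow_succ]
      omega

theorem ExistsModular.exists_lt {s : ℕ} (h : ExistsModular s) :
    ∃ n A M, IsModular n A ∧ IsGreatest (A : Set ℕ) M ∧ 2 * M + 1 = 3 ^ n + 2 * s ∧ M < 3 ^ n := by
  obtain ⟨n, A, M, hA, hM, h⟩ := h
  obtain ⟨M', hM', h'⟩ := isGreatest_tower hM h (2 * s)
  refine ⟨n + 2 * s, _, M', hA.tower (2 * s), hM', h', ?_⟩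
  have : n + 2 * s < 3 ^ (n + 2 * s) := Nat.lt_pow_self (by norm_num)
  omega

theorem tower_mono : Monotone (tower n A) :=
  monotone_nat_of_le_succ fun _ => Finset.subset_union_left

theorem lt_of_mem_tower (hlt : ∀ a ∈ A, a < 3 ^ n) {j x : ℕ} (hx : x ∈ tower n A j) :
    x < 3 ^ (n + j) := by
  induction j generalizing x with
  | zero => exact hlt x hx
  | succ j ih =>
    obtain ⟨y, hy, d, hd, rfl⟩ := mem_tower_succ.1 hx
    have h1 := ih hy
    have h2 : 3 ^ (n + j) * d ≤ 3 ^ (n + j) * 1 := by gcongr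
    rw [← add_assoc, pow_succ]
    omega

theorem mem_tower_of_lt {i j x : ℕ} (hx : x ∈ tower n A i) (hlt : x < 3 ^ (n + j)) :
    x ∈ tower n A j := by
  induction i with
  | zero => exact tower_mono (Nat.zero_le j) hx
  | succ i ih =>
    by_cases hij : i + 1 ≤ j
    · exact tower_mono hij hx
    · obtain ⟨y, hy, d, hd, rfl⟩ := mem_tower_succ.1 hx
      have : 3 ^ (n + j) ≤ 3 ^ (n + i) := Nat.pow_le_pow_right (by norm_num) (by omega)
      obtain rfl : d = 0 := by
        by_contra hd0
        have : 3 ^ (n + i) * 1 ≤ 3 ^ (n + i) * d := by gcongr; omega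
        omega
      exact ih (by simpa using hy)

/-- The union of the sets `tower n A j`. -/
def towerLimit (n : ℕ) (A : Finset ℕ) : Set ℕ :=
  {x | ∃ j, x ∈ tower n A j}

theorem mem_towerLimit_iff {j x : ℕ} (hlt : x < 3 ^ (n + j)) :
    x ∈ towerLimit n A ↔ x ∈ tower n A j :=
  ⟨fun ⟨_, hi⟩ => mem_tower_of_lt hi hlt, fun h => ⟨j, h⟩⟩

theorem add_mem_towerLimit_iff (hlt : ∀ a ∈ A, a < 3 ^ n) {j x : ℕ} (hx : x < 3 ^ (n + j)) :
    3 ^ (n + j) + x ∈ towerLimit n A ↔ x ∈ towerLimit n A := by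
  rw [mem_towerLimit_iff hx, mem_towerLimit_iff (j := j + 1), mem_tower_succ]
  · constructor
    · rintro ⟨y, hy, d, hd, h⟩
      have := lt_of_mem_tower hlt hy
      interval_cases d
      · omega
      · rwa [show x = y by omega]
    · exact fun h => ⟨x, h, 1, le_rfl, by ring⟩
  · rw [← add_assoc, pow_succ]
    omega

theorem IsModular.threeFree_towerLimit (hA : IsModular n A) : ThreeFree (towerLimit n A) := by
  rintro x ⟨i, hx⟩ y ⟨j, hy⟩ z ⟨k, hz⟩ hxy hyz h
  have := (hA.tower (i + j + k)).free x (tower_mono (by omega) hx) y (tower_mono (by omega) hy)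
    z (tower_mono (by omega) hz) ⟨0, by push_cast [mul_zero]; omega⟩
  omega

theorem IsModular.exists_two_mul_eq_add (hA : IsModular n A) (hlt : ∀ a ∈ A, a < 3 ^ n) {m : ℕ}
    (hm : 3 ^ n ≤ m) :
    ∃ a ∈ towerLimit n A, ∃ b ∈ towerLimit n A, a ≤ b ∧ 2 * b = a + m := by
  obtain ⟨j, hj, hj'⟩ : ∃ j, 3 ^ (n + j) ≤ m ∧ m < 3 ^ (n + j + 1) := by
    have hm0 : m ≠ 0 := fun h => by
      have : 0 < 3 ^ n := by positivity
      omega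
    have hn : n ≤ Nat.log 3 m := Nat.le_log_of_pow_le (by norm_num) hm
    refine ⟨Nat.log 3 m - n, ?_, ?_⟩ <;> rw [Nat.add_sub_cancel' hn]
    · exact Nat.pow_log_le_self 3 hm0
    · exact Nat.lt_pow_succ_log_self (by norm_num) m
  obtain ⟨a, ha, b, hb, hab, k, hk⟩ := (hA.tower j).cover m
  have hb' := lt_of_mem_tower hlt hb
  have hpos : 0 < 3 ^ (n + j) := by positivity
  rw [pow_succ] at hj'
  suffices ∃ s t : ℕ, s ≤ t ∧ t ≤ 1 ∧ k + 2 * t - s = 0 by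
    obtain ⟨s, t, hst, ht, h⟩ := this
    refine ⟨_, ⟨j + 1, mem_tower_succ.2 ⟨a, ha, s, by omega, rfl⟩⟩,
      _, ⟨j + 1, mem_tower_succ.2 ⟨b, hb, t, ht, rfl⟩⟩, by gcongr, ?_⟩
    zify
    linear_combination hk + 3 ^ (n + j) * h
  zify at hj hj' hb' hpos hab
  have h1 : -3 < k := by
    by_contra! hcon
    nlinarith
  have h2 : k < 1 := by
    by_contra! hcon
    nlinarith
  have : k = 0 ∨ k = -1 ∨ k = -2 := by omega
  rcases this with rfl | rfl | rfl
  · exact ⟨0, 0, by simp⟩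
  · exact ⟨1, 1, by simp⟩
  · exact ⟨0, 1, by simp⟩

open Classical in
theorem IsModular.count_towerLimit (hA : IsModular n A) (hlt : ∀ a ∈ A, a < 3 ^ n) (j : ℕ) :
    Nat.count (· ∈ towerLimit n A) (3 ^ (n + j)) = 2 ^ (n + j) := by
  rw [Nat.count_eq_card_filter_range, ← (hA.tower j).card]
  congr 1
  ext x
  rw [Finset.mem_filter, Finset.mem_range]
  exact ⟨fun h => (mem_towerLimit_iff h.1).1 h.2, fun h => ⟨lt_of_mem_tower hlt h, j, h⟩⟩

theorem IsModular.pow_mem_towerLimit (hA : IsModular n A) (j : ℕ) :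
    3 ^ (n + j) ∈ towerLimit n A :=
  ⟨j + 1, mem_tower_succ.2 ⟨0, (hA.tower j).zero_mem, 1, le_rfl, by simp⟩⟩

theorem IsModular.infinite_towerLimit (hA : IsModular n A) : (towerLimit n A).Infinite :=
  Set.infinite_of_injective_forall_mem (f := fun j => 3 ^ (n + j))
    (fun i j h => by simpa using h) hA.pow_mem_towerLimit

theorem IsModular.nth_two_pow (hA : IsModular n A) (hlt : ∀ a ∈ A, a < 3 ^ n) (j : ℕ) :
    Nat.nth (· ∈ towerLimit n A) (2 ^ (n + j)) = 3 ^ (n + j) := by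
  classical
  rw [← hA.count_towerLimit hlt j]
  exact Nat.nth_count (hA.pow_mem_towerLimit j)

theorem IsModular.nth_lt (hA : IsModular n A) (hlt : ∀ a ∈ A, a < 3 ^ n) {i j : ℕ}
    (hi : i < 2 ^ (n + j)) : Nat.nth (· ∈ towerLimit n A) i < 3 ^ (n + j) := by
  rw [← hA.nth_two_pow hlt j]
  exact Nat.nth_strictMono hA.infinite_towerLimit hi

theorem IsModular.nth_two_pow_add (hA : IsModular n A) (hlt : ∀ a ∈ A, a < 3 ^ n) {i j : ℕ}
    (hi : i < 2 ^ (n + j)) :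
    Nat.nth (· ∈ towerLimit n A) (2 ^ (n + j) + i) =
      3 ^ (n + j) + Nat.nth (· ∈ towerLimit n A) i := by
  classical
  have hx := hA.nth_lt hlt hi
  have hmem := Nat.nth_mem_of_infinite hA.infinite_towerLimit i
  have hc := Nat.count_nth_of_infinite hA.infinite_towerLimit i
  set x := Nat.nth (· ∈ towerLimit n A) i
  have : Nat.count (· ∈ towerLimit n A) (3 ^ (n + j) + x) = 2 ^ (n + j) + i := by
    rw [Nat.count_add, hA.count_towerLimit hlt, ← hc]
    congr 1
    rw [Nat.count_eq_card_filter_range, Nat.count_eq_card_filter_range]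
    congr 1
    refine Finset.filter_congr fun y hy => add_mem_towerLimit_iff hlt ?_
    exact (Finset.mem_range.1 hy).trans hx
  rw [← this]
  exact Nat.nth_count ((add_mem_towerLimit_iff hlt hx).2 hmem)

theorem IsModular.nth_two_pow_sub_one (hA : IsModular n A) (hlt : ∀ a ∈ A, a < 3 ^ n) {j M : ℕ}
    (hM : IsGreatest (_root_.tower n A j : Set ℕ) M) :
    Nat.nth (· ∈ towerLimit n A) (2 ^ (n + j) - 1) = M := by
  classical
  have hpos : 0 < 2 ^ (n + j) := by positivity
  apply le_antisymm
  · refine hM.2 ((mem_towerLimit_iff ?_).1 (Nat.nth_mem_of_infinite hA.infinite_towerLimit _))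
    exact hA.nth_lt hlt (by omega)
  · have hmem : M ∈ towerLimit n A := ⟨j, hM.1⟩
    rw [← Nat.nth_count (p := (· ∈ towerLimit n A)) hmem]
    refine (Nat.nth_strictMono hA.infinite_towerLimit).monotone (Nat.le_sub_one_of_lt ?_)
    rw [← hA.count_towerLimit hlt j]
    exact Nat.count_strict_mono hmem (lt_of_mem_tower hlt hM.1)

theorem IsModular.independentWithChar (hA : IsModular n A) (hlt : ∀ a ∈ A, a < 3 ^ n) {M s : ℕ}
    (hM : IsGreatest (A : Set ℕ) M) (hs : 2 * M + 1 = 3 ^ n + 2 * s) :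
    IndependentWithChar (Nat.nth (· ∈ towerLimit n A)) (2 * s : ℕ) := by
  refine ⟨n, fun k hk => ?_⟩
  obtain ⟨j, rfl⟩ := Nat.exists_eq_add_of_le hk
  obtain ⟨M', hM', h⟩ := isGreatest_tower hM hs j
  rw [hA.nth_two_pow hlt, hA.nth_two_pow_sub_one hlt hM']
  exact ⟨fun i hi => hA.nth_two_pow_add hlt hi, by omega⟩

theorem IsModular.isStanleySeq (hA : IsModular n A) (hlt : ∀ a ∈ A, a < 3 ^ n) :
    IsStanleySeq (_root_.tower n A 1) (Nat.nth (· ∈ towerLimit n A)) := by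
  classical
  have hmono : StrictMono (Nat.nth (· ∈ towerLimit n A)) :=
    Nat.nth_strictMono hA.infinite_towerLimit
  have hmem : ∀ i, Nat.nth (· ∈ towerLimit n A) i ∈ towerLimit n A :=
    Nat.nth_mem_of_infinite hA.infinite_towerLimit
  rw [IsStanleySeq, (hA.tower 1).card]
  refine ⟨hmono, fun i hi => (mem_towerLimit_iff (hA.nth_lt hlt hi)).1 (hmem i),
    fun k hk => ⟨⟨hmono k.lt_succ_self, ?_⟩, ?_⟩⟩
  · have hsub : Nat.nth (· ∈ towerLimit n A) '' Set.Iic k ∪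
        {Nat.nth (· ∈ towerLimit n A) (k + 1)} ⊆ towerLimit n A := by
      rintro _ (⟨i, -, rfl⟩ | rfl) <;> exact hmem _
    exact fun x hx y hy z hz => hA.threeFree_towerLimit x (hsub hx) y (hsub hy) z (hsub hz)
  · rintro m ⟨hkm, hfree⟩
    by_contra! hmk
    have hinit : ∀ x ∈ towerLimit n A, x < Nat.nth (· ∈ towerLimit n A) (k + 1) →
        x ∈ Nat.nth (· ∈ towerLimit n A) '' Set.Iic k := by
      intro x hx hxk
      rw [← Nat.nth_count (p := (· ∈ towerLimit n A)) hx] at hxk ⊢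
      exact ⟨_, Nat.lt_succ_iff.1 (hmono.lt_iff_lt.1 hxk), rfl⟩
    have hm : 3 ^ n ≤ m := by
      have h1 := hA.nth_two_pow hlt 0
      have hpos : 0 < 2 ^ n := by positivity
      have h2 := hmono.monotone (show 2 ^ (n + 0) ≤ k by
        rw [pow_succ] at hk
        rw [add_zero]
        omega)
      rw [h1, add_zero] at h2
      omega
    obtain ⟨a, ha, b, hb, hab, h⟩ := hA.exists_two_mul_eq_add hlt hm
    obtain rfl | hab := hab.eq_or_lt
    · obtain ⟨i, hi, hia⟩ := hinit a ha (by omega)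
      have := hmono.monotone (Set.mem_Iic.1 hi)
      omega
    · exact hfree a (Or.inl (hinit a ha (by omega))) b (Or.inl (hinit b hb (by omega))) m
        (Or.inr rfl) hab (by omega) h.symm

end Tower

theorem even_characters (lam : ℕ) (hpos : 0 < lam) (heven : Even lam) :
    ∃ A : Finset ℕ, A.Nonempty ∧ ThreeFree ↑A ∧
      ∃ a : ℕ → ℕ, IsStanleySeq A a ∧ IndependentWithChar a (lam : ℤ) := by
  obtain ⟨s, rfl⟩ := heven.two_dvd
  obtain ⟨n, A, M, hA, hM, h, hMn⟩ := (existsModular s).exists_lt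
  have hlt : ∀ a ∈ A, a < 3 ^ n := fun a ha => (hM.2 ha).trans_lt hMn
  refine ⟨tower n A 1, ⟨0, (hA.tower 1).zero_mem⟩, fun x hx y hy z hz => ?_,
    _, hA.isStanleySeq hlt, hA.independentWithChar hlt hM h⟩
  exact hA.threeFree_towerLimit x ⟨1, hx⟩ y ⟨1, hy⟩ z ⟨1, hz⟩
end

section
/- For every odd positive integer λ with λ ∉ {1, 3, 5, 9, 11, 15}, there exists a finite 3-free set A of nonnegative integers such that the Stanley sequence S(A) is independent with character λ. -/
/-- The `n`-th natural number whose ternary expansion only has the digits `0` and `1`. -/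
def ternary (n : ℕ) : ℕ := Nat.ofDigits 3 (Nat.digits 2 n)

theorem ternary_zero : ternary 0 = 0 := by simp [ternary]

theorem ternary_two_mul (n : ℕ) : ternary (2 * n) = 3 * ternary n := by
  rcases Nat.eq_zero_or_pos n with rfl | h
  · simp [ternary]
  · unfold ternary
    rw [Nat.digits_def' (by norm_num) (by omega), Nat.ofDigits_cons]
    simp

theorem ternary_two_mul_add_one (n : ℕ) : ternary (2 * n + 1) = 3 * ternary n + 1 := by
  unfold ternary
  rw [Nat.digits_def' (by norm_num) (by omega), Nat.ofDigits_cons]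
  have h1 : (2 * n + 1) % 2 = 1 := by omega
  have h2 : (2 * n + 1) / 2 = n := by omega
  rw [h1, h2]
  ring

theorem ternary_strictMono : StrictMono ternary := by
  refine strictMono_nat_of_lt_succ fun n => ?_
  induction n using Nat.strong_induction_on with
  | _ n ih =>
    rcases Nat.even_or_odd' n with ⟨m, rfl | rfl⟩
    · rw [ternary_two_mul, ternary_two_mul_add_one]
      omega
    · have h : 2 * m + 1 + 1 = 2 * (m + 1) := by ring
      rw [h, ternary_two_mul, ternary_two_mul_add_one]
      have := ih m (by omega)
      omega

theorem ternary_free (i j k : ℕ) (h : ternary i + ternary k = 2 * ternary j) : i = j := by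
  induction j using Nat.strong_induction_on generalizing i k with
  | _ j ih =>
    rcases Nat.even_or_odd' i with ⟨i', rfl | rfl⟩ <;>
    rcases Nat.even_or_odd' j with ⟨j', rfl | rfl⟩ <;>
    rcases Nat.even_or_odd' k with ⟨k', rfl | rfl⟩ <;>
    simp only [ternary_two_mul, ternary_two_mul_add_one] at h <;> try omega
    · rcases Nat.eq_zero_or_pos j' with rfl | hj
      · have h0 : ternary i' = ternary 0 := by rw [ternary_zero] at h ⊢; omega
        rw [ternary_strictMono.injective h0]
      · rw [ih j' (by omega) i' k' (by omega)]
    · rw [ih j' (by omega) i' k' (by omega)]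

theorem ternary_cover (t : ℕ) : ∃ i j, i ≤ j ∧ ternary i + t = 2 * ternary j := by
  induction t using Nat.strong_induction_on with
  | _ t ih =>
    rcases Nat.eq_zero_or_pos t with rfl | ht
    · exact ⟨0, 0, le_rfl, by simp [ternary_zero]⟩
    · obtain ⟨i, j, hij, h⟩ := ih (t / 3) (by omega)
      have h3 : t % 3 = 0 ∨ t % 3 = 1 ∨ t % 3 = 2 := by omega
      rcases h3 with h3 | h3 | h3
      · refine ⟨2 * i, 2 * j, by omega, ?_⟩
        simp only [ternary_two_mul]
        omega
      · refine ⟨2 * i + 1, 2 * j + 1, by omega, ?_⟩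
        simp only [ternary_two_mul_add_one]
        omega
      · refine ⟨2 * i, 2 * j + 1, by omega, ?_⟩
        simp only [ternary_two_mul, ternary_two_mul_add_one]
        omega

theorem ternary_two_pow_add (m i : ℕ) (hi : i < 2 ^ m) :
    ternary (2 ^ m + i) = 3 ^ m + ternary i := by
  induction m generalizing i with
  | zero =>
    obtain rfl : i = 0 := by simpa using hi
    have h := ternary_two_mul_add_one 0
    simp only [mul_zero, zero_add, ternary_zero] at h
    simp [h, ternary_zero]
  | succ m ih =>
    rw [pow_succ] at hi
    rcases Nat.even_or_odd' i with ⟨j, rfl | rfl⟩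
    · have h : 2 ^ (m + 1) + 2 * j = 2 * (2 ^ m + j) := by ring
      rw [h, ternary_two_mul, ternary_two_mul, ih j (by omega)]
      ring
    · have h : 2 ^ (m + 1) + (2 * j + 1) = 2 * (2 ^ m + j) + 1 := by ring
      rw [h, ternary_two_mul_add_one, ternary_two_mul_add_one, ih j (by omega)]
      ring

theorem two_mul_ternary_two_pow_sub_one (m : ℕ) : 2 * ternary (2 ^ m - 1) + 1 = 3 ^ m := by
  induction m with
  | zero => simp [ternary_zero]
  | succ m ih =>
    have h1 : 1 ≤ 2 ^ m := Nat.one_le_two_pow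
    have h : 2 ^ (m + 1) - 1 = 2 * (2 ^ m - 1) + 1 := by rw [pow_succ]; omega
    rw [h, ternary_two_mul_add_one, pow_succ]
    omega

/-- The values of `f` contain `0`, are pairwise incongruent and free of three-term progressions
modulo `N`, and every other residue continues a progression that starts with two increasing
values of `f`. -/
structure Modular {ι : Type} (N : ℕ) (f : ι → ℕ) : Prop where
  pos : 0 < N
  zero : ∃ i, f i = 0
  free : ∀ i j k, f i + f k ≡ 2 * f j [MOD N] → i = j
  cover : ∀ r, (∃ i, f i ≡ r [MOD N]) ∨ ∃ i j, f i < f j ∧ f i + r ≡ 2 * f j [MOD N]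

namespace Modular

variable {ι : Type} {N : ℕ} {f : ι → ℕ}

theorem inj (h : Modular N f) {i j : ι} (hij : f i ≡ f j [MOD N]) : i = j :=
  h.free i j i (by rw [two_mul]; exact hij.add hij)

theorem injective (h : Modular N f) : Function.Injective f :=
  fun i j hij => h.inj (by rw [hij])

theorem comp_equiv (h : Modular N f) {κ : Type} (e : κ ≃ ι) : Modular N (f ∘ e) where
  pos := h.pos
  zero := by
    obtain ⟨i, hi⟩ := h.zero
    exact ⟨e.symm i, by simpa using hi⟩
  free i j k hijk := e.injective (h.free _ _ _ hijk)
  cover r := by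
    rcases h.cover r with ⟨i, hi⟩ | ⟨i, j, hij, hr⟩
    · exact Or.inl ⟨e.symm i, by simpa using hi⟩
    · exact Or.inr ⟨e.symm i, e.symm j, by simpa using hij, by simpa using hr⟩

end Modular

/-- The sequence of values of `f` repeated along the multiples of `N` by the numbers with ternary
digits `0` and `1`. -/
def blockSeq {n : ℕ} [NeZero n] (N : ℕ) (f : Fin n → ℕ) (j : ℕ) : ℕ :=
  N * ternary (j / n) + f (Fin.ofNat n j)

section BlockSeq

variable {n N : ℕ} [NeZero n] {f : Fin n → ℕ}

theorem blockSeq_mul_add (q : ℕ) (i : Fin n) :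
    blockSeq N f (n * q + i) = N * ternary q + f i := by
  have hn : 0 < n := NeZero.pos n
  have h1 : (n * q + i) / n = q := by
    rw [Nat.mul_add_div hn, Nat.div_eq_of_lt i.2, add_zero]
  have h2 : Fin.ofNat n (n * q + i) = i := by
    apply Fin.ext
    simp [Fin.ofNat, Nat.mod_eq_of_lt i.2]
  rw [blockSeq, h1, h2]

theorem exists_index (n : ℕ) [NeZero n] (j : ℕ) : ∃ q, ∃ i : Fin n, j = n * q + i :=
  ⟨j / n, Fin.ofNat n j, by simp [Fin.ofNat, Nat.div_add_mod]⟩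

theorem blockSeq_strictMono (hf : StrictMono f) (hN : ∀ i, f i < N) :
    StrictMono (blockSeq N f) := by
  intro a b hab
  obtain ⟨q, i, rfl⟩ := exists_index n a
  obtain ⟨p, j, rfl⟩ := exists_index n b
  rw [blockSeq_mul_add, blockSeq_mul_add]
  rcases lt_trichotomy q p with h | rfl | h
  · have h1 := ternary_strictMono h
    have h2 := hN i
    nlinarith
  · have := hf (show i < j from Fin.lt_def.2 (by omega))
    omega
  · have h1 := i.2
    have h2 := j.2
    nlinarith

theorem blockSeq_free (hm : Modular N f) :
    ThreeFree (Set.range (blockSeq N f)) := by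
  rintro _ ⟨a, rfl⟩ _ ⟨b, rfl⟩ _ ⟨c, rfl⟩ hab hbc h
  obtain ⟨q, i, rfl⟩ := exists_index n a
  obtain ⟨p, j, rfl⟩ := exists_index n b
  obtain ⟨r, k, rfl⟩ := exists_index n c
  simp only [blockSeq_mul_add] at h hab hbc
  have hmod : f i + f k ≡ 2 * f j [MOD N] := by
    have e1 : f i + f k ≡ (N * ternary q + f i) + (N * ternary r + f k) [MOD N] := by
      simp [Nat.ModEq, Nat.add_mod]
    have e2 : 2 * f j ≡ 2 * (N * ternary p + f j) [MOD N] := by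
      simp [Nat.ModEq, Nat.mul_mod]
    rw [h] at e1
    exact e1.trans e2.symm
  have hij := hm.free _ _ _ hmod
  have hkj := hm.free k j i (by rwa [add_comm])
  subst hij hkj
  have := ternary_free q p r (by nlinarith [hm.pos])
  subst this
  omega

theorem blockSeq_cover (hm : Modular N f) (hN : ∀ i, f i < N) (m : ℕ) (hmN : N ≤ m)
    (hmem : m ∉ Set.range (blockSeq N f)) :
    ∃ a b, blockSeq N f a < blockSeq N f b ∧ blockSeq N f a + m = 2 * blockSeq N f b := by
  have hpos := hm.pos
  have hdiv := Nat.div_add_mod m N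
  have hlt := Nat.mod_lt m hpos
  have hq : 1 ≤ m / N := (Nat.one_le_div_iff hpos).2 hmN
  set q := m / N
  set r := m % N
  rcases hm.cover r with ⟨i, hi⟩ | ⟨i, j, hij, hr⟩
  · have hir : f i = r := Nat.ModEq.eq_of_lt_of_lt hi (hN i) hlt
    obtain ⟨a, b, hab, h⟩ := ternary_cover q
    rcases hab.lt_or_eq with hab | rfl
    · refine ⟨n * a + i, n * b + i, ?_, ?_⟩
      · rw [blockSeq_mul_add, blockSeq_mul_add]
        have := ternary_strictMono hab
        nlinarith
      · rw [blockSeq_mul_add, blockSeq_mul_add]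
        nlinarith
    · refine absurd ⟨n * a + i, ?_⟩ hmem
      rw [blockSeq_mul_add, show ternary a = q by omega]
      omega
  · have hfi := hN i
    have hfj := hN j
    obtain ⟨c, hc, hcr⟩ : ∃ c, c ≤ 1 ∧ f i + r + N * c = 2 * f j := by
      obtain ⟨c, hc⟩ := (Nat.modEq_iff_dvd.1 hr)
      have h1 : c < 2 := by
        by_contra hcon
        push Not at hcon
        have : (N : ℤ) * 2 ≤ N * c := by gcongr
        push_cast at hc
        omega
      have h0 : -1 < c := by
        by_contra hcon
        push Not at hcon
        have : (N : ℤ) * c ≤ N * (-1) := by gcongr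
        push_cast at hc
        omega
      have hc01 : c = 0 ∨ c = 1 := by omega
      rcases hc01 with rfl | rfl
      · exact ⟨0, by omega, by push_cast at hc; omega⟩
      · exact ⟨1, by omega, by push_cast at hc; omega⟩
    obtain ⟨a, b, hab, h⟩ := ternary_cover (q - c)
    refine ⟨n * a + i, n * b + j, ?_, ?_⟩
    · rw [blockSeq_mul_add, blockSeq_mul_add]
      have := ternary_strictMono.monotone hab
      nlinarith
    · rw [blockSeq_mul_add, blockSeq_mul_add]
      have h' : ternary a + q = 2 * ternary b + c := by omega
      nlinarith

theorem isStanleySeq_blockSeq (hm : Modular N f) (hf : StrictMono f) (hN : ∀ i, f i < N) :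
    IsStanleySeq ((Finset.range (n + 1)).image (blockSeq N f)) (blockSeq N f) := by
  have hmono := blockSeq_strictMono hf hN
  have hcard : ((Finset.range (n + 1)).image (blockSeq N f)).card = n + 1 := by
    rw [Finset.card_image_of_injective _ hmono.injective, Finset.card_range]
  refine ⟨hmono, ?_, ?_⟩
  · intro i hi
    rw [hcard] at hi
    exact Finset.mem_image_of_mem _ (Finset.mem_range.2 hi)
  · intro k hk
    rw [hcard] at hk
    refine ⟨⟨hmono (Nat.lt_succ_self k), ?_⟩, ?_⟩
    · have hsub : blockSeq N f '' Set.Iic k ∪ {blockSeq N f (k + 1)} ⊆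
          Set.range (blockSeq N f) := by
        rintro _ (⟨i, -, rfl⟩ | rfl) <;> exact Set.mem_range_self _
      intro x hx y hy z hz
      exact blockSeq_free hm x (hsub hx) y (hsub hy) z (hsub hz)
    · rintro m ⟨hkm, hfree⟩
      by_contra hlt
      push Not at hlt
      have hmem : m ∉ Set.range (blockSeq N f) := by
        rintro ⟨j, rfl⟩
        have h1 := hmono.lt_iff_lt.1 hkm
        have h2 := hmono.lt_iff_lt.1 hlt
        omega
      have hmN : N ≤ m := by
        have h0 : blockSeq N f (n * 1 + (0 : Fin n)) = N * ternary 1 + f 0 := blockSeq_mul_add 1 0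
        have h1 : ternary 1 = 1 := by simpa [ternary_zero] using ternary_two_mul_add_one 0
        have h2 : n * 1 + ((0 : Fin n) : ℕ) ≤ k := by simp; omega
        have h3 := hmono.monotone h2
        rw [h0, h1] at h3
        omega
      obtain ⟨a, b, hab, h⟩ := blockSeq_cover hm hN m hmN hmem
      have hb : b < k + 1 := hmono.lt_iff_lt.1 (by omega)
      have ha : a < b := hmono.lt_iff_lt.1 hab
      refine hfree _ (Or.inl ⟨a, ?_, rfl⟩) _ (Or.inl ⟨b, ?_, rfl⟩) m (Or.inr rfl) hab (by omega) h
      · exact Set.mem_Iic.2 (by omega)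
      · exact Set.mem_Iic.2 (by omega)

end BlockSeq

theorem independentWithChar_blockSeq {K N s : ℕ} {f : Fin (2 ^ K) → ℕ} (hm : Modular N f)
    (hf : StrictMono f) (t : Fin (2 ^ K)) (ht : ∀ i, f i ≤ f t) (hs : 2 * f t = 2 * s + N) :
    IndependentWithChar (blockSeq N f) ((2 * s + 1 : ℕ) : ℤ) := by
  have hf0 : f 0 = 0 := by
    obtain ⟨i, hi⟩ := hm.zero
    have := hf.monotone (Fin.zero_le i)
    omega
  have hpow : ∀ m, blockSeq N f (2 ^ (K + m)) = N * 3 ^ m := by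
    intro m
    have h : blockSeq N f (2 ^ K * 2 ^ m + (0 : Fin (2 ^ K))) = _ := blockSeq_mul_add (2 ^ m) 0
    have h1 := ternary_two_pow_add m 0 (by positivity)
    simp only [add_zero, ternary_zero] at h1
    simpa [hf0, h1, pow_add] using h
  refine ⟨K, fun k hk => ?_⟩
  obtain ⟨m, rfl⟩ := Nat.exists_eq_add_of_le hk
  refine ⟨fun i hi => ?_, ?_⟩
  · rw [hpow]
    obtain ⟨q, j, rfl⟩ := exists_index (2 ^ K) i
    have hq : q < 2 ^ m := by
      rw [pow_add] at hi
      exact lt_of_mul_lt_mul_left (lt_of_le_of_lt (Nat.le_add_right _ _) hi) (Nat.zero_le _)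
    have h : 2 ^ (K + m) + (2 ^ K * q + j) = 2 ^ K * (2 ^ m + q) + j := by ring
    rw [h, blockSeq_mul_add, blockSeq_mul_add, ternary_two_pow_add m q hq]
    ring
  · have htop : (t : ℕ) = 2 ^ K - 1 := by
      have h1 := ht ⟨2 ^ K - 1, Nat.sub_lt (by positivity) one_pos⟩
      have h2 := Fin.le_def.1 (hf.le_iff_le.1 h1)
      have h3 := t.2
      simp only at h2
      omega
    have hidx : (2 ^ (K + m) - 1 : ℕ) = 2 ^ K * (2 ^ m - 1) + (t : ℕ) := by
      have h1 : 1 ≤ 2 ^ m := Nat.one_le_two_pow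
      have h2 : 1 ≤ 2 ^ K := Nat.one_le_two_pow
      obtain ⟨x, hx⟩ := Nat.exists_eq_add_of_le h1
      rw [htop, pow_add, hx, Nat.add_sub_cancel_left]
      have : 2 ^ K * (1 + x) = 2 ^ K * x + 2 ^ K := by ring
      omega
    rw [hpow, hidx, blockSeq_mul_add]
    have h := two_mul_ternary_two_pow_sub_one m
    have h' : N * 3 ^ m = 2 * (N * ternary (2 ^ m - 1)) + N := by rw [← h]; ring
    rw [h']
    push_cast
    have hs' : (2 * f t : ℤ) = 2 * s + N := by exact_mod_cast hs
    linarith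

theorem exists_modEq_add_mul {M N r n : ℕ} (hM : 0 < M) (hN : 0 < N) (h : r ≡ n [MOD M]) :
    ∃ q, n ≡ r + M * q [MOD M * N] := by
  have hle : r ≤ n + M * N * r := by nlinarith [Nat.mul_pos hM hN]
  have h' : r ≡ n + M * N * r [MOD M] := by
    refine h.trans ?_
    simp [Nat.ModEq, Nat.add_mod, mul_assoc]
  obtain ⟨q, hq⟩ := (Nat.modEq_iff_dvd' hle).1 h'
  refine ⟨q, ?_⟩
  have : r + M * q = n + M * N * r := by omega
  rw [this]
  simp [Nat.ModEq, Nat.add_mod]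

theorem bool_eq_of_modEq (a b c : Bool) (h : a.toNat + c.toNat ≡ 2 * b.toNat [MOD 3]) :
    a = b := by
  revert h
  revert a b c
  decide

namespace Modular

variable {ι : Type} {N : ℕ} {f : ι → ℕ}

theorem append (h : Modular N f) :
    Modular (N * 3) (fun p : ι × Bool => f p.1 + N * p.2.toNat) where
  pos := by have := h.pos; omega
  zero := by
    obtain ⟨i, hi⟩ := h.zero
    exact ⟨(i, false), by simp [hi]⟩
  free := by
    rintro ⟨i, a⟩ ⟨j, b⟩ ⟨k, c⟩ hijk
    simp only at hijk
    have hmod : f i + f k ≡ 2 * f j [MOD N] := by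
      have h1 := Nat.ModEq.of_mul_right 3 hijk
      have h2 : f i + f k ≡ f i + N * a.toNat + (f k + N * c.toNat) [MOD N] := by
        simp [Nat.ModEq, Nat.add_mod]
      have h3 : 2 * f j ≡ 2 * (f j + N * b.toNat) [MOD N] := by
        simp [Nat.ModEq, Nat.mul_mod]
      exact h2.trans (h1.trans h3.symm)
    have hij := h.free i j k hmod
    have hkj := h.free k j i (by rwa [add_comm])
    subst hij hkj
    have h1 : 2 * f k + N * (a.toNat + c.toNat) ≡ 2 * f k + N * (2 * b.toNat) [MOD N * 3] := by
      convert hijk using 1 <;> ring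
    have h2 := (Nat.ModEq.add_left_cancel' _ h1).mul_left_cancel' h.pos.ne'
    rw [bool_eq_of_modEq a b c h2]
  cover := by
    intro n
    have digit : ∀ q : ℕ, ∃ a b : Bool, a ≤ b ∧ a.toNat + q ≡ 2 * b.toNat [MOD 3] := by
      intro q
      have hq : q % 3 = 0 ∨ q % 3 = 1 ∨ q % 3 = 2 := by omega
      rcases hq with hq | hq | hq
      · exact ⟨false, false, le_rfl, by simp [Nat.ModEq, hq]⟩
      · exact ⟨true, true, le_rfl, by simp [Nat.ModEq, Nat.add_mod, hq]⟩
      · exact ⟨false, true, Bool.false_le _, by simp [Nat.ModEq, hq]⟩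
    have lift : ∀ (i j : ι) (q : ℕ) (a b : Bool),
        f i + n + N * q ≡ 2 * f j [MOD N * 3] → a.toNat ≡ 2 * b.toNat + q [MOD 3] →
        f i + N * a.toNat + n ≡ 2 * (f j + N * b.toNat) [MOD N * 3] := by
      intro i j q a b h1 h2
      have h3 := h1.add (h2.mul_left' N)
      refine Nat.ModEq.add_right_cancel' (N * q) ?_
      convert h3 using 1 <;> ring
    have cong : ∀ x y, x ≡ y [MOD N] → ∃ q, x + N * q ≡ y [MOD N * 3] := by
      intro x y hxy
      obtain ⟨q, hq⟩ := exists_modEq_add_mul h.pos (by norm_num : 0 < 3) hxy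
      exact ⟨q, hq.symm⟩
    rcases h.cover n with ⟨i, hi⟩ | ⟨i, j, hij, hr⟩
    · obtain ⟨q, hq⟩ := cong _ _ hi
      have h3 : q % 3 = 0 ∨ q % 3 = 1 ∨ q % 3 = 2 := by omega
      have hmem : ∀ e : Bool, e.toNat ≡ q [MOD 3] → f i + N * e.toNat ≡ n [MOD N * 3] :=
        fun e he => ((he.mul_left' N).add_left _).trans hq
      rcases h3 with h3 | h3 | h3
      · exact Or.inl ⟨(i, false), hmem false (by simp [Nat.ModEq, h3])⟩
      · exact Or.inl ⟨(i, true), hmem true (by simp [Nat.ModEq, h3])⟩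
      · refine Or.inr ⟨(i, false), (i, true), by simpa using h.pos, ?_⟩
        have h4 : f i + N * 2 ≡ n [MOD N * 3] :=
          (((show 2 ≡ q [MOD 3] by simp [Nat.ModEq, h3]).mul_left' N).add_left _).trans hq
        simp only [Bool.toNat_false, Bool.toNat_true]
        convert (h4.symm.add_left (f i)) using 1 <;> ring
    · obtain ⟨q, hq⟩ := cong _ _ hr
      obtain ⟨a, b, hab, h2⟩ := digit (q + q)
      refine Or.inr ⟨(i, a), (j, b), ?_, lift i j q a b hq ?_⟩
      · have : a.toNat ≤ b.toNat := Bool.toNat_le_toNat hab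
        simp only
        nlinarith
      · simp only [Nat.ModEq] at h2 ⊢
        omega

/-- Replacing values by congruent ones preserves modularity as long as increasing pairs remain
increasing. -/
theorem of_modEq (h : Modular N f) {g : ι → ℕ} (hg : ∀ i, g i ≡ f i [MOD N])
    (hzero : ∀ i, f i = 0 → g i = 0) (hlt : ∀ i j, f i < f j → g i < g j) : Modular N g where
  pos := h.pos
  zero := h.zero.imp hzero
  free i j k hijk :=
    h.free i j k (((hg i).symm.add (hg k).symm).trans (hijk.trans ((hg j).mul_left 2)))
  cover r := by
    rcases h.cover r with ⟨i, hi⟩ | ⟨i, j, hij, hr⟩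
    · exact Or.inl ⟨i, (hg i).trans hi⟩
    · exact Or.inr ⟨i, j, hlt i j hij,
        ((hg i).add_right r).trans (hr.trans ((hg j).symm.mul_left 2))⟩

theorem lift [DecidableEq ι] (h : Modular N f) {t : ι} (ht : ∀ i, i ≠ t → f i < f t)
    (h0 : 0 < f t) (k : ℕ) : Modular N (Function.update f t (f t + N * k)) := by
  have hle : ∀ i, f i ≤ f t := fun i => by
    rcases eq_or_ne i t with rfl | hi
    · exact le_rfl
    · exact (ht i hi).le
  refine h.of_modEq (fun i => ?_) (fun i hi => ?_) (fun i j hij => ?_)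
  · rcases eq_or_ne i t with rfl | hi
    · simp [Nat.ModEq]
    · simp [hi, Nat.ModEq]
  · have : i ≠ t := by rintro rfl; omega
    simpa [this] using hi
  · have hi : i ≠ t := by rintro rfl; exact absurd (hle j) (by omega)
    rcases eq_or_ne j t with rfl | hj
    · simp only [Function.update_of_ne hi, Function.update_self]
      omega
    · simpa [hi, hj] using hij

theorem free_triple (h : Modular N f) {w : ℕ} (hw : Nat.Coprime 3 w) {g : ι × Bool → ℕ}
    (hg : ∀ p, g p ≡ 3 * f p.1 + w * p.2.toNat [MOD 3 * N]) (p q r : ι × Bool)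
    (hpqr : g p + g r ≡ 2 * g q [MOD 3 * N]) : p = q := by
  have h1 := (((hg p).add (hg r)).symm.trans (hpqr.trans ((hg q).mul_left 2)))
  obtain ⟨i, a⟩ := p
  obtain ⟨j, b⟩ := q
  obtain ⟨k, c⟩ := r
  simp only at h1
  have h2 : 3 * (f i + f k) + w * (a.toNat + c.toNat) ≡
      3 * (2 * f j) + w * (2 * b.toNat) [MOD 3 * N] := by
    convert h1 using 1 <;> ring
  have h3 : w * (a.toNat + c.toNat) ≡ w * (2 * b.toNat) [MOD 3] := by
    simpa [Nat.ModEq, Nat.add_mod] using h2.of_mul_right N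
  have h4 := Nat.ModEq.cancel_left_of_coprime hw h3
  have hab := bool_eq_of_modEq a b c h4
  have hcb := bool_eq_of_modEq c b a (by rwa [add_comm])
  subst hab hcb
  rw [← two_mul] at h2
  have h5 := (Nat.ModEq.add_right_cancel' _ h2).mul_left_cancel' (by norm_num)
  rw [h.free i j k h5]

end Modular

theorem modEq_triple {N a b k n p q r x y z : ℕ} (hn : n ≡ z + 3 * q [MOD 3 * N])
    (h : a + (q + k) ≡ 2 * b [MOD N]) (hxyz : x + z = 2 * y + 3 * k)
    (hp : p ≡ 3 * a + x [MOD 3 * N]) (hr : r ≡ 3 * b + y [MOD 3 * N]) :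
    p + n ≡ 2 * r [MOD 3 * N] := by
  have h1 := hp.add hn
  rw [show 3 * a + x + (z + 3 * q) = 3 * (a + (q + k)) + 2 * y by omega] at h1
  have h2 := (h.mul_left' 3).add_right (2 * y)
  have h3 := hr.mul_left 2
  rw [show 2 * (3 * b + y) = 3 * (2 * b) + 2 * y by ring] at h3
  exact h1.trans (h2.trans h3.symm)

theorem modEq_three_cases {w : ℕ} (hw : Nat.Coprime 3 w) (n : ℕ) :
    0 ≡ n [MOD 3] ∨ w ≡ n [MOD 3] ∨ 2 * w ≡ n [MOD 3] := by
  have h : ¬ 3 ∣ w := (Nat.Prime.coprime_iff_not_dvd Nat.prime_three).1 hw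
  simp only [Nat.ModEq]
  have hw' : w % 3 = 1 ∨ w % 3 = 2 := by omega
  rcases hw' with hw' | hw' <;> rw [Nat.mul_mod, hw'] <;> omega

theorem Modular.triple_add {ι : Type} {N : ℕ} {f : ι → ℕ} (h : Modular N f) {w : ℕ}
    (hw : Nat.Coprime 3 w) :
    Modular (3 * N) (fun p : ι × Bool => 3 * f p.1 + w * p.2.toNat) where
  pos := by have := h.pos; omega
  zero := by
    obtain ⟨i, hi⟩ := h.zero
    exact ⟨(i, false), by simp [hi]⟩
  free := h.free_triple hw fun _ => rfl
  cover := by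
    intro n
    have hw0 : 0 < w := by
      rcases Nat.eq_zero_or_pos w with rfl | h0
      · simp at hw
      · exact h0
    have member : ∀ e : Bool, w * e.toNat ≡ n [MOD 3] →
        (∃ p : ι × Bool, 3 * f p.1 + w * p.2.toNat ≡ n [MOD 3 * N]) ∨
        ∃ p q : ι × Bool, 3 * f p.1 + w * p.2.toNat < 3 * f q.1 + w * q.2.toNat ∧
          3 * f p.1 + w * p.2.toNat + n ≡ 2 * (3 * f q.1 + w * q.2.toNat) [MOD 3 * N] := by
      intro e he
      obtain ⟨q, hq⟩ := exists_modEq_add_mul (by norm_num) h.pos he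
      rcases h.cover q with ⟨i, hi⟩ | ⟨i, j, hij, hr⟩
      · refine Or.inl ⟨(i, e), ?_⟩
        rw [add_comm]
        exact ((hi.mul_left' 3).add_left _).trans hq.symm
      · exact Or.inr ⟨(i, e), (j, e), by simpa using hij,
          modEq_triple (k := 0) hq (by simpa using hr) (by ring) rfl rfl⟩
    rcases modEq_three_cases hw n with h3 | h3 | h3
    · exact member false (by simpa using h3)
    · exact member true (by simpa using h3)
    · obtain ⟨q, hq⟩ := exists_modEq_add_mul (by norm_num) h.pos h3
      rcases h.cover q with ⟨i, hi⟩ | ⟨i, j, hij, hr⟩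
      · refine Or.inr ⟨(i, false), (i, true), by simpa using hw0,
          modEq_triple (k := 0) (a := f i) (b := f i) hq ?_ ?_ rfl rfl⟩
        · rw [two_mul]
          exact hi.symm.add_left _
        · simp
      · refine Or.inr ⟨(i, false), (j, true), ?_,
          modEq_triple (k := 0) hq (by simpa using hr) ?_ rfl rfl⟩
        · simp only [Bool.toNat_false, Bool.toNat_true]
          omega
        · simp

/-- A modular family whose largest value is used to continue progressions only together with
values that lie more than `N` below it. -/
structure Detached {ι : Type} (N : ℕ) (f : ι → ℕ) (t : ι) : Prop extends Modular N f where
  lt_top : ∀ i, i ≠ t → f i < f t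
  le_top : N ≤ f t
  cover_lt : ∀ r, (∃ i, f i ≡ r [MOD N]) ∨
    ∃ i j, f i < f j ∧ f i + r ≡ 2 * f j [MOD N] ∧ (j = t → f i + N < f t)
  gap : ∃ v, 0 < v ∧ v < 3 ∧ ∀ i, ¬ f i ≡ f t + v [MOD N]

theorem Modular.detached_lift {ι : Type} [DecidableEq ι] {N : ℕ} {f : ι → ℕ} (h : Modular N f)
    {t : ι} (ht : ∀ i, i ≠ t → f i < f t) (h0 : 0 < f t)
    (hgap : ∃ v, 0 < v ∧ v < 3 ∧ ∀ i, ¬ f i ≡ f t + v [MOD N]) :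
    Detached N (Function.update f t (f t + N)) t := by
  have hm := h.lift ht h0 1
  rw [mul_one] at hm
  have hlt : ∀ i, i ≠ t → Function.update f t (f t + N) i < Function.update f t (f t + N) t := by
    intro i hi
    have := ht i hi
    simp only [Function.update_of_ne hi, Function.update_self]
    omega
  refine ⟨hm, hlt, by simp, fun r => ?_, ?_⟩
  · rcases hm.cover r with h1 | ⟨i, j, hij, hr⟩
    · exact Or.inl h1
    · refine Or.inr ⟨i, j, hij, hr, ?_⟩
      rintro rfl
      have hi : i ≠ j := by rintro rfl; exact lt_irrefl _ hij
      have := ht i hi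
      simp only [Function.update_of_ne hi, Function.update_self]
      omega
  · obtain ⟨v, hv0, hv3, hv⟩ := hgap
    refine ⟨v, hv0, hv3, fun i hi => hv i ?_⟩
    have h1 : f t + N + v ≡ f t + v [MOD N] := by
      rw [add_right_comm]
      simp [Nat.ModEq]
    rcases eq_or_ne i t with rfl | hit
    · have h2 : f i + N ≡ f i [MOD N] := by simp [Nat.ModEq]
      simp only [Function.update_self] at hi
      exact h2.symm.trans (hi.trans h1)
    · simp only [Function.update_of_ne hit, Function.update_self] at hi
      exact hi.trans h1

open Classical in
/-- The triple of a family together with its translate by `v`, where the translate of the largest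
value is lowered so that the triple of the largest value remains the largest. -/
noncomputable def tripleLowered {ι : Type} (N : ℕ) (f : ι → ℕ) (t : ι) (v : ℕ)
    (p : ι × Bool) : ℕ :=
  if p = (t, true) then 3 * (f t - N) + v else 3 * f p.1 + v * p.2.toNat

section TripleLowered

variable {ι : Type} {N : ℕ} {f : ι → ℕ} {t : ι} {v : ℕ}

theorem tripleLowered_false (i : ι) : tripleLowered N f t v (i, false) = 3 * f i := by
  simp [tripleLowered]

theorem tripleLowered_true {i : ι} (hi : i ≠ t) :
    tripleLowered N f t v (i, true) = 3 * f i + v := by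
  simp [tripleLowered, hi]

theorem tripleLowered_top : tripleLowered N f t v (t, true) = 3 * (f t - N) + v := by
  simp [tripleLowered]

theorem tripleLowered_modEq (hN : N ≤ f t) (p : ι × Bool) :
    tripleLowered N f t v p ≡ 3 * f p.1 + v * p.2.toNat [MOD 3 * N] := by
  by_cases hp : p = (t, true)
  · subst hp
    rw [tripleLowered_top]
    have h : 3 * f t + v = 3 * (f t - N) + v + 3 * N := by omega
    simp [h, Nat.ModEq]
  · simp [tripleLowered, hp, Nat.ModEq]

theorem Detached.triple (h : Detached N f t) : ∃ v, Detached (3 * N) (tripleLowered N f t v)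
    (t, false) := by
  obtain ⟨v, hv0, hv3, hv⟩ := h.gap
  have hw : Nat.Coprime 3 v := by
    rw [Nat.Prime.coprime_iff_not_dvd Nat.prime_three]
    omega
  have hpos := h.pos
  have htop := h.le_top
  have hle : ∀ i, f i ≤ f t := fun i => by
    rcases eq_or_ne i t with rfl | hi
    · exact le_rfl
    · exact (h.lt_top i hi).le
  have hmod := tripleLowered_modEq (v := v) htop
  have hcover : ∀ n, (∃ p, tripleLowered N f t v p ≡ n [MOD 3 * N]) ∨
      ∃ p q, tripleLowered N f t v p < tripleLowered N f t v q ∧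
        tripleLowered N f t v p + n ≡ 2 * tripleLowered N f t v q [MOD 3 * N] ∧
        (q = (t, false) →
          tripleLowered N f t v p + 3 * N < tripleLowered N f t v (t, false)) := by
    intro n
    have member : ∀ e : Bool, v * e.toNat ≡ n [MOD 3] →
        (∃ p, tripleLowered N f t v p ≡ n [MOD 3 * N]) ∨
        ∃ p q, tripleLowered N f t v p < tripleLowered N f t v q ∧
          tripleLowered N f t v p + n ≡ 2 * tripleLowered N f t v q [MOD 3 * N] ∧
          (q = (t, false) →
            tripleLowered N f t v p + 3 * N < tripleLowered N f t v (t, false)) := by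
      intro e he
      obtain ⟨q, hq⟩ := exists_modEq_add_mul (by norm_num) hpos he
      rcases h.cover_lt q with ⟨i, hi⟩ | ⟨i, j, hij, hr, hjt⟩
      · refine Or.inl ⟨(i, e), (hmod (i, e)).trans ?_⟩
        rw [add_comm]
        exact ((hi.mul_left' 3).add_left _).trans hq.symm
      · refine Or.inr ⟨(i, e), (j, e), ?_,
          modEq_triple (k := 0) hq (by simpa using hr) (by ring) (hmod _) (hmod _), ?_⟩
        · have hit : i ≠ t := by rintro rfl; exact absurd (hle j) (by omega)
          cases e
          · simp only [tripleLowered_false]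
            omega
          · rw [tripleLowered_true hit]
            rcases eq_or_ne j t with rfl | hj
            · rw [tripleLowered_top]
              have := hjt rfl
              omega
            · rw [tripleLowered_true hj]
              omega
        · intro hje
          obtain ⟨rfl, rfl⟩ := Prod.mk.inj hje
          have := hjt rfl
          simp only [tripleLowered_false]
          omega
    rcases modEq_three_cases hw n with h3 | h3 | h3
    · exact member false (by simpa using h3)
    · exact member true (by simpa using h3)
    · obtain ⟨q, hq⟩ := exists_modEq_add_mul (by norm_num) hpos h3
      rcases h.cover_lt q with ⟨i, hi⟩ | ⟨i, j, hij, hr, hjt⟩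
      · rcases eq_or_ne i t with rfl | hit
        · rcases h.cover_lt (f i + v) with ⟨b, hb⟩ | ⟨b, d, hbd, hr, hdt⟩
          · exact absurd hb (hv b)
          · have hb : b ≠ i := by rintro rfl; exact absurd (hle d) (by omega)
            refine Or.inr ⟨(b, true), (d, false), ?_,
              modEq_triple (k := v) (a := f b) (b := f d) hq ?_ ?_ (hmod _) (hmod _), ?_⟩
            · rw [tripleLowered_true hb, tripleLowered_false]
              omega
            · exact ((hi.symm.add_right v).add_left _).trans hr
            · simp
              ring
            · intro hdi
              obtain ⟨rfl, -⟩ := Prod.mk.inj hdi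
              have := hdt rfl
              rw [tripleLowered_true hb, tripleLowered_false]
              omega
        · refine Or.inr ⟨(i, false), (i, true), ?_,
            modEq_triple (k := 0) (a := f i) (b := f i) hq ?_ ?_ (hmod _) (hmod _), by simp⟩
          · rw [tripleLowered_true hit, tripleLowered_false]
            omega
          · rw [two_mul]
            exact hi.symm.add_left _
          · simp
      · refine Or.inr ⟨(i, false), (j, true), ?_,
          modEq_triple (k := 0) hq (by simpa using hr) (by simp) (hmod _) (hmod _), by simp⟩
        rw [tripleLowered_false]
        rcases eq_or_ne j t with rfl | hj
        · have := hjt rfl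
          rw [tripleLowered_top]
          omega
        · rw [tripleLowered_true hj]
          omega
  refine ⟨v, ⟨by omega, ?_, h.free_triple hw hmod, fun r => ?_⟩, ?_, ?_, hcover,
    3 - v, by omega, by omega, ?_⟩
  · obtain ⟨i, hi⟩ := h.zero
    exact ⟨(i, false), by simp [tripleLowered_false, hi]⟩
  · rcases hcover r with h1 | ⟨p, q, hpq, hr, -⟩
    · exact Or.inl h1
    · exact Or.inr ⟨p, q, hpq, hr⟩
  · rintro ⟨i, _ | _⟩ hi
    · have := h.lt_top i (by rintro rfl; exact hi rfl)
      simp only [tripleLowered_false]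
      omega
    · rw [tripleLowered_false]
      rcases eq_or_ne i t with rfl | hit
      · rw [tripleLowered_top]
        omega
      · have := h.lt_top i hit
        rw [tripleLowered_true hit]
        omega
  · rw [tripleLowered_false]
    omega
  · rintro ⟨i, e⟩ hi
    have h1 := ((hmod (i, e)).symm.trans hi).of_mul_right N
    rw [tripleLowered_false] at h1
    cases e
    · simp [Nat.ModEq] at h1
      omega
    · simp [Nat.ModEq] at h1
      omega

end TripleLowered

/-- Some modular family of `2 ^ K` values has a largest value belonging to the character
`2 * s + 1`. -/
def Realizes (s : ℕ) : Prop :=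
  ∃ (ι : Type) (_ : Fintype ι) (K N : ℕ) (f : ι → ℕ) (t : ι), Fintype.card ι = 2 ^ K ∧
    Modular N f ∧ (∀ i, i ≠ t → f i < f t) ∧ 2 * f t = 2 * s + N

theorem card_prod_bool {ι : Type} [Fintype ι] {K : ℕ} (h : Fintype.card ι = 2 ^ K) :
    Fintype.card (ι × Bool) = 2 ^ (K + 1) := by
  rw [Fintype.card_prod, h, Fintype.card_bool, pow_succ]

theorem Realizes.exists_large {s : ℕ} (h : Realizes s) (M : ℕ) :
    ∃ (ι : Type) (_ : Fintype ι) (K N : ℕ) (f : ι → ℕ) (t : ι), M ≤ N ∧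
      Fintype.card ι = 2 ^ K ∧ Modular N f ∧ (∀ i, i ≠ t → f i < f t) ∧
      2 * f t = 2 * s + N := by
  induction M with
  | zero =>
    obtain ⟨ι, hι, K, N, f, t, h⟩ := h
    exact ⟨ι, hι, K, N, f, t, Nat.zero_le _, h⟩
  | succ M ih =>
    obtain ⟨ι, hι, K, N, f, t, hMN, hcard, hm, ht, hs⟩ := ih
    have hpos := hm.pos
    refine ⟨ι × Bool, inferInstance, K + 1, N * 3, _, (t, true), by omega, card_prod_bool hcard,
      hm.append, ?_, ?_⟩
    · rintro ⟨i, e⟩ hi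
      rcases eq_or_ne i t with rfl | hit
      · cases e
        · simpa using hpos
        · exact absurd rfl hi
      · have h1 := ht i hit
        have h2 : N * e.toNat ≤ N * 1 := Nat.mul_le_mul_left _ e.toNat_le
        simp only [Bool.toNat_true]
        omega
    · simp only [Bool.toNat_true]
      omega

theorem Realizes.exists_isStanleySeq {s : ℕ} (h : Realizes s) :
    ∃ A : Finset ℕ, A.Nonempty ∧ ThreeFree ↑A ∧
      ∃ a : ℕ → ℕ, IsStanleySeq A a ∧ IndependentWithChar a ((2 * s + 1 : ℕ) : ℤ) := by
  obtain ⟨ι, hι, K, N, f, t, hMN, hcard, hm, ht, hs⟩ := h.exists_large (2 * s + 1)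
  let e := (Fintype.equivFinOfCardEq hcard).symm
  let e' := (Tuple.sort (f ∘ e)).trans e
  have hm' := hm.comp_equiv e'
  have hmono : StrictMono (f ∘ e') :=
    (Tuple.monotone_sort (f ∘ e)).strictMono_of_injective hm'.injective
  have hle : ∀ i, f i ≤ f t := fun i => by
    rcases eq_or_ne i t with rfl | hi
    · exact le_rfl
    · exact (ht i hi).le
  have hlt : ∀ i, (f ∘ e') i < N := fun i => by
    have := hle (e' i)
    simp only [Function.comp_apply]
    omega
  have hSeq := isStanleySeq_blockSeq hm' hmono hlt
  refine ⟨_, ?_, ?_, _, hSeq, ?_⟩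
  · exact Finset.Nonempty.image (by simp) _
  · intro x hx y hy z hz
    have hsub : ∀ x ∈ (↑((Finset.range (2 ^ K + 1)).image (blockSeq N (f ∘ e'))) : Set ℕ),
        x ∈ Set.range (blockSeq N (f ∘ e')) := by
      intro x hx
      obtain ⟨i, -, rfl⟩ := Finset.mem_image.1 (Finset.mem_coe.1 hx)
      exact Set.mem_range_self i
    exact blockSeq_free hm' x (hsub x hx) y (hsub y hy) z (hsub z hz)
  · exact independentWithChar_blockSeq hm' hmono (e'.symm t) (fun i => by simpa using hle (e' i))
      (by simpa using hs)

theorem Realizes.of_detached {ι : Type} [Fintype ι] {K N s : ℕ} {f : ι → ℕ} {t : ι}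
    (hcard : Fintype.card ι = 2 ^ K) (h : Detached N f t) (hs : 2 * f t = 2 * s + N) (m : ℕ) :
    Realizes (3 ^ m * s) := by
  induction m generalizing ι K N s f t with
  | zero => exact ⟨ι, inferInstance, K, N, f, t, hcard, h.toModular, h.lt_top, by simpa using hs⟩
  | succ m ih =>
    obtain ⟨v, hv⟩ := h.triple
    have := ih (s := 3 * s) (card_prod_bool hcard) hv (by rw [tripleLowered_false]; omega)
    rwa [pow_succ, mul_assoc]

/-- A decidable form of modularity. -/
def IsCertificate {n : ℕ} (N : ℕ) (f : Fin n → ℕ) : Prop :=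
  0 < N ∧ (∃ i, f i = 0) ∧ (∀ i j k, (f i + f k) % N = (2 * f j) % N → i = j) ∧
    (∀ r < N, (∃ i, f i % N = r) ∨ ∃ i j, f i < f j ∧ (f i + r) % N = (2 * f j) % N)

instance {n : ℕ} (N : ℕ) (f : Fin n → ℕ) : Decidable (IsCertificate N f) := by
  unfold IsCertificate
  infer_instance

theorem IsCertificate.modular {n N : ℕ} {f : Fin n → ℕ} (h : IsCertificate N f) :
    Modular N f := by
  obtain ⟨hpos, hzero, hfree, hcover⟩ := h
  refine ⟨hpos, hzero, hfree, fun r => ?_⟩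
  rcases hcover (r % N) (Nat.mod_lt _ hpos) with ⟨i, hi⟩ | ⟨i, j, hij, hr⟩
  · exact Or.inl ⟨i, hi⟩
  · exact Or.inr ⟨i, j, hij, by rw [Nat.add_mod_mod] at hr; exact hr⟩

theorem modular_ten : Modular 10 ![0, 1, 7, 8] :=
  IsCertificate.modular (by decide)

theorem lt_top_ten : ∀ i : Fin 4, i ≠ 3 → ![0, 1, 7, 8] i < ![0, 1, 7, 8] 3 := by decide

theorem realizes_three : Realizes 3 :=
  ⟨Fin 4, inferInstance, 2, 10, _, 3, rfl, modular_ten, lt_top_ten, rfl⟩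

section ThirtyFamily

variable {w : ℕ}

theorem lt_top_thirty (hw : 0 < w) (p : Fin 4 × Bool) (hp : p ≠ (3, true)) :
    3 * ![0, 1, 7, 8] p.1 + w * p.2.toNat < 3 * ![0, 1, 7, 8] 3 + w * true.toNat := by
  obtain ⟨i, e⟩ := p
  rcases eq_or_ne i 3 with rfl | hi
  · cases e
    · simpa using hw
    · exact absurd rfl hp
  · have h1 := lt_top_ten i hi
    have h2 : w * e.toNat ≤ w * true.toNat := Nat.mul_le_mul_left _ e.toNat_le
    simp only at h1 ⊢
    omega

theorem realizes_nine_add (hw : Nat.Coprime 3 w) (hw0 : 0 < w) : Realizes (9 + w) := by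
  refine ⟨Fin 4 × Bool, inferInstance, 3, 3 * 10, _, (3, true), card_prod_bool (K := 2) rfl,
    modular_ten.triple_add hw, lt_top_thirty hw0, ?_⟩
  simp
  omega

theorem realizes_three_pow_mul (hw : Nat.Coprime 3 w) (hw0 : 0 < w) (m : ℕ) :
    Realizes (3 ^ m * (39 + w)) := by
  classical
  have hw3 : ¬ 3 ∣ w := (Nat.Prime.coprime_iff_not_dvd Nat.prime_three).1 hw
  refine Realizes.of_detached (card_prod_bool (K := 2) rfl)
    ((modular_ten.triple_add hw).detached_lift (t := (3, true)) (lt_top_thirty hw0)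
      (by simp) ?_) (by simp; omega) m
  refine ⟨w % 3, by omega, by omega, ?_⟩
  rintro ⟨i, e⟩ hi
  have h := hi.of_mul_right 10
  cases e <;> simp [Nat.ModEq] at h <;> omega

end ThirtyFamily

/-- Moduli together with increasing modular families. -/
def certificates : List (ℕ × (Fin 8 → ℕ)) :=
  [(28, ![0, 4, 5, 9, 15, 17, 20, 22]),
   (28, ![0, 1, 3, 4, 19, 20, 22, 23]),
   (28, ![0, 5, 11, 13, 16, 18, 24, 29]),
   (28, ![0, 5, 11, 15, 16, 20, 26, 31]),
   (28, ![0, 1, 9, 10, 12, 13, 31, 32]),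
   (28, ![0, 11, 15, 16, 20, 26, 31, 33]),
   (28, ![0, 1, 9, 10, 25, 26, 34, 35]),
   (28, ![0, 5, 15, 17, 20, 22, 32, 37]),
   (28, ![0, 1, 9, 12, 13, 31, 32, 38]),
   (28, ![0, 5, 13, 16, 18, 24, 29, 39]),
   (28, ![0, 1, 3, 9, 32, 38, 40, 41]),
   (28, ![0, 5, 9, 17, 20, 22, 32, 43]),
   (28, ![0, 5, 11, 13, 18, 24, 29, 44]),
   (28, ![0, 1, 19, 20, 25, 26, 44, 45]),
   (28, ![0, 5, 11, 13, 16, 24, 29, 46]),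
   (28, ![0, 24, 25, 27, 43, 44, 46, 47]),
   (28, ![0, 3, 4, 19, 22, 23, 29, 48]),
   (28, ![0, 3, 19, 22, 27, 30, 46, 49]),
   (28, ![0, 5, 13, 16, 18, 29, 39, 52]),
   (28, ![0, 13, 17, 23, 30, 36, 40, 53]),
   (28, ![0, 1, 9, 10, 34, 35, 53, 54]),
   (28, ![0, 15, 17, 23, 32, 38, 40, 55]),
   (28, ![0, 27, 31, 36, 37, 39, 40, 58]),
   (28, ![0, 1, 10, 25, 26, 35, 37, 62]),
   (28, ![0, 9, 12, 27, 31, 39, 58, 64]),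
   (28, ![0, 1, 3, 9, 32, 38, 41, 68]),
   (30, ![0, 1, 3, 4, 10, 13, 14, 21]),
   (30, ![0, 7, 10, 17, 19, 26, 36, 39]),
   (30, ![0, 7, 9, 20, 29, 36, 56, 57]),
   (30, ![0, 23, 31, 34, 40, 41, 44, 63]),
   (32, ![0, 2, 3, 5, 23, 25, 26, 28])]

theorem certificates_valid : ∀ c ∈ certificates, IsCertificate c.1 c.2 ∧
    (∀ i : Fin 8, i ≠ 7 → c.2 i < c.2 7) := by
  decide +kernel

theorem realizes_of_certificate {s : ℕ}
    (h : ∃ c ∈ certificates, ∃ k, 2 * (c.2 7 + c.1 * k) = 2 * s + c.1) : Realizes s := by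
  obtain ⟨c, hc, k, hk⟩ := h
  obtain ⟨hcert, hlt⟩ := certificates_valid c hc
  have h0 : 0 < c.2 7 := lt_of_le_of_lt (Nat.zero_le _) (hlt 0 (by decide))
  refine ⟨Fin 8, inferInstance, 3, c.1, _, 7, rfl, hcert.modular.lift hlt h0 k, ?_, ?_⟩
  · intro i hi
    have := hlt i hi
    simp only [Function.update_of_ne hi, Function.update_self]
    omega
  · simpa using hk

theorem realizes_of_lt_sixty {s : ℕ} (hs : s < 60) (h3 : 3 ∣ s) (h0 : 3 < s) : Realizes s := by
  have h : ∀ s < 60, 3 ∣ s → 3 < s →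
      ∃ c ∈ certificates, ∃ k < 3, 2 * (c.2 7 + c.1 * k) = 2 * s + c.1 := by
    decide +kernel
  obtain ⟨c, hc, k, -, hk⟩ := h s hs h3 h0
  exact realizes_of_certificate ⟨c, hc, k, hk⟩

theorem realizes_eight : Realizes 8 :=
  realizes_of_certificate ⟨(28, ![0, 4, 5, 9, 15, 17, 20, 22]), by simp [certificates], 0, rfl⟩

theorem realizes_of_residue {s N s₀ : ℕ} (hs : s₀ ≤ s) (hN : s₀ ≡ s [MOD N])
    (h : ∃ c ∈ certificates, c.1 = N ∧ 2 * c.2 7 = 2 * s₀ + N) : Realizes s := by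
  obtain ⟨c, hc, rfl, h⟩ := h
  obtain ⟨k, hk⟩ := (Nat.modEq_iff_dvd' hs).1 hN
  refine realizes_of_certificate ⟨c, hc, k, ?_⟩
  rw [mul_add]
  omega

theorem realizes_of_mod_twentyEight {s : ℕ} (hs : 60 ≤ s) (h14 : ¬ 14 ∣ s) : Realizes s := by
  have h : ∀ r < 28, ¬ 14 ∣ r → ∃ s₀ < 60, s₀ % 28 = r ∧
      ∃ c ∈ certificates, c.1 = 28 ∧ 2 * c.2 7 = 2 * s₀ + 28 := by
    decide +kernel
  obtain ⟨s₀, hs₀, hr, hc⟩ := h (s % 28) (Nat.mod_lt _ (by norm_num)) (by omega)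
  exact realizes_of_residue (by omega) hr hc

theorem realizes_of_mod_thirty {s : ℕ} (hs : 60 ≤ s) (h6 : 6 ∣ s) (h5 : ¬ 5 ∣ s) :
    Realizes s := by
  have h : ∀ r < 30, 6 ∣ r → ¬ 5 ∣ r → ∃ s₀ < 60, s₀ % 30 = r ∧
      ∃ c ∈ certificates, c.1 = 30 ∧ 2 * c.2 7 = 2 * s₀ + 30 := by
    decide +kernel
  obtain ⟨s₀, hs₀, hr, hc⟩ := h (s % 30) (Nat.mod_lt _ (by norm_num)) (by omega) (by omega)
  exact realizes_of_residue (by omega) hr hc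

theorem realizes_of_not_mem {s : ℕ} (hs : s ∉ ({0, 1, 2, 4, 5, 7} : Set ℕ)) : Realizes s := by
  simp only [Set.mem_insert_iff, Set.mem_singleton_iff, not_or] at hs
  obtain ⟨h0, h1, h2, h4, h5, h7⟩ := hs
  by_cases h3 : 3 ∣ s
  · rcases eq_or_ne s 3 with rfl | hs3
    · exact realizes_three
    rcases lt_or_ge s 60 with hlt | hge
    · exact realizes_of_lt_sixty hlt h3 (by omega)
    by_cases h14 : 14 ∣ s
    · obtain ⟨m, q, hq, rfl⟩ := Nat.exists_eq_pow_mul_and_not_dvd h0 3 (by norm_num)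
      rcases lt_or_ge q 40 with hq40 | hq40
      · have hq14 : 14 ∣ q :=
          (Nat.Coprime.pow_right m (by norm_num : Nat.Coprime 14 3)).dvd_of_dvd_mul_left h14
        refine realizes_of_mod_thirty hge (by omega) fun h5 => ?_
        have hq5 : 5 ∣ q :=
          (Nat.Coprime.pow_right m (by norm_num : Nat.Coprime 5 3)).dvd_of_dvd_mul_left h5
        omega
      · obtain ⟨w, rfl⟩ := Nat.exists_eq_add_of_le (show 39 ≤ q by omega)
        refine realizes_three_pow_mul ?_ (by omega) m
        rw [Nat.Prime.coprime_iff_not_dvd Nat.prime_three]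
        omega
    · exact realizes_of_mod_twentyEight hge h14
  · rcases eq_or_ne s 8 with rfl | h8
    · exact realizes_eight
    obtain ⟨w, rfl⟩ := Nat.exists_eq_add_of_le (show 9 ≤ s by omega)
    refine realizes_nine_add ?_ (by omega)
    rw [Nat.Prime.coprime_iff_not_dvd Nat.prime_three]
    omega

theorem odd_characters (lam : ℕ) (hpos : 0 < lam) (hodd : Odd lam)
    (hlam : lam ∉ ({1, 3, 5, 9, 11, 15} : Set ℕ)) :
    ∃ A : Finset ℕ, A.Nonempty ∧ ThreeFree ↑A ∧
      ∃ a : ℕ → ℕ, IsStanleySeq A a ∧ IndependentWithChar a (lam : ℤ) := by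
  obtain ⟨s, rfl⟩ := hodd
  refine (realizes_of_not_mem fun hs => hlam ?_).exists_isStanleySeq
  simp only [Set.mem_insert_iff, Set.mem_singleton_iff] at hs ⊢
  omega
end

section
/- Let N and M be positive integers. If A is near-modular modulo N and B is near-modular modulo M, then the set A + N·B = {a + N·b : a ∈ A, b ∈ B} is near-modular modulo N·M. -/
/-- `z` is mod-covered by `A` modulo `N`. -/
def ModCovered (N : ℕ) (A : Set ℕ) (z : ℤ) : Prop :=
  ∃ x ∈ A, ∃ y ∈ A, x ≤ y ∧ 2 * (y : ℤ) - (x : ℤ) ≡ z [ZMOD (N : ℤ)]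

/-- `A` is 3-free modulo `N`: any mod-AP in `A` is trivial. -/
def ThreeFreeMod (N : ℕ) (A : Set ℕ) : Prop :=
  ∀ x ∈ A, ∀ y ∈ A, ∀ z ∈ A,
    ((x : ℤ) + (z : ℤ) ≡ 2 * (y : ℤ) [ZMOD (N : ℤ)]) → x = y ∧ y = z

/-- `A` is a near-modular set modulo `N`. -/
def NearModular (N : ℕ) (A : Finset ℕ) : Prop :=
  0 ∈ A ∧ ThreeFreeMod N ↑A ∧ ∀ z : ℤ, ModCovered N ↑A z

/-- `A` is a modular set modulo `N`: near-modular and contained in `{0, …, N-1}`. -/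
def ModularSet (N : ℕ) (A : Finset ℕ) : Prop :=
  NearModular N A ∧ ∀ a ∈ A, a < N

theorem nearModular_product (N M : ℕ) (hN : 0 < N) (hM : 0 < M)
    (A B : Finset ℕ) (hA : NearModular N A) (hB : NearModular M B) :
    NearModular (N * M) (Finset.image₂ (fun a b => a + N * b) A B) := by
  obtain ⟨hA0, hAfree, hAcov⟩ := hA
  obtain ⟨hB0, hBfree, hBcov⟩ := hB
  have hN0 : (N : ℤ) ≠ 0 := by exact_mod_cast hN.ne'
  refine ⟨Finset.mem_image₂.2 ⟨0, hA0, 0, hB0, by simp⟩, ?_, fun z => ?_⟩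
  · intro x hx y hy z hz h
    obtain ⟨a, ha, b, hb, rfl⟩ := Finset.mem_image₂.1 (Finset.mem_coe.1 hx)
    obtain ⟨a', ha', b', hb', rfl⟩ := Finset.mem_image₂.1 (Finset.mem_coe.1 hy)
    obtain ⟨a'', ha'', b'', hb'', rfl⟩ := Finset.mem_image₂.1 (Finset.mem_coe.1 hz)
    obtain ⟨k, hk⟩ := h.dvd
    push_cast at hk
    obtain ⟨rfl, rfl⟩ := hAfree a ha a' ha' a'' ha'' <|
      Int.modEq_iff_dvd.2 ⟨M * k - (2 * b' - b - b''), by linear_combination hk⟩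
    obtain ⟨rfl, rfl⟩ := hBfree b hb b' hb' b'' hb'' <|
      Int.modEq_iff_dvd.2 ⟨k, mul_left_cancel₀ hN0 (by linear_combination hk)⟩
    exact ⟨rfl, rfl⟩
  · obtain ⟨x, hx, y, hy, hxy, h⟩ := hAcov z
    obtain ⟨w, hw⟩ := h.dvd
    obtain ⟨u, hu, v, hv, huv, h'⟩ := hBcov w
    obtain ⟨k, hk⟩ := h'.dvd
    refine ⟨x + N * u, Finset.mem_coe.2 (Finset.mem_image₂_of_mem hx hu),
      y + N * v, Finset.mem_coe.2 (Finset.mem_image₂_of_mem hy hv), by gcongr,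
      Int.modEq_iff_dvd.2 ⟨k, ?_⟩⟩
    push_cast
    linear_combination hw + (N : ℤ) * hk
end

section
/- Let N be a positive integer and let L be a near-modular set modulo N with maximum element t such that the cardinality of L is a power of two. Then there exists a finite 3-free set A of nonnegative integers such that the Stanley sequence S(A) is independent with character 2t + 1 − N. -/
lemma ternaryOfBinary_zero : ternaryOfBinary 0 = 0 := by
  simp [ternaryOfBinary]

lemma ternaryOfBinary_eq (n : ℕ) :
    ternaryOfBinary n = 3 * ternaryOfBinary (n / 2) + n % 2 := by
  rcases Nat.eq_zero_or_pos n with rfl | hn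
  · simp [ternaryOfBinary]
  · simp only [ternaryOfBinary]
    rw [Nat.digits_def' (by norm_num) hn, Nat.ofDigits_cons]
    ring

lemma ternaryOfBinary_strictMono : StrictMono ternaryOfBinary := by
  intro m n
  induction n using Nat.strong_induction_on generalizing m with
  | _ n ih =>
    intro h
    rw [ternaryOfBinary_eq m, ternaryOfBinary_eq n]
    rcases (Nat.div_le_div_right h.le : m / 2 ≤ n / 2).lt_or_eq with hlt | heq
    · have := ih (n / 2) (by omega) hlt
      omega
    · rw [heq]
      omega

lemma ternaryOfBinary_threeFree {x y z : ℕ}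
    (h : ternaryOfBinary x + ternaryOfBinary z = 2 * ternaryOfBinary y) : x = y := by
  induction y using Nat.strong_induction_on generalizing x z with
  | _ y ih =>
    rcases Nat.eq_zero_or_pos y with rfl | hy
    · rw [ternaryOfBinary_zero] at h
      apply ternaryOfBinary_strictMono.injective
      rw [ternaryOfBinary_zero]
      omega
    · rw [ternaryOfBinary_eq x, ternaryOfBinary_eq y, ternaryOfBinary_eq z] at h
      have := ih (y / 2) (by omega) (x := x / 2) (z := z / 2) (by omega)
      omega

lemma exists_ternaryOfBinary_cover (q : ℕ) :
    ∃ x y, x ≤ y ∧ q + ternaryOfBinary x = 2 * ternaryOfBinary y := by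
  induction q using Nat.strong_induction_on with
  | _ q ih =>
    rcases Nat.eq_zero_or_pos q with rfl | hq
    · exact ⟨0, 0, le_rfl, by simp [ternaryOfBinary_zero]⟩
    · obtain ⟨x, y, hxy, h⟩ := ih (q / 3) (by omega)
      have bit (n b : ℕ) (hb : b < 2) :
          ternaryOfBinary (2 * n + b) = 3 * ternaryOfBinary n + b := by
        rw [ternaryOfBinary_eq, show (2 * n + b) / 2 = n by omega,
          show (2 * n + b) % 2 = b by omega]
      have h3 : q % 3 < 3 := Nat.mod_lt _ (by norm_num)
      obtain h0 | h1 | h2 : q % 3 = 0 ∨ q % 3 = 1 ∨ q % 3 = 2 := by omega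
      · refine ⟨2 * x + 0, 2 * y + 0, by omega, ?_⟩
        rw [bit _ _ (by norm_num), bit _ _ (by norm_num)]
        omega
      · refine ⟨2 * x + 1, 2 * y + 1, by omega, ?_⟩
        rw [bit _ _ (by norm_num), bit _ _ (by norm_num)]
        omega
      · refine ⟨2 * x + 0, 2 * y + 1, by omega, ?_⟩
        rw [bit _ _ (by norm_num), bit _ _ (by norm_num)]
        omega

lemma ternaryOfBinary_two_pow_add (n : ℕ) {q : ℕ} (hq : q < 2 ^ n) :
    ternaryOfBinary (2 ^ n + q) = 3 ^ n + ternaryOfBinary q := by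
  induction n generalizing q with
  | zero =>
    obtain rfl : q = 0 := by simpa using hq
    simp [ternaryOfBinary]
  | succ n ih =>
    rw [ternaryOfBinary_eq, ternaryOfBinary_eq q, pow_succ, pow_succ,
      show (2 ^ n * 2 + q) / 2 = 2 ^ n + q / 2 by omega, ih (by rw [pow_succ] at hq; omega)]
    omega

lemma ternaryOfBinary_two_pow_sub_one (n : ℕ) :
    2 * ternaryOfBinary (2 ^ n - 1) + 1 = 3 ^ n := by
  induction n with
  | zero => simp [ternaryOfBinary]
  | succ n ih =>
    have : 0 < 2 ^ n := by positivity
    rw [ternaryOfBinary_eq, show (2 ^ (n + 1) - 1) / 2 = 2 ^ n - 1 by rw [pow_succ]; omega,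
      show (2 ^ (n + 1) - 1) % 2 = 1 by rw [pow_succ]; omega, pow_succ]
    omega

lemma ThreeFreeMod.eq_of_modEq {N : ℕ} {A : Set ℕ} (hA : ThreeFreeMod N A) {x y : ℕ}
    (hx : x ∈ A) (hy : y ∈ A) (h : (x : ℤ) ≡ y [ZMOD N]) : x = y := by
  refine (hA x hx y hy y hy ?_).1
  rw [two_mul]
  exact h.add_right _

lemma ThreeFree.mono {S T : Set ℕ} (hT : ThreeFree T) (h : S ⊆ T) : ThreeFree S :=
  fun x hx y hy z hz => hT x (h hx) y (h hy) z (h hz)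

/-- The union of `L` and `L + N`. -/
def doubled (N : ℕ) (L : Finset ℕ) : Finset ℕ :=
  L ∪ L.image (· + N)

lemma mem_doubled {N : ℕ} {L : Finset ℕ} {x : ℕ} :
    x ∈ doubled N L ↔ ∃ u ∈ L, ∃ a < 2, x = u + a * N := by
  simp only [doubled, Finset.mem_union, Finset.mem_image]
  constructor
  · rintro (h | ⟨u, hu, rfl⟩)
    · exact ⟨x, h, 0, by norm_num, by simp⟩
    · exact ⟨u, hu, 1, by norm_num, by simp⟩
  · rintro ⟨u, hu, a, ha, rfl⟩
    interval_cases a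
    · left; simpa using hu
    · right; exact ⟨u, hu, by simp⟩

lemma NearModular.union_shift {N : ℕ} (hN : 0 < N) {L : Finset ℕ} (hL : NearModular N L) :
    NearModular (3 * N) (doubled N L) := by
  obtain ⟨h0, hfree, hcov⟩ := hL
  refine ⟨mem_doubled.2 ⟨0, h0, 0, by norm_num, by simp⟩, ?_, ?_⟩
  · intro x hx y hy z hz h
    obtain ⟨u, hu, a, ha, rfl⟩ := mem_doubled.1 hx
    obtain ⟨v, hv, b, hb, rfl⟩ := mem_doubled.1 hy
    obtain ⟨w, hw, c, hc, rfl⟩ := mem_doubled.1 hz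
    obtain ⟨s, hs⟩ := h.dvd
    push_cast at hs
    obtain ⟨rfl, rfl⟩ := hfree u hu v hv w hw <| Int.modEq_iff_dvd.2
      ⟨3 * s - 2 * b + a + c, by linear_combination hs⟩
    have hN' : (N : ℤ) ≠ 0 := by exact_mod_cast hN.ne'
    have : 2 * (b : ℤ) - a - c = 3 * s :=
      mul_left_cancel₀ hN' (by linear_combination hs)
    obtain ⟨rfl, rfl⟩ : a = b ∧ b = c := by
      interval_cases a <;> interval_cases b <;> interval_cases c <;> omega
    exact ⟨rfl, rfl⟩
  · intro z
    obtain ⟨x, hx, y, hy, hxy, h⟩ := hcov z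
    obtain ⟨s, hs⟩ := h.dvd
    obtain ⟨a, b, k, hb, hab, hk⟩ :
        ∃ a b : ℕ, ∃ k : ℤ, b < 2 ∧ a ≤ b ∧ 2 * (b : ℤ) - a = s - 3 * k := by
      obtain h | h | h : s % 3 = 0 ∨ s % 3 = 1 ∨ s % 3 = 2 := by omega
      · exact ⟨0, 0, s / 3, by norm_num, le_rfl, by omega⟩
      · exact ⟨1, 1, s / 3, by norm_num, le_rfl, by omega⟩
      · exact ⟨0, 1, s / 3, by norm_num, by norm_num, by omega⟩
    refine ⟨x + a * N, mem_doubled.2 ⟨x, hx, a, by omega, rfl⟩,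
      y + b * N, mem_doubled.2 ⟨y, hy, b, hb, rfl⟩,
      Nat.add_le_add hxy (Nat.mul_le_mul_right _ hab), Int.modEq_iff_dvd.2 ⟨k, ?_⟩⟩
    push_cast
    linear_combination hs - (N : ℤ) * hk

lemma NearModular.card_doubled {N : ℕ} (hN : 0 < N) {L : Finset ℕ} (hL : NearModular N L) :
    (doubled N L).card = 2 * L.card := by
  rw [doubled, Finset.card_union_of_disjoint,
    Finset.card_image_of_injective _ (add_left_injective N), two_mul]
  rw [Finset.disjoint_left]
  intro x hx hx'
  obtain ⟨u, hu, rfl⟩ := Finset.mem_image.1 hx'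
  have := hL.2.1.eq_of_modEq hx hu (by push_cast; simp)
  omega

lemma isGreatest_doubled {N t : ℕ} {L : Finset ℕ} (ht : IsGreatest (L : Set ℕ) t) :
    IsGreatest (doubled N L : Set ℕ) (t + N) := by
  refine ⟨mem_doubled.2 ⟨t, ht.1, 1, by norm_num, by simp⟩, fun x hx => ?_⟩
  obtain ⟨u, hu, a, ha, rfl⟩ := mem_doubled.1 hx
  have := ht.2 hu
  interval_cases a <;> omega

lemma NearModular.exists_scaled {N : ℕ} (hN : 0 < N) {L : Finset ℕ} (hL : NearModular N L)
    {t j : ℕ} (ht : IsGreatest (L : Set ℕ) t) (hcard : L.card = 2 ^ j) (m : ℕ) :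
    ∃ (M : Finset ℕ) (u : ℕ), NearModular (3 ^ m * N) M ∧ IsGreatest (M : Set ℕ) u ∧
      M.card = 2 ^ (j + m) ∧ 2 * u + N = 2 * t + 3 ^ m * N := by
  induction m with
  | zero => exact ⟨L, t, by simpa using hL, ht, hcard, by simp⟩
  | succ m ih =>
    obtain ⟨M, u, hM, hu, hc, he⟩ := ih
    have hpos : 0 < 3 ^ m * N := by positivity
    refine ⟨doubled (3 ^ m * N) M, u + 3 ^ m * N, ?_, isGreatest_doubled hu, ?_, ?_⟩
    · rw [show 3 ^ (m + 1) * N = 3 * (3 ^ m * N) by ring]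
      exact hM.union_shift hpos
    · rw [hM.card_doubled hpos, hc, ← add_assoc, pow_succ, mul_comm]
    · rw [pow_succ]
      linarith

lemma NearModular.exists_modularSet {N : ℕ} (hN : 0 < N) {L : Finset ℕ} (hL : NearModular N L)
    {t j : ℕ} (ht : IsGreatest (L : Set ℕ) t) (hcard : L.card = 2 ^ j) :
    ∃ (N' : ℕ) (M : Finset ℕ) (u i : ℕ), 0 < N' ∧ ModularSet N' M ∧ IsGreatest (M : Set ℕ) u ∧
      M.card = 2 ^ i ∧ 2 * u + N = 2 * t + N' := by
  obtain ⟨M, u, hM, hu, hc, he⟩ := hL.exists_scaled hN ht hcard (2 * t)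
  refine ⟨3 ^ (2 * t) * N, M, u, j + 2 * t, by positivity, ⟨hM, fun a ha => ?_⟩, hu, hc, he⟩
  have h1 : 2 * t < 3 ^ (2 * t) := Nat.lt_pow_self (by norm_num)
  have h2 : 3 ^ (2 * t) ≤ 3 ^ (2 * t) * N := Nat.le_mul_of_pos_right _ hN
  have := hu.2 ha
  omega

/-- The increasing enumeration of `L + N * S`, where `L ⊆ [0, N)` has `2 ^ j` elements and `S`
is the Stanley sequence of `{0}`. -/
def modularSeq (N : ℕ) {L : Finset ℕ} {j : ℕ} (hc : L.card = 2 ^ j) (k : ℕ) : ℕ :=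
  N * ternaryOfBinary (k / 2 ^ j) +
    L.orderEmbOfFin hc ⟨k % 2 ^ j, Nat.mod_lt _ (by positivity)⟩

section ModularSeq

variable {N : ℕ} {L : Finset ℕ} {j : ℕ} (hc : L.card = 2 ^ j)

lemma mem_range_modularSeq {x : ℕ} :
    x ∈ Set.range (modularSeq N hc) ↔ ∃ q, ∃ u ∈ L, x = N * ternaryOfBinary q + u := by
  constructor
  · rintro ⟨k, rfl⟩
    exact ⟨_, _, L.orderEmbOfFin_mem hc _, rfl⟩
  · rintro ⟨q, u, hu, rfl⟩
    rw [← Finset.mem_coe, ← Finset.range_orderEmbOfFin L hc] at hu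
    obtain ⟨i, rfl⟩ := hu
    refine ⟨2 ^ j * q + i, ?_⟩
    have h1 : (2 ^ j * q + i) / 2 ^ j = q := by
      rw [Nat.mul_add_div (by positivity), Nat.div_eq_of_lt i.2, add_zero]
    have h2 : (2 ^ j * q + (i : ℕ)) % 2 ^ j = i := by
      rw [Nat.mul_add_mod, Nat.mod_eq_of_lt i.2]
    simp only [modularSeq, h1, h2]

lemma modularSeq_strictMono (hlt : ∀ a ∈ L, a < N) : StrictMono (modularSeq N hc) := by
  intro m n h
  simp only [modularSeq]
  rcases (Nat.div_le_div_right h.le : m / 2 ^ j ≤ n / 2 ^ j).lt_or_eq with hq | hq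
  · have h1 := Nat.mul_le_mul_left N (Nat.succ_le_of_lt (ternaryOfBinary_strictMono hq))
    have h2 := hlt _ (L.orderEmbOfFin_mem hc ⟨m % 2 ^ j, Nat.mod_lt _ (by positivity)⟩)
    rw [Nat.mul_succ] at h1
    omega
  · rw [hq]
    refine Nat.add_lt_add_left ((L.orderEmbOfFin hc).strictMono ?_) _
    rw [Fin.mk_lt_mk]
    have h1 := Nat.div_add_mod m (2 ^ j)
    have h2 := Nat.div_add_mod n (2 ^ j)
    rw [hq] at h1
    omega

lemma threeFree_range_modularSeq (hN : 0 < N) (hfree : ThreeFreeMod N L) :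
    ThreeFree (Set.range (modularSeq N hc)) := by
  intro x hx y hy z hz hxy _ h
  obtain ⟨p, u, hu, rfl⟩ := (mem_range_modularSeq hc).1 hx
  obtain ⟨q, v, hv, rfl⟩ := (mem_range_modularSeq hc).1 hy
  obtain ⟨r, w, hw, rfl⟩ := (mem_range_modularSeq hc).1 hz
  obtain ⟨rfl, rfl⟩ := hfree u hu v hv w hw <| Int.modEq_iff_dvd.2
    ⟨ternaryOfBinary p + ternaryOfBinary r - 2 * ternaryOfBinary q, by
      zify at h
      linear_combination -h⟩
  have := ternaryOfBinary_threeFree (x := p) (y := q) (z := r)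
    (Nat.eq_of_mul_eq_mul_left hN (by linarith))
  subst this
  exact lt_irrefl _ hxy

lemma exists_cover_of_notMem_range_modularSeq (hL : ModularSet N L) {m : ℕ} (hm : N ≤ m)
    (hmem : m ∉ Set.range (modularSeq N hc)) :
    ∃ x ∈ Set.range (modularSeq N hc), ∃ y ∈ Set.range (modularSeq N hc),
      x < y ∧ x + m = 2 * y := by
  obtain ⟨x, hx, y, hy, hxy, h⟩ := hL.1.2.2 m
  obtain ⟨s, hs⟩ := h.dvd
  have hxN := hL.2 x hx
  have hyN := hL.2 y hy
  have hs0 : 0 ≤ s := by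
    by_contra! hneg
    nlinarith
  lift s to ℕ using hs0
  obtain ⟨p, q, hpq, hcov⟩ := exists_ternaryOfBinary_cover s
  have heq : (N * ternaryOfBinary p + x) + m = 2 * (N * ternaryOfBinary q + y) := by
    zify at hcov ⊢
    linear_combination hs + (N : ℤ) * hcov
  have hle : N * ternaryOfBinary p + x ≤ N * ternaryOfBinary q + y :=
    Nat.add_le_add (Nat.mul_le_mul_left _ (ternaryOfBinary_strictMono.monotone hpq)) hxy
  refine ⟨_, (mem_range_modularSeq hc).2 ⟨p, x, hx, rfl⟩,
    _, (mem_range_modularSeq hc).2 ⟨q, y, hy, rfl⟩, hle.lt_of_ne fun hne => hmem ?_, heq⟩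
  exact (mem_range_modularSeq hc).2 ⟨p, x, hx, by omega⟩

lemma modularSeq_two_pow_add (n : ℕ) {i : ℕ} (hi : i < 2 ^ (j + n)) :
    modularSeq N hc (2 ^ (j + n) + i) = N * 3 ^ n + modularSeq N hc i := by
  have h1 : (2 ^ (j + n) + i) / 2 ^ j = 2 ^ n + i / 2 ^ j := by
    rw [pow_add, Nat.mul_add_div (by positivity)]
  have h2 : (2 ^ (j + n) + i) % 2 ^ j = i % 2 ^ j := by
    rw [pow_add, Nat.mul_add_mod]
  have h3 : i / 2 ^ j < 2 ^ n := Nat.div_lt_of_lt_mul (by rwa [← pow_add])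
  simp only [modularSeq, h1, h2, ternaryOfBinary_two_pow_add n h3]
  ring

lemma modularSeq_zero (h0 : 0 ∈ L) : modularSeq N hc 0 = 0 := by
  have : L.orderEmbOfFin hc 0 = 0 := by
    refine (Finset.orderEmbOfFin_zero hc (by positivity)).trans ?_
    exact Nat.le_zero.1 (L.min'_le 0 h0)
  simp [modularSeq, ternaryOfBinary_zero, this]

lemma modularSeq_two_pow (h0 : 0 ∈ L) (n : ℕ) : modularSeq N hc (2 ^ (j + n)) = N * 3 ^ n := by
  simpa [modularSeq_zero hc h0] using modularSeq_two_pow_add (N := N) hc n (i := 0) (by positivity)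

lemma modularSeq_two_pow_sub_one {t : ℕ} (ht : IsGreatest (L : Set ℕ) t) (n : ℕ) :
    2 * modularSeq N hc (2 ^ (j + n) - 1) + N = N * 3 ^ n + 2 * t := by
  have hj : 0 < 2 ^ j := by positivity
  have hn : 0 < 2 ^ n := by positivity
  have hsplit : 2 ^ (j + n) - 1 = 2 ^ j * (2 ^ n - 1) + (2 ^ j - 1) := by
    obtain ⟨b, hb⟩ := Nat.exists_eq_succ_of_ne_zero hn.ne'
    rw [pow_add, hb, Nat.succ_sub_one, Nat.mul_succ]
    omega
  have h1 : (2 ^ (j + n) - 1) / 2 ^ j = 2 ^ n - 1 := by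
    rw [hsplit, Nat.mul_add_div hj, Nat.div_eq_of_lt (by omega), add_zero]
  have h2 : (2 ^ (j + n) - 1) % 2 ^ j = 2 ^ j - 1 := by
    rw [hsplit, Nat.mul_add_mod, Nat.mod_eq_of_lt (by omega)]
  have h3 : L.orderEmbOfFin hc ⟨2 ^ j - 1, by omega⟩ = t := by
    rw [Finset.orderEmbOfFin_last hc hj]
    exact (L.isGreatest_max' _).unique ht
  simp only [modularSeq, h1, h2, h3]
  rw [← ternaryOfBinary_two_pow_sub_one n]
  ring

lemma isStanleySeq_modularSeq (hN : 0 < N) (hL : ModularSet N L) :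
    IsStanleySeq ((Finset.range (2 ^ j + 1)).image (modularSeq N hc)) (modularSeq N hc) := by
  have hmono := modularSeq_strictMono hc hL.2
  have hcard : ((Finset.range (2 ^ j + 1)).image (modularSeq N hc)).card = 2 ^ j + 1 := by
    rw [Finset.card_image_of_injective _ hmono.injective, Finset.card_range]
  refine ⟨hmono, fun i hi => ?_, fun k hk => ⟨⟨hmono k.lt_succ_self, ?_⟩, ?_⟩⟩
  · rw [hcard] at hi
    exact Finset.mem_image_of_mem _ (Finset.mem_range.2 hi)
  · refine (threeFree_range_modularSeq hc hN hL.1.2.1).mono ?_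
    rintro x (⟨i, -, rfl⟩ | rfl) <;> exact Set.mem_range_self _
  · rintro m ⟨hkm, hfree⟩
    by_contra! hlt
    rw [hcard] at hk
    have hNm : N ≤ m := by
      have h1 : modularSeq N hc (2 ^ j) = N := by
        simpa using modularSeq_two_pow (N := N) hc hL.1.1 0
      have h2 := hmono.monotone (show 2 ^ j ≤ k by omega)
      omega
    obtain ⟨x, ⟨i, rfl⟩, y, ⟨l, rfl⟩, hxy, h⟩ :=
      exists_cover_of_notMem_range_modularSeq hc hL hNm (by
        rintro ⟨i, rfl⟩
        have h1 := hmono.lt_iff_lt.1 hkm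
        have h2 := hmono.lt_iff_lt.1 hlt
        omega)
    have hl : l < k + 1 := hmono.lt_iff_lt.1 (by omega)
    have hi : i < l := hmono.lt_iff_lt.1 hxy
    exact hfree _ (Or.inl ⟨i, Set.mem_Iic.2 (by omega), rfl⟩)
      _ (Or.inl ⟨l, Set.mem_Iic.2 (by omega), rfl⟩) m (Or.inr rfl) hxy (by omega) h

lemma independentWithChar_modularSeq (h0 : 0 ∈ L) {t : ℕ} (ht : IsGreatest (L : Set ℕ) t) :
    IndependentWithChar (modularSeq N hc) (2 * (t : ℤ) + 1 - N) := by
  refine ⟨j, fun k hk => ?_⟩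
  obtain ⟨n, rfl⟩ := Nat.exists_eq_add_of_le hk
  rw [modularSeq_two_pow hc h0]
  refine ⟨fun i hi => modularSeq_two_pow_add hc n hi, ?_⟩
  have := modularSeq_two_pow_sub_one (N := N) hc ht n
  zify at this
  push_cast
  linarith

end ModularSeq

theorem nearModular_to_character (N : ℕ) (hN : 0 < N) (L : Finset ℕ) (hL : L.Nonempty)
    (hnm : NearModular N L) (t : ℕ) (ht : L.max' hL = t)
    (hcard : ∃ j : ℕ, L.card = 2 ^ j) :
    ∃ A : Finset ℕ, A.Nonempty ∧ ThreeFree ↑A ∧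
      ∃ a : ℕ → ℕ, IsStanleySeq A a ∧
        IndependentWithChar a (2 * (t : ℤ) + 1 - (N : ℤ)) := by
  obtain ⟨j, hj⟩ := hcard
  have htop : IsGreatest (L : Set ℕ) t := ht ▸ L.isGreatest_max' hL
  obtain ⟨N', M, u, i, hN', hM, hu, hc, he⟩ := hnm.exists_modularSet hN htop hj
  refine ⟨(Finset.range (2 ^ i + 1)).image (modularSeq N' hc), by simp, ?_, modularSeq N' hc,
    isStanleySeq_modularSeq hc hN' hM, ?_⟩
  · refine (threeFree_range_modularSeq hc hN' hM.1.2.1).mono ?_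
    rw [Finset.coe_image]
    exact Set.image_subset_range _ _
  · have hchar : 2 * (t : ℤ) + 1 - N = 2 * (u : ℤ) + 1 - N' := by omega
    rw [hchar]
    exact independentWithChar_modularSeq hc hM.1.1 hu
end

section
/- Let N be a positive integer, let L be a near-modular set modulo N with maximum element t, and for k ≥ 1 let E_k = { Σ_{i=0}^{k−1} ε_i 3^i : each ε_i ∈ {0,1} } be the set of nonnegative integers less than 3^k all of whose ternary digits are 0 or 1. If k satisfies t + N·(3^k − 1)/2 < N·3^k, then the set L + N·E_k = {ℓ + N·e : ℓ ∈ L, e ∈ E_k} is a modular set modulo N·3^k whose maximum element is t + N·(3^k − 1)/2. -/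
/-- The set of nonnegative integers less than `3^k` all of whose ternary
digits are 0 or 1. -/
def ternary01 (k : ℕ) : Finset ℕ :=
  (Finset.range (3 ^ k)).filter (fun m => ∀ d ∈ Nat.digits 3 m, d ≤ 1)

theorem mem_ternary01_succ {k e : ℕ} :
    e ∈ ternary01 (k + 1) ↔ ∃ m ∈ ternary01 k, ∃ d ≤ 1, e = d + 3 * m := by
  simp only [ternary01, Finset.mem_filter, Finset.mem_range]
  constructor
  · rintro ⟨hlt, hdig⟩
    refine ⟨e / 3, ⟨by rw [pow_succ] at hlt; omega, fun d hd => ?_⟩, e % 3, ?_,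
      (Nat.mod_add_div e 3).symm⟩
    · rcases Nat.eq_zero_or_pos e with rfl | he
      · simp at hd
      · exact hdig d (by rw [Nat.digits_def' (by norm_num) he]; exact List.mem_cons_of_mem _ hd)
    · rcases Nat.eq_zero_or_pos e with rfl | he
      · simp
      · exact hdig _ (by rw [Nat.digits_def' (by norm_num) he]; exact List.mem_cons_self)
  · rintro ⟨m, ⟨hlt, hdig⟩, d, hd, rfl⟩
    refine ⟨by rw [pow_succ]; omega, fun c hc => ?_⟩
    rcases Nat.eq_zero_or_pos (d + 3 * m) with h0 | hpos
    · simp [h0] at hc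
    · rw [Nat.digits_def' (by norm_num) hpos, List.mem_cons] at hc
      rcases hc with rfl | hc
      · omega
      · rw [show (d + 3 * m) / 3 = m by omega] at hc
        exact hdig c hc

theorem ternary01_zero : ternary01 0 = {0} := by
  ext e
  simp only [ternary01, Finset.mem_filter, Finset.mem_range, Finset.mem_singleton, pow_zero,
    Nat.lt_one_iff, and_iff_left_iff_imp]
  rintro rfl
  simp

theorem two_mul_add_one_le_of_mem_ternary01 {k e : ℕ} (he : e ∈ ternary01 k) :
    2 * e + 1 ≤ 3 ^ k := by
  induction k generalizing e with
  | zero => simp_all [ternary01_zero]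
  | succ k ih =>
    obtain ⟨m, hm, d, hd, rfl⟩ := mem_ternary01_succ.1 he
    have := ih hm
    rw [pow_succ]
    omega

theorem exists_mem_ternary01_two_mul_add_one_eq (k : ℕ) :
    ∃ e ∈ ternary01 k, 2 * e + 1 = 3 ^ k := by
  induction k with
  | zero => exact ⟨0, by simp [ternary01_zero]⟩
  | succ k ih =>
    obtain ⟨m, hm, h⟩ := ih
    exact ⟨1 + 3 * m, mem_ternary01_succ.2 ⟨m, hm, 1, le_rfl, rfl⟩, by rw [pow_succ]; omega⟩

theorem NearModular.image₂_zero_one {N : ℕ} (hN : 0 < N) {L : Finset ℕ} (h : NearModular N L) :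
    NearModular (N * 3) (Finset.image₂ (fun l e => l + N * e) L {0, 1}) := by
  obtain ⟨h0, hfree, hcov⟩ := h
  have hN0 : (N : ℤ) ≠ 0 := by exact_mod_cast hN.ne'
  refine ⟨Finset.mem_image₂.2 ⟨0, h0, 0, by simp⟩, ?_, fun z => ?_⟩
  · intro x hx y hy z hz hxyz
    obtain ⟨a, ha, i, hi, rfl⟩ := Finset.mem_image₂.1 (Finset.mem_coe.1 hx)
    obtain ⟨b, hb, j, hj, rfl⟩ := Finset.mem_image₂.1 (Finset.mem_coe.1 hy)
    obtain ⟨c, hc, l, hl, rfl⟩ := Finset.mem_image₂.1 (Finset.mem_coe.1 hz)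
    obtain ⟨q, hq⟩ := Int.modEq_iff_dvd.1 hxyz
    push_cast at hq
    obtain ⟨rfl, rfl⟩ := hfree a ha b hb c hc
      (Int.modEq_iff_dvd.2 ⟨3 * q - 2 * j + i + l, by linear_combination hq⟩)
    have hdigits : (2 * j - i - l : ℤ) = 3 * q :=
      mul_left_cancel₀ hN0 (by linear_combination hq)
    simp only [Finset.mem_insert, Finset.mem_singleton] at hi hj hl
    have hij : i = j := by omega
    have hjl : j = l := by omega
    simp [hij, hjl]
  · obtain ⟨x, hx, y, hy, hxy, hz⟩ := hcov z
    obtain ⟨q, hq⟩ := Int.modEq_iff_dvd.1 hz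
    have key : ∀ i ∈ ({0, 1} : Finset ℕ), ∀ j ∈ ({0, 1} : Finset ℕ), i ≤ j →
        (3 : ℤ) ∣ q - (2 * j - i) →
        ModCovered (N * 3) ↑(Finset.image₂ (fun l e => l + N * e) L {0, 1}) z := by
      rintro i hi j hj hij ⟨r, hr⟩
      refine ⟨x + N * i, Finset.mem_coe.2 (Finset.mem_image₂_of_mem hx hi),
        y + N * j, Finset.mem_coe.2 (Finset.mem_image₂_of_mem hy hj), by gcongr,
        Int.modEq_iff_dvd.2 ⟨r, ?_⟩⟩
      push_cast
      linear_combination hq + N * hr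
    have hmod : q % 3 = 0 ∨ q % 3 = 1 ∨ q % 3 = 2 := by omega
    rcases hmod with h | h | h
    · exact key 0 (by simp) 0 (by simp) le_rfl (by push_cast; omega)
    · exact key 1 (by simp) 1 (by simp) le_rfl (by push_cast; omega)
    · exact key 0 (by simp) 1 (by simp) zero_le_one (by push_cast; omega)

theorem image₂_ternary01_succ (N : ℕ) (L : Finset ℕ) (k : ℕ) :
    Finset.image₂ (fun l e => l + N * e) L (ternary01 (k + 1)) =
      Finset.image₂ (fun l e => l + N * 3 * e)
        (Finset.image₂ (fun l e => l + N * e) L {0, 1}) (ternary01 k) := by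
  ext a
  simp only [Finset.mem_image₂]
  constructor
  · rintro ⟨l, hl, e, he, rfl⟩
    obtain ⟨m, hm, d, hd, rfl⟩ := mem_ternary01_succ.1 he
    exact ⟨l + N * d, ⟨l, hl, d, by simp; omega, rfl⟩, m, hm, by ring⟩
  · rintro ⟨_, ⟨l, hl, d, hd, rfl⟩, m, hm, rfl⟩
    simp only [Finset.mem_insert, Finset.mem_singleton] at hd
    exact ⟨l, hl, d + 3 * m, mem_ternary01_succ.2 ⟨m, hm, d, by omega, rfl⟩, by ring⟩

theorem NearModular.image₂_ternary01 {N : ℕ} (hN : 0 < N) {L : Finset ℕ} (h : NearModular N L)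
    (k : ℕ) :
    NearModular (N * 3 ^ k) (Finset.image₂ (fun l e => l + N * e) L (ternary01 k)) := by
  induction k generalizing N L with
  | zero => simpa [ternary01_zero] using h
  | succ k ih =>
    rw [image₂_ternary01_succ, pow_succ', ← mul_assoc]
    exact ih (by positivity) (h.image₂_zero_one hN)

theorem nearModular_to_modular (N : ℕ) (hN : 0 < N) (L : Finset ℕ) (hL : L.Nonempty)
    (hnm : NearModular N L) (t : ℕ) (ht : L.max' hL = t)
    (k : ℕ) (hk : 1 ≤ k) (hbound : t + N * (3 ^ k - 1) / 2 < N * 3 ^ k) :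
    ModularSet (N * 3 ^ k) (Finset.image₂ (fun l e => l + N * e) L (ternary01 k)) ∧
    ∃ h : (Finset.image₂ (fun l e => l + N * e) L (ternary01 k)).Nonempty,
      (Finset.image₂ (fun l e => l + N * e) L (ternary01 k)).max' h
        = t + N * (3 ^ k - 1) / 2 := by
  obtain ⟨m, hm, hm3⟩ := exists_mem_ternary01_two_mul_add_one_eq k
  have htop : N * (3 ^ k - 1) / 2 = N * m := by
    rw [← hm3, Nat.add_sub_cancel, mul_left_comm, Nat.mul_div_cancel_left _ two_pos]
  rw [htop] at hbound ⊢
  have hle : ∀ a ∈ Finset.image₂ (fun l e => l + N * e) L (ternary01 k), a ≤ t + N * m := by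
    intro a ha
    obtain ⟨l, hl, e, he, rfl⟩ := Finset.mem_image₂.1 ha
    have hem : e ≤ m := by
      have := two_mul_add_one_le_of_mem_ternary01 he
      omega
    have hlt : l ≤ t := ht ▸ L.le_max' l hl
    gcongr
  have hmem : t + N * m ∈ Finset.image₂ (fun l e => l + N * e) L (ternary01 k) :=
    Finset.mem_image₂.2 ⟨t, ht ▸ L.max'_mem hL, m, hm, rfl⟩
  exact ⟨⟨hnm.image₂_ternary01 hN k, fun a ha => (hle a ha).trans_lt hbound⟩, ⟨_, hmem⟩,
    le_antisymm (Finset.max'_le _ _ _ hle) (Finset.le_max' _ _ hmem)⟩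
end
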